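/- arXiv:0910.3569 — 2 statements merged into one kernel-verified Lean document; each statement's English description precedes it below -/
import Mathlib

section
/- Let k be an algebraically closed field of characteristic zero, let d ≥ 1 and s ≥ 0 be integers. Then there exist a plane Π (a 3-dimensional linear subspace of k^5) and s pairwise disjoint lines L_1,…,L_s (2-dimensional linear subspaces of k^5) in P^4, each line disjoint from Π, such that the ideal I_X = I(Π) ∩ I(L_1) ∩ ⋯ ∩ I(L_s) in k[x_0,…,x_4] satisfies dim (I_X)_d = max{ C(d+4,4) − C(d+2,2) − s(d+1), 0 }. -/
open MvPolynomial

noncomputable def vanIdeal (k : Type) [Field k] (N : ℕ) (V : Set (Fin N → k)) :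
    Ideal (MvPolynomial (Fin N) k) where
  carrier := {f | ∀ v ∈ V, MvPolynomial.eval v f = 0}
  add_mem' := by
    intro f g hf hg v hv
    simp only [Set.mem_setOf_eq] at *
    simp [map_add, hf v hv, hg v hv]
  zero_mem' := by
    intro v hv
    simp
  smul_mem' := by
    intro c f hf v hv
    simp only [Set.mem_setOf_eq] at *
    simp [smul_eq_mul, hf v hv]

noncomputable def hdim (k : Type) [Field k] (N : ℕ)
    (I : Ideal (MvPolynomial (Fin N) k)) (d : ℕ) : ℕ :=
  Module.finrank k
    ↥(Submodule.restrictScalars k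
        (I : Submodule (MvPolynomial (Fin N) k) (MvPolynomial (Fin N) k))
      ⊓ MvPolynomial.homogeneousSubmodule (Fin N) k d)

namespace PL

section basics
variable {k : Type} [Field k]

/-- A property holding on a nonempty basic open set. -/
def Gen {T : Type} (P : (T → k) → Prop) : Prop :=
  ∃ Φ : MvPolynomial T k, Φ ≠ 0 ∧ ∀ τ, eval τ Φ ≠ 0 → P τ

theorem Gen.and {T : Type} {P Q : (T → k) → Prop} (hP : Gen P) (hQ : Gen Q) :
    Gen (fun τ => P τ ∧ Q τ) := by
  obtain ⟨a, ha, ha'⟩ := hP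
  obtain ⟨b, hb, hb'⟩ := hQ
  refine ⟨a * b, mul_ne_zero ha hb, fun τ h => ?_⟩
  rw [map_mul] at h
  exact ⟨ha' τ (left_ne_zero_of_mul h), hb' τ (right_ne_zero_of_mul h)⟩

theorem Gen.all {T ι : Type} [Finite ι] {P : ι → (T → k) → Prop} (hP : ∀ i, Gen (P i)) :
    Gen (fun τ => ∀ i, P i τ) := by
  classical
  cases nonempty_fintype ι
  choose a ha ha' using hP
  refine ⟨∏ i, a i, Finset.prod_ne_zero_iff.2 fun i _ => ha i, fun τ h i => ?_⟩
  rw [map_prod] at h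
  exact ha' i τ (Finset.prod_ne_zero_iff.1 h i (Finset.mem_univ _))

theorem Gen.exists [Infinite k] {T : Type} {P : (T → k) → Prop} (hP : Gen P) : ∃ τ, P τ := by
  obtain ⟨a, ha, ha'⟩ := hP
  by_contra hc
  push Not at hc
  apply ha
  apply MvPolynomial.funext
  intro τ
  by_contra h
  exact hc τ (ha' τ (by simpa using h))

theorem gen_ne {T : Type} (Φ : MvPolynomial T k) (τ0 : T → k) (h : eval τ0 Φ ≠ 0) :
    Gen (fun τ => eval τ Φ ≠ 0) :=
  ⟨Φ, fun h0 => h (by simp [h0]), fun _ h => h⟩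

theorem Gen.mono {T : Type} {P Q : (T → k) → Prop} (hP : Gen P) (h : ∀ τ, P τ → Q τ) : Gen Q := by
  obtain ⟨a, ha, ha'⟩ := hP
  exact ⟨a, ha, fun τ ht => h τ (ha' τ ht)⟩

/-- Openness of joint injectivity. -/
theorem gen_inj {T J V : Type} [Finite J] [AddCommGroup V] [Module k V] [FiniteDimensional k V]
    (φ : J → V →ₗ[k] MvPolynomial T k) (τ0 : T → k)
    (h : ∀ v, (∀ j, eval τ0 (φ j v) = 0) → v = 0) :
    Gen (fun τ => ∀ v, (∀ j, eval τ (φ j v) = 0) → v = 0) := by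
  classical
  cases nonempty_fintype J
  let n := Module.finrank k V
  let b : Module.Basis (Fin n) k V := Module.finBasis k V
  let E : (T → k) → V →ₗ[k] (J → k) := fun τ =>
    LinearMap.pi fun j => (MvPolynomial.aeval τ).toLinearMap ∘ₗ φ j
  have hE : ∀ τ v j, E τ v j = eval τ (φ j v) := by
    intro τ v j
    simp [E, MvPolynomial.aeval_eq_eval]
  have hinj : LinearMap.ker (E τ0) = ⊥ := by
    rw [LinearMap.ker_eq_bot']
    intro v hv
    exact h v fun j => by rw [← hE, hv]; rfl
  obtain ⟨B, hB⟩ := (E τ0).exists_leftInverse_of_injective hinj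
  let M : Matrix (Fin n) (Fin n) (MvPolynomial T k) :=
    Matrix.of fun i l => ∑ j, C (b.repr (B (Pi.single j 1)) i) * φ j (b l)
  have key : ∀ τ, (eval τ).mapMatrix M = LinearMap.toMatrix b b (B ∘ₗ E τ) := by
    intro τ
    ext i l
    rw [LinearMap.toMatrix_apply]
    simp only [M, RingHom.mapMatrix_apply, Matrix.map_apply, Matrix.of_apply, map_sum, map_mul,
      eval_C, LinearMap.comp_apply]
    have h1 : E τ (b l) = ∑ j, eval τ (φ j (b l)) • Pi.single j (1 : k) := by
      ext j
      simp [hE, Finset.sum_apply, Pi.single_apply]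
    rw [h1]
    simp only [map_sum, map_smul, Finsupp.finsetSum_apply, Finsupp.smul_apply, smul_eq_mul]
    exact Finset.sum_congr rfl fun j _ => mul_comm _ _
  have key2 : ∀ τ, eval τ M.det = LinearMap.det (B ∘ₗ E τ) := by
    intro τ
    rw [RingHom.map_det, key, LinearMap.det_toMatrix]
  refine ⟨M.det, ?_, ?_⟩
  · intro h0
    have h2 := key2 τ0
    rw [h0, hB] at h2
    simp at h2
  · intro τ hτ v hv
    rw [key2] at hτ
    have h2 : E τ v = 0 := by
      ext j
      rw [hE, hv]; rfl
    have h3 : (LinearMap.equivOfDetNeZero (B ∘ₗ E τ) hτ) v = 0 := by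
      change (B ∘ₗ E τ) v = 0
      simp [h2]
    exact (LinearEquiv.map_eq_zero_iff _).1 h3

/-- Upper semicontinuity of kernel dimensions. -/
theorem gen_ker {T J V : Type} [Finite J] [AddCommGroup V] [Module k V]
    (U : Submodule k V) [FiniteDimensional k U]
    (φ : J → V →ₗ[k] MvPolynomial T k) (K : (T → k) → Submodule k V)
    (hK : ∀ τ v, v ∈ K τ ↔ v ∈ U ∧ ∀ j, eval τ (φ j v) = 0)
    (τ0 : T → k) (r : ℕ) (h : Module.finrank k (K τ0) ≤ r) :
    Gen (fun τ => Module.finrank k (K τ) ≤ r) := by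
  have hle : ∀ τ, K τ ≤ U := fun τ v hv => ((hK τ v).1 hv).1
  obtain ⟨C0, hC⟩ := Submodule.exists_isCompl ((K τ0).comap U.subtype)
  let C := C0.map U.subtype
  have hCU : C ≤ U := by
    rintro _ ⟨x, _, rfl⟩
    exact x.2
  have : FiniteDimensional k C := Submodule.finiteDimensional_of_le hCU
  have hdim : Module.finrank k (K τ0) + Module.finrank k C = Module.finrank k U := by
    have h1 := Submodule.finrank_add_eq_of_isCompl hC
    rw [← h1]
    congr 1
    · exact ((Submodule.comapSubtypeEquivOfLe (hle τ0)).finrank_eq).symm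
    · exact ((Submodule.equivMapOfInjective U.subtype U.injective_subtype C0).finrank_eq).symm
  have hg := gen_inj (V := C) (fun j => φ j ∘ₗ C.subtype) τ0 (by
    rintro ⟨c, hc⟩ hz
    obtain ⟨x, hx, rfl⟩ := hc
    have hxK : x ∈ (K τ0).comap U.subtype := by
      rw [Submodule.mem_comap, hK]
      exact ⟨x.2, fun j => by simpa using hz j⟩
    have := (Submodule.disjoint_def.1 hC.disjoint) x hxK hx
    simp [this])
  refine hg.mono fun τ hτ => ?_
  have hbot : K τ ⊓ C = ⊥ := by
    rw [eq_bot_iff]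
    rintro c ⟨hcK, hcC⟩
    have := hτ ⟨c, hcC⟩ (fun j => by simpa using ((hK τ c).1 hcK).2 j)
    simpa using this
  have : FiniteDimensional k (K τ) := Submodule.finiteDimensional_of_le (hle τ)
  have h1 := Submodule.finrank_sup_add_finrank_inf_eq (K τ) C
  rw [hbot, finrank_bot] at h1
  have h2 := Submodule.finrank_mono (sup_le (hle τ) hCU)
  omega

/-- The polynomials restricted to the plane. -/
noncomputable def eps : MvPolynomial (Fin 5) k →ₐ[k] MvPolynomial (Fin 3) k :=
  aeval ![X 0, X 1, X 2, 0, 0]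

/-- Forms of degree `d` vanishing on the plane. -/
noncomputable def W (k : Type) [Field k] (d : ℕ) : Submodule k (MvPolynomial (Fin 5) k) :=
  homogeneousSubmodule (Fin 5) k d ⊓ LinearMap.ker (eps (k := k)).toLinearMap

theorem mem_W {d : ℕ} {f : MvPolynomial (Fin 5) k} :
    f ∈ W k d ↔ f.IsHomogeneous d ∧ eps f = 0 := by
  simp [W, Submodule.mem_inf]

instance (d : ℕ) : FiniteDimensional k (homogeneousSubmodule (Fin 5) k d) :=
  Module.Finite.of_fg (homogeneousSubmodule_fg _ _ d)

instance (d : ℕ) : FiniteDimensional k (W k d) := Submodule.finiteDimensional_of_le inf_le_left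

/-- Forms of degree `d` vanishing on the plane and on `S`. -/
noncomputable def Kr (d : ℕ) (S : Set (Fin 5 → k)) : Submodule k (MvPolynomial (Fin 5) k) where
  carrier := {f | f ∈ W k d ∧ ∀ v ∈ S, eval v f = 0}
  add_mem' := by
    rintro f g ⟨hf, hf'⟩ ⟨hg, hg'⟩
    exact ⟨add_mem hf hg, fun v hv => by simp [hf' v hv, hg' v hv]⟩
  zero_mem' := ⟨zero_mem _, fun v _ => by simp⟩
  smul_mem' := by
    rintro c f ⟨hf, hf'⟩
    exact ⟨Submodule.smul_mem _ _ hf, fun v hv => by simp [hf' v hv]⟩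

theorem mem_Kr {d : ℕ} {S : Set (Fin 5 → k)} {f : MvPolynomial (Fin 5) k} :
    f ∈ Kr d S ↔ f ∈ W k d ∧ ∀ v ∈ S, eval v f = 0 := Iff.rfl

theorem Kr_le_W (d : ℕ) (S : Set (Fin 5 → k)) : Kr d S ≤ W k d := fun _ h => h.1

instance (d : ℕ) (S : Set (Fin 5 → k)) : FiniteDimensional k (Kr d S) :=
  Submodule.finiteDimensional_of_le (Kr_le_W d S)

theorem Kr_anti {d : ℕ} {S T : Set (Fin 5 → k)} (h : S ⊆ T) : Kr d T ≤ Kr d S :=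
  fun _ hf => ⟨hf.1, fun v hv => hf.2 v (h hv)⟩

/-- dimension -/
noncomputable def kap (d : ℕ) (S : Set (Fin 5 → k)) : ℕ := Module.finrank k (Kr d S)

/-- dimension of `W` -/
noncomputable def D (k : Type) [Field k] (d : ℕ) : ℕ := Module.finrank k (W k d)

theorem kap_anti {d : ℕ} {S T : Set (Fin 5 → k)} (h : S ⊆ T) : kap d T ≤ kap d S :=
  Submodule.finrank_mono (Kr_anti h)

theorem kap_le_D (d : ℕ) (S : Set (Fin 5 → k)) : kap d S ≤ D k d :=
  Submodule.finrank_mono (Kr_le_W d S)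

theorem Kr_empty (d : ℕ) : Kr d (∅ : Set (Fin 5 → k)) = W k d := by
  ext f; simp [mem_Kr]

theorem kap_empty (d : ℕ) : kap d (∅ : Set (Fin 5 → k)) = D k d := by
  rw [kap, Kr_empty, D]

/-- The (cone over the) line through two points. -/
def ln (p p' : Fin 5 → k) : Set (Fin 5 → k) := {v | ∃ a b : k, v = a • p + b • p'}

theorem left_mem_ln (p p' : Fin 5 → k) : p ∈ ln p p' := ⟨1, 0, by simp⟩
theorem right_mem_ln (p p' : Fin 5 → k) : p' ∈ ln p p' := ⟨0, 1, by simp⟩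

theorem ln_subset {p p' q q' : Fin 5 → k} (h : p ∈ ln q q') (h' : p' ∈ ln q q') :
    ln p p' ⊆ ln q q' := by
  obtain ⟨a, b, rfl⟩ := h
  obtain ⟨a', b', rfl⟩ := h'
  rintro _ ⟨x, y, rfl⟩
  exact ⟨x * a + y * a', x * b + y * b', by ext i; simp; ring⟩

theorem hom_smul {d : ℕ} {f : MvPolynomial (Fin 5) k} (hf : f.IsHomogeneous d) (a : k)
    (v : Fin 5 → k) : eval (a • v) f = a ^ d * eval v f := by
  rw [eval_eq, eval_eq, Finset.mul_sum]
  refine Finset.sum_congr rfl fun m hm => ?_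
  have h1 := hf.degree_eq_sum_deg_support hm
  simp only [Pi.smul_apply, smul_eq_mul, mul_pow, Finset.prod_mul_distrib]
  rw [Finset.prod_pow_eq_pow_sum, h1]
  ring

theorem eval_line (p p' : Fin 5 → k) (f : MvPolynomial (Fin 5) k) (c : k) :
    (aeval (fun i => Polynomial.C (p i) + Polynomial.X * Polynomial.C (p' i)) f).eval c
      = eval (p + c • p') f := by
  induction f using MvPolynomial.induction_on with
  | C a => simp
  | add f g hf hg => rw [map_add, Polynomial.eval_add, hf, hg, map_add]
  | mul_X f i hf => rw [map_mul, Polynomial.eval_mul, hf, map_mul, aeval_X, eval_X]; simp [mul_comm (p' i) c]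

/-- Vanishing at `d+1` points of a line implies vanishing on the line. -/
theorem van_line [CharZero k] {d : ℕ} {f : MvPolynomial (Fin 5) k} (hf : f.IsHomogeneous d)
    (p p' : Fin 5 → k) (h : ∀ c : Fin (d + 1), eval (p + ((c : ℕ) : k) • p') f = 0) :
    ∀ v ∈ ln p p', eval v f = 0 := by
  have h1 : ∀ c : k, eval (p + c • p') f = 0 := by
    intro c
    rw [← eval_line]
    have : (aeval (fun i => Polynomial.C (p i) + Polynomial.X * Polynomial.C (p' i)) f) = 0 := by
      refine Polynomial.eq_zero_of_natDegree_lt_card_of_eval_eq_zero _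
        (f := fun c : Fin (d + 1) => ((c : ℕ) : k)) ?_ ?_ ?_
      · intro a b hab
        exact Fin.ext (Nat.cast_injective hab)
      · intro c
        rw [eval_line, h]
      · rw [Fintype.card_fin, Nat.lt_succ_iff]
        have := MvPolynomial.aeval_natDegree_le f hf.totalDegree_le
          (fun i => Polynomial.C (p i) + Polynomial.X * Polynomial.C (p' i)) (n := 1) ?_
        · simpa using this
        · intro i
          compute_degree
    rw [this, Polynomial.eval_zero]
  rintro _ ⟨a, b, rfl⟩
  by_cases ha : a = 0
  · subst ha
    have h2 : (aeval (fun i => Polynomial.C ((b • p') i) + Polynomial.X * Polynomial.C (p i)) f)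
        = 0 := by
      refine Polynomial.eq_zero_of_infinite_isRoot _ ?_
      refine Set.Infinite.mono (s := {0}ᶜ) ?_ (Set.finite_singleton (0 : k)).infinite_compl
      intro c hc
      have hc : c ≠ 0 := by simpa using hc
      change Polynomial.eval c _ = 0
      rw [eval_line]
      have : b • p' + c • p = c • (p + (b / c) • p') := by
        ext i; simp; field_simp; ring
      rw [this, hom_smul hf, h1, mul_zero]
    have h3 := eval_line (b • p') p f 0
    rw [h2] at h3
    simpa using h3.symm
  · have : a • p + b • p' = a • (p + (b / a) • p') := by
      ext i; simp; field_simp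
    rw [this, hom_smul hf, h1, mul_zero]

/-- Evaluation of a family of points. -/
noncomputable def ev {T : Type} (τ : T → k) (p : Fin 5 → MvPolynomial T k) : Fin 5 → k := fun c => eval τ (p c)

theorem eval_aeval {T : Type} (τ : T → k) (p : Fin 5 → MvPolynomial T k)
    (f : MvPolynomial (Fin 5) k) : eval τ (aeval p f) = eval (ev τ p) f := by
  induction f using MvPolynomial.induction_on with
  | C a => simp
  | add f g hf hg => rw [map_add, map_add, hf, hg, map_add]
  | mul_X f i hf => rw [map_mul, map_mul, hf, map_mul, aeval_X, eval_X]; rfl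

theorem gen_lines [CharZero k] {T ι : Type} [Finite ι] (d : ℕ) (S0 : Set (Fin 5 → k))
    (p p' : ι → Fin 5 → MvPolynomial T k) (τ0 : T → k) (r : ℕ)
    (h : kap d (S0 ∪ ⋃ i, ln (ev τ0 (p i)) (ev τ0 (p' i))) ≤ r) :
    Gen (fun τ => kap d (S0 ∪ ⋃ i, ln (ev τ (p i)) (ev τ (p' i))) ≤ r) := by
  refine gen_ker (J := ι × Fin (d + 1)) (Kr d S0)
    (fun j => (aeval (fun c => p j.1 c + C ((j.2 : ℕ) : k) * p' j.1 c)).toLinearMap)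
    (fun τ => Kr d (S0 ∪ ⋃ i, ln (ev τ (p i)) (ev τ (p' i)))) ?_ τ0 r h
  intro τ f
  have hev : ∀ (i : ι) (c : k), ev τ (fun x => p i x + C c * p' i x)
      = ev τ (p i) + c • ev τ (p' i) := by
    intro i c; ext x; simp [ev]
  constructor
  · rintro ⟨hf, hf'⟩
    refine ⟨⟨hf, fun v hv => hf' v (Or.inl hv)⟩, fun j => ?_⟩
    rw [AlgHom.toLinearMap_apply, eval_aeval, hev]
    exact hf' _ (Or.inr (Set.mem_iUnion.2 ⟨j.1, ⟨1, _, by rw [one_smul]⟩⟩))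
  · rintro ⟨⟨hf, hf'⟩, hj⟩
    refine ⟨hf, ?_⟩
    rintro v (hv | hv)
    · exact hf' v hv
    · obtain ⟨i, hi⟩ := Set.mem_iUnion.1 hv
      refine van_line (mem_W.1 hf).1 _ _ (fun c => ?_) v hi
      have := hj (i, c)
      rwa [AlgHom.toLinearMap_apply, eval_aeval, hev] at this

/-- A line imposes at most `d+1` conditions. -/
theorem kap_line [CharZero k] (d : ℕ) (S : Set (Fin 5 → k)) (p p' : Fin 5 → k) :
    kap d S ≤ kap d (S ∪ ln p p') + (d + 1) := by
  let φ : Kr d S →ₗ[k] (Fin (d + 1) → k) :=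
    (LinearMap.pi fun c : Fin (d + 1) =>
      (MvPolynomial.aeval (p + ((c : ℕ) : k) • p')).toLinearMap) ∘ₗ (Kr d S).subtype
  have h1 := LinearMap.finrank_range_add_finrank_ker φ
  have h2 : Module.finrank k (LinearMap.range φ) ≤ d + 1 := by
    simpa using Submodule.finrank_le (LinearMap.range φ)
  have h3 : Module.finrank k (LinearMap.ker φ) ≤ kap d (S ∪ ln p p') := by
    rw [(Submodule.equivMapOfInjective _ (Kr d S).injective_subtype (LinearMap.ker φ)).finrank_eq]
    apply Submodule.finrank_mono
    rintro _ ⟨f, hf, rfl⟩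
    refine ⟨f.2.1, ?_⟩
    rintro v (hv | hv)
    · exact f.2.2 v hv
    · refine van_line (mem_W.1 f.2.1).1 _ _ (fun c => ?_) v hv
      have := congrFun (LinearMap.mem_ker.1 hf) c
      simpa [φ, MvPolynomial.aeval_eq_eval] using this
  have h4 : Module.finrank k (Kr d S) = kap d S := rfl
  omega

theorem kap_lines [CharZero k] {ι : Type} (s : Finset ι) (d : ℕ) (S : Set (Fin 5 → k))
    (p p' : ι → Fin 5 → k) :
    kap d S ≤ kap d (S ∪ ⋃ i ∈ s, ln (p i) (p' i)) + s.card * (d + 1) := by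
  classical
  induction s using Finset.induction_on with
  | empty => simp
  | insert a s ha ih =>
    have h1 := kap_line d (S ∪ ⋃ i ∈ s, ln (p i) (p' i)) (p a) (p' a)
    have h2 : S ∪ ⋃ i ∈ insert a s, ln (p i) (p' i)
        = (S ∪ ⋃ i ∈ s, ln (p i) (p' i)) ∪ ln (p a) (p' a) := by
      rw [Finset.set_biUnion_insert, Set.union_assoc, Set.union_comm (ln _ _)]
    rw [h2, Finset.card_insert_of_notMem ha, add_mul]
    omega

theorem points_nat (d : ℕ) (S Γ : Set (Fin 5 → k)) (B : ℕ) (hB : kap d (S ∪ Γ) ≤ B)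
    (hΓ : Γ.Nonempty) (N : ℕ) (h : kap d S ≤ B + N) :
    ∃ x : Fin N → Fin 5 → k, (∀ i, x i ∈ Γ) ∧ kap d (S ∪ Set.range x) ≤ B := by
  induction N generalizing S with
  | zero => exact ⟨Fin.elim0, fun i => i.elim0, by
      refine (kap_anti Set.subset_union_left).trans (by simpa using h)⟩
  | succ N ih =>
    obtain ⟨y, hy⟩ := hΓ
    by_cases hc : kap d S ≤ B
    · exact ⟨fun _ => y, fun _ => hy, (kap_anti Set.subset_union_left).trans hc⟩
    have hlt : ∃ z ∈ Γ, kap d (S ∪ {z}) < kap d S := by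
      by_contra hcon
      push Not at hcon
      have : Kr d S ≤ Kr d (S ∪ Γ) := by
        intro f hf
        refine ⟨hf.1, ?_⟩
        rintro v (hv | hv)
        · exact hf.2 v hv
        · have h1 : Kr d (S ∪ {v}) = Kr d S :=
            Submodule.eq_of_le_of_finrank_le (Kr_anti Set.subset_union_left) (hcon v hv)
          rw [← h1] at hf
          exact hf.2 v (Or.inr rfl)
      have h2 : kap d S ≤ kap d (S ∪ Γ) := Submodule.finrank_mono this
      omega
    obtain ⟨z, hz, hlt⟩ := hlt
    obtain ⟨x, hx, hx'⟩ := ih (S ∪ {z})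
      ((kap_anti (by intro v; simp; tauto)).trans hB) (by omega)
    refine ⟨Fin.cons z x, fun i => Fin.cases hz hx i, ?_⟩
    refine (kap_anti ?_).trans hx'
    rw [Fin.range_cons]
    intro v; simp; tauto

theorem points {ι : Type} [Fintype ι] (d : ℕ) (S Γ : Set (Fin 5 → k)) (B : ℕ)
    (hB : kap d (S ∪ Γ) ≤ B) (hΓ : Γ.Nonempty) (h : kap d S ≤ B + Fintype.card ι) :
    ∃ x : ι → Fin 5 → k, (∀ i, x i ∈ Γ) ∧ kap d (S ∪ Set.range x) ≤ B := by
  obtain ⟨x, hx, hx'⟩ := points_nat d S Γ B hB hΓ _ h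
  refine ⟨x ∘ Fintype.equivFin ι, fun i => hx _, ?_⟩
  rwa [EquivLike.range_comp]

/-- The residual exact sequence. -/
theorem residual (d δ : ℕ) (P : MvPolynomial (Fin 5) k) (hP0 : P ≠ 0) (hP : P.IsHomogeneous δ)
    (S T S' : Set (Fin 5 → k)) (hTS : T ⊆ S) (hTP : ∀ v ∈ T, eval v P = 0)
    (hres : ∀ g : MvPolynomial (Fin 5) k, (∀ v ∈ S, eval v (P * g) = 0) → ∀ v ∈ S', eval v g = 0) :
    kap (d + δ) S + D k d ≤ kap (d + δ) T + kap d S' := by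
  let m := LinearMap.mulLeft k P
  have hm : Function.Injective m := fun a b hab => mul_left_cancel₀ hP0 (by simpa [m] using hab)
  have hD : Module.finrank k ((W k d).map m) = D k d :=
    ((Submodule.equivMapOfInjective m hm _).finrank_eq).symm
  have hk : Module.finrank k ((Kr d S').map m) = kap d S' :=
    ((Submodule.equivMapOfInjective m hm _).finrank_eq).symm
  have h1 := Submodule.finrank_sup_add_finrank_inf_eq (Kr (d + δ) S) ((W k d).map m)
  have h2 : Kr (d + δ) S ⊓ (W k d).map m ≤ (Kr d S').map m := by
    rintro _ ⟨⟨_, hf⟩, ⟨g, hg, rfl⟩⟩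
    exact ⟨g, ⟨hg, hres g (by simpa [m] using hf)⟩, rfl⟩
  have h3 : Kr (d + δ) S ⊔ (W k d).map m ≤ Kr (d + δ) T := by
    refine sup_le (Kr_anti hTS) ?_
    rintro _ ⟨g, hg, rfl⟩
    rw [SetLike.mem_coe, mem_W] at hg
    refine ⟨mem_W.2 ⟨?_, by simp [m, hg.2]⟩, fun v hv => by simp [m, hTP v hv]⟩
    rw [add_comm]
    exact hP.mul hg.1
  have h2' := Submodule.finrank_mono h2
  have h3' := Submodule.finrank_mono h3
  rw [hk] at h2'
  rw [hD] at h1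
  change _ = kap (d + δ) S + _ at h1
  change _ ≤ kap (d + δ) T at h3'
  omega

/-- Dividing out a factor not vanishing on a line. -/
theorem div_line [Infinite k] (P g : MvPolynomial (Fin 5) k) (p p' : Fin 5 → k)
    (hP : ∃ v ∈ ln p p', eval v P ≠ 0) (h : ∀ v ∈ ln p p', eval v (P * g) = 0) :
    ∀ v ∈ ln p p', eval v g = 0 := by
  let q : Fin 5 → MvPolynomial (Fin 2) k := fun i => X 0 * C (p i) + X 1 * C (p' i)
  have hq : ∀ τ : Fin 2 → k, ev τ q = τ 0 • p + τ 1 • p' := by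
    intro τ; ext i; simp [ev, q]
  have h0 : aeval q (P * g) = 0 := by
    apply MvPolynomial.funext
    intro τ
    rw [eval_aeval, hq, map_zero]
    exact h _ ⟨_, _, rfl⟩
  rw [map_mul, mul_eq_zero] at h0
  have hall : ∀ f, aeval q f = 0 → ∀ v ∈ ln p p', eval v f = 0 := by
    rintro f hf _ ⟨a, b, rfl⟩
    have := eval_aeval ![a, b] q f
    rw [hf, hq] at this
    simpa using this.symm
  rcases h0 with h0 | h0
  · obtain ⟨v, hv, hv'⟩ := hP
    exact absurd (hall _ h0 v hv) hv'
  · exact hall _ h0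

end basics
end PL

namespace PL

section dims
variable {k : Type} [Field k]

theorem finrank_hom (n d : ℕ) :
    Module.finrank k (homogeneousSubmodule (Fin n) k d) = (n + d - 1).choose d := by
  classical
  have h1 : homogeneousSubmodule (Fin n) k d
      = restrictSupport k {m : Fin n →₀ ℕ | m.degree = d} := by
    ext f
    rw [homogeneousSubmodule_eq_finsupp_supported]
    rfl
  rw [h1, Module.finrank_eq_nat_card_basis (basisRestrictSupport k _)]
  have h2 : {m : Fin n →₀ ℕ | m.degree = d}
      = ((Finset.finsuppAntidiag Finset.univ d : Finset (Fin n →₀ ℕ)) : Set (Fin n →₀ ℕ)) := by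
    ext m
    simp [Finsupp.degree_eq_sum]
  rw [h2]
  have := Finset.card_finsuppAntidiag_nat_eq_choose (s := (Finset.univ : Finset (Fin n))) d
  rw [Finset.card_univ, Fintype.card_fin] at this
  rw [← this, Nat.card_coe_set_eq, Set.ncard_coe_finset]

theorem D_add (d : ℕ) : D k d + (d + 2).choose 2 = (d + 4).choose 4 := by
  let H := homogeneousSubmodule (Fin 5) k d
  let φ : H →ₗ[k] MvPolynomial (Fin 3) k := (eps (k := k)).toLinearMap ∘ₗ H.subtype
  have h1 := LinearMap.finrank_range_add_finrank_ker φ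
  have h2 : Module.finrank k (LinearMap.ker φ) = D k d := by
    rw [(Submodule.equivMapOfInjective _ H.injective_subtype (LinearMap.ker φ)).finrank_eq, D]
    suffices hs : (LinearMap.ker φ).map H.subtype = W k d by rw [hs]
    ext f
    simp only [Submodule.mem_map, mem_W]
    constructor
    · rintro ⟨g, hg, rfl⟩
      exact ⟨g.2, by simpa [φ] using hg⟩
    · rintro ⟨hf, hf'⟩
      exact ⟨⟨f, hf⟩, by simpa [φ] using hf', rfl⟩
  have h3 : LinearMap.range φ = homogeneousSubmodule (Fin 3) k d := by
    ext g
    constructor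
    · rintro ⟨f, rfl⟩
      have := MvPolynomial.IsHomogeneous.aeval (m := d) (n := 1) f.2 (τ := Fin 3) (S := k)
        ![X 0, X 1, X 2, 0, 0] (by
          intro i
          fin_cases i <;> simp [isHomogeneous_X, isHomogeneous_zero])
      simpa [φ, eps] using this
    · intro hg
      refine ⟨⟨rename ![0, 1, 2] g, hg.rename_isHomogeneous⟩, ?_⟩
      simp only [φ, LinearMap.comp_apply, Submodule.subtype_apply, AlgHom.toLinearMap_apply, eps,
        aeval_rename]
      have : (![X 0, X 1, X 2, 0, 0] : Fin 5 → MvPolynomial (Fin 3) k) ∘ ![0, 1, 2] = X := by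
        funext i
        fin_cases i <;> rfl
      rw [this, aeval_X_left_apply]
  rw [h2, h3, finrank_hom, finrank_hom] at h1
  have e1 : (3 + d - 1).choose d = (d + 2).choose 2 := by
    rw [show 3 + d - 1 = d + 2 by omega]
    exact (Nat.choose_symm_add)
  have e2 : (5 + d - 1).choose d = (d + 4).choose 4 := by
    rw [show 5 + d - 1 = d + 4 by omega]
    exact (Nat.choose_symm_add)
  rw [e1, e2] at h1
  omega

theorem D_formula (d : ℕ) : 24 * D k d = d * (d + 1) * (d + 2) * (d + 7) := by
  have h := D_add (k := k) d
  have h4 : (d + 4).choose 4 * 24 = (d + 4) * (d + 3) * (d + 2) * (d + 1) := by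
    have := Nat.descFactorial_eq_factorial_mul_choose (d + 4) 4
    simp [Nat.descFactorial_succ, Nat.factorial] at this
    nlinarith [this]
  have h2 : (d + 2).choose 2 * 2 = (d + 2) * (d + 1) := by
    have := Nat.descFactorial_eq_factorial_mul_choose (d + 2) 2
    simp [Nat.descFactorial_succ, Nat.factorial] at this
    nlinarith [this]
  zify at *
  nlinarith [h, h4, h2]

theorem eval_X_apply (v : Fin 5 → k) (i : Fin 5) : eval v (X i) = v i := eval_X _

/-- The quadric. -/
noncomputable def Q (k : Type) [Field k] : MvPolynomial (Fin 5) k := X 0 * X 1 - X 3 * X 4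

theorem eval_Q (v : Fin 5 → k) : eval v (Q k) = v 0 * v 1 - v 3 * v 4 := by simp [Q]

theorem Q_hom : (Q k).IsHomogeneous 2 :=
  ((isHomogeneous_X _ _).mul (isHomogeneous_X _ _)).sub
    ((isHomogeneous_X _ _).mul (isHomogeneous_X _ _))

theorem eps_Q : eps (Q k) ≠ 0 := by
  simp [Q, eps]

theorem Q_ne : Q k ≠ 0 := fun h => eps_Q (k := k) (by rw [h, map_zero])

theorem X2_ne : (X 2 : MvPolynomial (Fin 5) k) ≠ 0 := X_ne_zero _

theorem eps_X2 : eps (X 2 : MvPolynomial (Fin 5) k) ≠ 0 := by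
  simp [eps]

theorem Q_prime : Prime (Q k) := by
  apply Irreducible.prime
  have h : Q k = X 1 * X 0 + (-(X 3 * X 4)) := by rw [Q]; ring
  rw [h]
  apply irreducible_mul_X_add
  · exact X_ne_zero _
  · simp [vars_X]
  · intro h
    rw [vars_neg] at h
    have := vars_mul _ _ h
    simp [vars_X] at this
  · rw [Irreducible.isRelPrime_iff_not_dvd]
    · rw [dvd_neg]
      intro h
      rcases (X_prime (R := k) (σ := Fin 5) (i := 1)).dvd_or_dvd h with h | h
      · rw [X_dvd_X] at h; simp at h
      · rw [X_dvd_X] at h; simp at h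
    · exact (X_prime).irreducible

theorem prime_dvd [IsAlgClosed k] {P f : MvPolynomial (Fin 5) k} (hP : Prime P)
    (h : ∀ v, eval v P = 0 → eval v f = 0) : P ∣ f := by
  have : (Ideal.span {P}).IsPrime := (Ideal.span_singleton_prime hP.ne_zero).2 hP
  rw [← Ideal.mem_span_singleton, ← IsPrime.vanishingIdeal_zeroLocus (K := k) (Ideal.span {P}),
    mem_vanishingIdeal_iff]
  intro v hv
  rw [zeroLocus_span] at hv
  have := hv P rfl
  rw [MvPolynomial.aeval_eq_eval] at this ⊢
  exact h v this

/-- Homogeneous quotient. -/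
theorem hom_quot {P f : MvPolynomial (Fin 5) k} {δ d : ℕ} (hP : P.IsHomogeneous δ)
    (heps : eps P ≠ 0) (hf : f ∈ W k (d + δ)) (h : P ∣ f) : ∃ g ∈ W k d, f = P * g := by
  obtain ⟨g, rfl⟩ := h
  rw [mem_W] at hf
  have h1 : P * g = P * homogeneousComponent d g := by
    have h2 := homogeneousComponent_eq_self hf.1
    conv_lhs => rw [← h2]
    conv_lhs => rw [← sum_homogeneousComponent g, Finset.mul_sum, map_sum]
    have h3 : ∀ i, homogeneousComponent (d + δ) (P * homogeneousComponent i g)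
        = if i = d then P * homogeneousComponent d g else 0 := by
      intro i
      have h4 : (P * homogeneousComponent i g) ∈ homogeneousSubmodule (Fin 5) k (δ + i) :=
        hP.mul (homogeneousComponent_isHomogeneous i g)
      rw [homogeneousComponent_of_mem h4]
      by_cases hi : i = d
      · subst hi; simp [add_comm]
      · rw [if_neg, if_neg hi]; omega
    simp only [h3]
    rw [Finset.sum_ite_eq']
    split_ifs with h5
    · rfl
    · rw [homogeneousComponent_eq_zero, mul_zero]
      simpa using h5
  refine ⟨homogeneousComponent d g, mem_W.2 ⟨homogeneousComponent_isHomogeneous _ _, ?_⟩, h1⟩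
  have h2 := hf.2
  rw [h1, map_mul, mul_eq_zero] at h2
  exact h2.resolve_left heps

theorem hom_quot_zero {P f : MvPolynomial (Fin 5) k} {δ d : ℕ} (hP : P.IsHomogeneous δ)
    (hP0 : P ≠ 0) (hd : d < δ) (hf : f.IsHomogeneous d) (h : P ∣ f) : f = 0 := by
  by_contra hf0
  obtain ⟨g, rfl⟩ := h
  have hg : g ≠ 0 := right_ne_zero_of_mul hf0
  have h1 := totalDegree_mul_of_isDomain hP0 hg
  rw [hP.totalDegree hP0, hf.totalDegree hf0] at h1
  omega

end dims
end PL

namespace PL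

section traces
variable {k : Type} [Field k]

theorem finrank_mul {P : MvPolynomial (Fin 5) k} (hP : P ≠ 0)
    (U : Submodule k (MvPolynomial (Fin 5) k)) :
    Module.finrank k (U.map (LinearMap.mulLeft k P)) = Module.finrank k U :=
  ((Submodule.equivMapOfInjective (LinearMap.mulLeft k P)
    (fun a b hab => mul_left_cancel₀ hP (by simpa using hab)) _).finrank_eq).symm

theorem kap_Q [IsAlgClosed k] (d : ℕ) (S : Set (Fin 5 → k)) (hS : ∀ v, eval v (Q k) = 0 → v ∈ S) :
    kap (d + 2) S ≤ D k d := by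
  rw [D, ← finrank_mul (Q_ne (k := k))]
  apply Submodule.finrank_mono
  intro f hf
  obtain ⟨g, hg, rfl⟩ := hom_quot Q_hom eps_Q hf.1
    (prime_dvd Q_prime fun v hv => hf.2 v (hS v hv))
  exact ⟨g, hg, rfl⟩

theorem kap_H [IsAlgClosed k] (d : ℕ) (S : Set (Fin 5 → k)) (hS : ∀ v, v 2 = 0 → v ∈ S) :
    kap (d + 1) S ≤ D k d := by
  rw [D, ← finrank_mul (X2_ne (k := k))]
  apply Submodule.finrank_mono
  intro f hf
  obtain ⟨g, hg, rfl⟩ := hom_quot (isHomogeneous_X k 2) eps_X2 hf.1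
    (prime_dvd X_prime fun v hv => hf.2 v (hS v (by simpa using hv)))
  exact ⟨g, hg, rfl⟩

/-- Setting `x₂ = 0`. -/
noncomputable def kill : MvPolynomial (Fin 5) k →ₐ[k] MvPolynomial (Fin 5) k :=
  aeval ![X 0, X 1, 0, X 3, X 4]

theorem eval_kill (v : Fin 5 → k) (f : MvPolynomial (Fin 5) k) :
    eval v (kill f) = eval ![v 0, v 1, 0, v 3, v 4] f := by
  rw [kill, eval_aeval]
  congr 2
  funext i
  fin_cases i <;> simp [ev]

theorem kill_W {d : ℕ} {f : MvPolynomial (Fin 5) k} (hf : f ∈ W k d) : kill f ∈ W k d := by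
  rw [mem_W] at *
  constructor
  · have := MvPolynomial.IsHomogeneous.aeval (m := d) (n := 1) hf.1 (τ := Fin 5) (S := k)
        ![X 0, X 1, 0, X 3, X 4] (by
          intro i
          fin_cases i <;> simp [isHomogeneous_X, isHomogeneous_zero])
    simpa [kill] using this
  · have : (eps (k := k)).comp kill = (aeval ![X 0, X 1, 0]).comp eps := by
      apply MvPolynomial.algHom_ext
      intro i
      fin_cases i <;> simp [eps, kill]
    have h2 := DFunLike.congr_fun this f
    simpa [hf.2] using h2

theorem split_QH [IsAlgClosed k] {d : ℕ} {S : Set (Fin 5 → k)} {f : MvPolynomial (Fin 5) k}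
    (hS : ∀ v, eval v (Q k) = 0 → v 2 = 0 → v ∈ S) (hf : f ∈ Kr d S) :
    X 2 ∣ (f - kill f) ∧ Q k ∣ kill f := by
  constructor
  · apply prime_dvd X_prime
    intro v hv
    have hv : v 2 = 0 := by simpa using hv
    rw [map_sub, eval_kill, sub_eq_zero]
    congr 2
    funext i
    fin_cases i <;> simp [hv]
  · apply prime_dvd Q_prime
    intro v hv
    rw [eval_kill]
    apply hf.2 _ (hS _ _ _)
    · rw [eval_Q] at *
      simpa using hv
    · simp

theorem kap_QH [IsAlgClosed k] (d : ℕ) (S : Set (Fin 5 → k))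
    (hS : ∀ v, eval v (Q k) = 0 → v 2 = 0 → v ∈ S) :
    kap (d + 1) S + (d + 2) ^ 2 ≤ D k (d + 1) + 2 := by
  have hX : (X 2 : MvPolynomial (Fin 5) k).IsHomogeneous 1 := isHomogeneous_X k 2
  rcases d with _ | d
  · have h0 : kap (0 + 1) S ≤ D k 0 := by
      rw [D, ← finrank_mul (X2_ne (k := k))]
      apply Submodule.finrank_mono
      intro f hf
      obtain ⟨h1, h2⟩ := split_QH hS hf
      have h3 := hom_quot_zero Q_hom Q_ne (by norm_num) (mem_W.1 (kill_W hf.1)).1 h2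
      rw [h3, sub_zero] at h1
      obtain ⟨g, hg, rfl⟩ := hom_quot hX eps_X2 hf.1 h1
      exact ⟨g, hg, rfl⟩
    have e0 := D_formula (k := k) 0
    have e1 := D_formula (k := k) 1
    simp only [zero_add] at *
    omega
  · let A := (W k (d + 1)).map (LinearMap.mulLeft k (X 2))
    let B := (W k d).map (LinearMap.mulLeft k (Q k))
    have hA : Module.finrank k A = D k (d + 1) := finrank_mul X2_ne _
    have hB : Module.finrank k B = D k d := finrank_mul Q_ne _
    have h0 : Kr (d + 1 + 1) S ≤ A ⊔ B := by
      intro f hf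
      obtain ⟨h1, h2⟩ := split_QH hS hf
      have hk := kill_W hf.1
      obtain ⟨g, hg, hg'⟩ := hom_quot hX eps_X2 (Submodule.sub_mem _ hf.1 hk) h1
      obtain ⟨q, hq, hq'⟩ := hom_quot (d := d) Q_hom eps_Q hk h2
      have : f = X 2 * g + Q k * q := by rw [← hg', ← hq']; ring
      rw [this]
      exact add_mem (Submodule.mem_sup_left ⟨g, hg, rfl⟩) (Submodule.mem_sup_right ⟨q, hq, rfl⟩)
    have h1 := Submodule.finrank_mono h0
    have h2 := Submodule.finrank_sup_add_finrank_inf_eq A B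
    change kap _ S ≤ _ at h1
    rcases d with _ | d
    · have e0 := D_formula (k := k) 0
      have e1 := D_formula (k := k) 1
      have e2 := D_formula (k := k) 2
      simp only [zero_add] at *
      norm_num at *
      omega
    · have h3 : (W k d).map (LinearMap.mulLeft k (X 2 * Q k)) ≤ A ⊓ B := by
        rintro _ ⟨g, hg, rfl⟩
        rw [SetLike.mem_coe, mem_W] at hg
        refine ⟨⟨Q k * g, mem_W.2 ⟨?_, by simp [hg.2]⟩, by simp⟩,
          ⟨X 2 * g, mem_W.2 ⟨?_, by simp [hg.2]⟩, by simp; ring⟩⟩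
        · rw [show d + 1 + 1 = 2 + d by omega]
          exact Q_hom.mul hg.1
        · rw [add_comm d 1]
          exact hX.mul hg.1
      have h4 := Submodule.finrank_mono h3
      rw [finrank_mul (mul_ne_zero X2_ne Q_ne)] at h4
      change D k d ≤ _ at h4
      have e0 := D_formula (k := k) d
      have e1 := D_formula (k := k) (d + 1)
      have e2 := D_formula (k := k) (d + 1 + 1)
      have e3 := D_formula (k := k) (d + 1 + 1 + 1)
      rw [hA, hB] at h2
      have h5 : kap (d + 1 + 1 + 1) S + D k d ≤ D k (d + 1 + 1) + D k (d + 1) := by omega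
      zify at *
      nlinarith [h5, e0, e1, e2, e3]

/-- The standard lines in the quadric surface. -/
def th (θ : k) : Fin 5 → k := ![θ, 0, 0, 1, 0]
/-- The standard lines in the quadric surface, second point. -/
def th' (θ : k) : Fin 5 → k := ![0, 1, 0, 0, θ]

theorem theta_form (Θ : Finset k) (θ : k) (h0 : θ ≠ 0) (hθ : θ ∉ Θ) (d : ℕ) (hd : Θ.card < d)
    (j : ℕ) (hj : j ≤ d) : ∃ f ∈ Kr d (⋃ θ ∈ Θ, ln (th θ) (th' θ)),
      aeval (fun i => Polynomial.C (th θ i) + Polynomial.X * Polynomial.C (th' θ i)) f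
        = Polynomial.monomial j (1 : k) := by
  classical
  obtain ⟨A, hA, hAc⟩ := Finset.exists_subset_card_eq (s := Θ) (n := min j Θ.card) (by simp)
  let F : MvPolynomial (Fin 5) k := (∏ t ∈ A, (X 4 - C t * X 1)) *
    (∏ t ∈ Θ \ A, (X 0 - C t * X 3)) * (X 3 ^ (d - Θ.card - (j - A.card)) * X 4 ^ (j - A.card))
  have hcard : (Θ \ A).card = Θ.card - A.card := Finset.card_sdiff_of_subset hA
  have hle : A.card ≤ Θ.card := Finset.card_le_card hA
  let c : k := (∏ t ∈ A, (θ - t)) * (∏ t ∈ Θ \ A, (θ - t)) * θ ^ (j - A.card)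
  have hc : c ≠ 0 := by
    refine mul_ne_zero (mul_ne_zero ?_ ?_) (pow_ne_zero _ h0)
    · refine Finset.prod_ne_zero_iff.2 fun t ht => sub_ne_zero.2 ?_
      rintro rfl; exact hθ (hA ht)
    · refine Finset.prod_ne_zero_iff.2 fun t ht => sub_ne_zero.2 ?_
      rintro rfl; exact hθ (Finset.mem_sdiff.1 ht).1
  have hFh : F.IsHomogeneous d := by
    have e : d = (∑ t ∈ A, 1 + ∑ t ∈ Θ \ A, 1) + (1 * (d - Θ.card - (j - A.card))
        + 1 * (j - A.card)) := by
      simp [hcard]; omega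
    rw [e]
    refine ((IsHomogeneous.prod _ _ _ fun t _ => ?_).mul
      (IsHomogeneous.prod _ _ _ fun t _ => ?_)).mul
      (((isHomogeneous_X _ _).pow _).mul ((isHomogeneous_X _ _).pow _))
    · exact (isHomogeneous_X _ _).sub (isHomogeneous_C_mul_X _ _)
    · exact (isHomogeneous_X _ _).sub (isHomogeneous_C_mul_X _ _)
  have hFe : eps F = 0 := by
    have : d - Θ.card - (j - A.card) ≠ 0 ∨ j - A.card ≠ 0 := by omega
    rcases this with h | h <;> simp [F, eps, h]
  have hFv : ∀ v ∈ ⋃ θ ∈ Θ, ln (th θ) (th' θ), eval v F = 0 := by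
    intro v hv
    simp only [Set.mem_iUnion] at hv
    obtain ⟨t, ht, a, b, rfl⟩ := hv
    by_cases htA : t ∈ A
    · have : eval (a • th t + b • th' t) (∏ t ∈ A, (X 4 - C t * X 1)) = 0 := by
        rw [map_prod]
        refine Finset.prod_eq_zero htA ?_
        simp [th, th']; ring
      simp only [F, map_mul, this, zero_mul]
    · have : eval (a • th t + b • th' t) (∏ t ∈ Θ \ A, (X 0 - C t * X 3)) = 0 := by
        rw [map_prod]
        refine Finset.prod_eq_zero (Finset.mem_sdiff.2 ⟨ht, htA⟩) ?_
        simp [th, th']; ring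
      simp only [F, map_mul, this, zero_mul, mul_zero]
  refine ⟨c⁻¹ • F, Submodule.smul_mem _ _ ⟨mem_W.2 ⟨hFh, hFe⟩, hFv⟩, ?_⟩
  have key : aeval (fun i => Polynomial.C (th θ i) + Polynomial.X * Polynomial.C (th' θ i)) F
      = Polynomial.C c * Polynomial.X ^ j := by
    have e1 : ∀ t : k, (Polynomial.X * Polynomial.C θ - Polynomial.C t * Polynomial.X :
        Polynomial k) = (Polynomial.C θ - Polynomial.C t) * Polynomial.X := by
      intro t; ring
    have v0 : Polynomial.C (th θ 0) + Polynomial.X * Polynomial.C (th' θ 0) = Polynomial.C θ := by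
      simp [th, th']
    have v1 : Polynomial.C (th θ 1) + Polynomial.X * Polynomial.C (th' θ 1) = Polynomial.X := by
      simp [th, th']
    have v3 : Polynomial.C (th θ 3) + Polynomial.X * Polynomial.C (th' θ 3) = 1 := by
      simp [th, th']
    have v4 : Polynomial.C (th θ 4) + Polynomial.X * Polynomial.C (th' θ 4)
        = Polynomial.X * Polynomial.C θ := by
      simp [th, th']
    have e2 : Polynomial.X ^ j = (Polynomial.X ^ A.card * Polynomial.X ^ (j - A.card) :
        Polynomial k) := by
      rw [← pow_add]; congr 1; omega
    simp only [F, map_mul, map_prod, map_sub, aeval_X, map_pow, algHom_C, v0, v1, v3, v4,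
      Polynomial.algebraMap_eq, one_pow, one_mul, mul_one, e1, Finset.prod_mul_distrib,
      Finset.prod_const, mul_pow]
    rw [e2]
    simp only [c, map_mul, map_prod, map_pow, map_sub]
    ring
  rw [map_smul, key, Polynomial.smul_eq_C_mul, ← mul_assoc, ← Polynomial.C_mul,
    inv_mul_cancel₀ hc, Polynomial.monomial_one_right_eq_X_pow]
  simp

theorem theta_step [CharZero k] (Θ : Finset k) (θ : k) (h0 : θ ≠ 0) (hθ : θ ∉ Θ) (d : ℕ)
    (hd : Θ.card < d) :
    kap d ((⋃ θ ∈ Θ, ln (th θ) (th' θ)) ∪ ln (th θ) (th' θ)) + (d + 1)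
      ≤ kap d (⋃ θ ∈ Θ, ln (th θ) (th' θ)) := by
  set S := ⋃ θ ∈ Θ, ln (th θ) (th' θ) with hS
  let φ : Kr d S →ₗ[k] Polynomial k :=
    (aeval (fun i => Polynomial.C (th θ i) + Polynomial.X * Polynomial.C (th' θ i))).toLinearMap
      ∘ₗ (Kr d S).subtype
  have h1 := LinearMap.finrank_range_add_finrank_ker φ
  have h2 : d + 1 ≤ Module.finrank k (LinearMap.range φ) := by
    choose f hf hf' using fun j : Fin (d + 1) =>
      theta_form Θ θ h0 hθ d hd j (Nat.lt_succ_iff.1 j.2)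
    let w : Fin (d + 1) → LinearMap.range φ := fun j => ⟨φ ⟨f j, hf j⟩, ⟨_, rfl⟩⟩
    have hw : LinearIndependent k w := by
      apply LinearIndependent.of_comp (LinearMap.range φ).subtype
      have := (Polynomial.basisMonomials k).linearIndependent.comp
        (fun j : Fin (d + 1) => (j : ℕ)) Fin.val_injective
      convert this using 1
      funext j
      simp only [Function.comp_apply, Submodule.subtype_apply, w, φ, LinearMap.comp_apply,
        AlgHom.toLinearMap_apply, hf', Polynomial.coe_basisMonomials]
    simpa using hw.fintype_card_le_finrank
  have h3 : kap d (S ∪ ln (th θ) (th' θ)) ≤ Module.finrank k (LinearMap.ker φ) := by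
    rw [(Submodule.equivMapOfInjective _ (Kr d S).injective_subtype (LinearMap.ker φ)).finrank_eq]
    apply Submodule.finrank_mono
    intro f hf
    refine ⟨⟨f, Kr_anti Set.subset_union_left hf⟩, ?_, rfl⟩
    apply Polynomial.funext
    intro c
    simp only [φ, LinearMap.comp_apply, Submodule.subtype_apply, AlgHom.toLinearMap_apply]
    rw [eval_line, Polynomial.eval_zero]
    exact hf.2 _ (Or.inr ⟨1, c, by simp⟩)
  change _ = kap d S at h1
  omega

theorem theta_lines [CharZero k] (Θ : Finset k) (h0 : ∀ θ ∈ Θ, θ ≠ 0) (d : ℕ) (hd : Θ.card ≤ d) :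
    kap d (⋃ θ ∈ Θ, ln (th θ) (th' θ)) + Θ.card * (d + 1) ≤ D k d := by
  classical
  induction Θ using Finset.induction_on with
  | empty => simpa using kap_le_D _ _
  | insert a s ha ih =>
    rw [Finset.card_insert_of_notMem ha] at *
    have h1 := ih (fun θ hθ => h0 θ (Finset.mem_insert_of_mem hθ)) (by omega)
    have h2 := theta_step s a (h0 a (Finset.mem_insert_self _ _)) ha d (by omega)
    rw [Finset.set_biUnion_insert, Set.union_comm, add_mul]
    omega

theorem theta_ln_Q {θ : k} {v : Fin 5 → k} (hv : v ∈ ln (th θ) (th' θ)) : eval v (Q k) = 0 := by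
  obtain ⟨a, b, rfl⟩ := hv
  rw [eval_Q]
  simp [th, th']; ring

theorem theta_ln_H {θ : k} {v : Fin 5 → k} (hv : v ∈ ln (th θ) (th' θ)) : v 2 = 0 := by
  obtain ⟨a, b, rfl⟩ := hv
  simp [th, th']

theorem exists_theta [CharZero k] (m : ℕ) : ∃ Θ : Finset k, (∀ θ ∈ Θ, θ ≠ 0) ∧ Θ.card = m := by
  classical
  refine ⟨(Finset.range m).image (fun n : ℕ => ((n + 1 : ℕ) : k)), ?_, ?_⟩
  · intro θ hθ
    obtain ⟨n, _, rfl⟩ := Finset.mem_image.1 hθ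
    exact Nat.cast_ne_zero.2 (Nat.succ_ne_zero n)
  · rw [Finset.card_image_of_injective, Finset.card_range]
    intro a b hab
    have := Nat.cast_injective hab
    omega

end traces
end PL

namespace PL

section steps
variable {k : Type} [Field k]

theorem ev_rename {T U : Type} (τ : U → k) (e : T → U) (p : Fin 5 → MvPolynomial T k) :
    ev τ (fun c => rename e (p c)) = ev (τ ∘ e) p := by
  funext c
  simp [ev, eval_rename]

theorem ev_zero {T : Type} (τ : T → k) : ev τ (fun _ => 0) = 0 := by
  funext c; simp [ev]

/-- The intersection of a line with the hyperplane. -/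
noncomputable def meet {T : Type} (P P' : Fin 5 → MvPolynomial T k) : Fin 5 → MvPolynomial T k :=
  fun c => P' 2 * P c - P 2 * P' c

theorem hstep [CharZero k] {T ι : Type} [Fintype ι] (P P' : Fin 5 → MvPolynomial T k)
    (hP' : P' 2 ≠ 0) (d : ℕ) (S0 : Set (Fin 5 → k)) (hS0 : ∀ v ∈ S0, v 2 = 0) (r B : ℕ)
    (τ0 : ι → T → k) (h1 : kap d (⋃ i, ln (ev (τ0 i) P) (ev (τ0 i) P')) ≤ r)
    (h2 : kap (d + 1) (S0 ∪ Set.range (fun τ => ev τ (meet P P'))) ≤ B)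
    (h3 : kap (d + 1) S0 ≤ B + Fintype.card ι) :
    ∃ τ : ι → T → k,
      kap (d + 1) (S0 ∪ ⋃ i, ln (ev (τ i) P) (ev (τ i) P')) + D k d ≤ B + r := by
  obtain ⟨x, hx, hx'⟩ := points (ι := ι) (d + 1) S0 _ B h2 ⟨_, ⟨0, rfl⟩⟩ h3
  choose σ hσ using hx
  let p : ι → Fin 5 → MvPolynomial (ι × T) k := fun i c => rename (fun t => (i, t)) (P c)
  let p' : ι → Fin 5 → MvPolynomial (ι × T) k := fun i c => rename (fun t => (i, t)) (P' c)
  let q : ι → Fin 5 → MvPolynomial (ι × T) k := fun i c => rename (fun t => (i, t)) (meet P P' c)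
  have hp : ∀ τ i, ev τ (p i) = ev (fun t => τ (i, t)) P := fun τ i => ev_rename _ _ _
  have hp' : ∀ τ i, ev τ (p' i) = ev (fun t => τ (i, t)) P' := fun τ i => ev_rename _ _ _
  have hq : ∀ τ i, ev τ (q i) = ev (fun t => τ (i, t)) (meet P P') := fun τ i => ev_rename _ _ _
  have g1 := gen_lines d ∅ p p' (fun x => τ0 x.1 x.2) r (by
    simp only [hp, hp', Set.empty_union]; exact h1)
  have g2 := gen_lines (d + 1) S0 q (fun _ _ => 0) (fun x => σ x.1 x.2) B (by
    refine (kap_anti ?_).trans hx'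
    apply Set.union_subset_union_right
    rintro _ ⟨i, rfl⟩
    refine Set.mem_iUnion.2 ⟨i, ?_⟩
    rw [← hσ i, hq]
    exact left_mem_ln _ _)
  have g3 : Gen (fun τ => ∀ i, eval τ (p' i 2) ≠ 0) := by
    apply Gen.all
    intro i
    refine ⟨p' i 2, ?_, fun _ h => h⟩
    intro h0
    apply hP'
    apply rename_injective (fun t => (i, t)) (fun a b hab => by simpa using hab)
    simpa [p'] using h0
  obtain ⟨τ, ⟨t1, t2⟩, t3⟩ := ((g1.and g2).and g3).exists
  refine ⟨fun i t => τ (i, t), ?_⟩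
  simp only [ev_zero] at t2
  have hqv : ∀ i, ev τ (q i) = ev τ (p' i) 2 • ev τ (p i) + (- ev τ (p i) 2) • ev τ (p' i) := by
    intro i
    funext c
    simp [q, p, p', meet, ev]
    ring
  have := residual d 1 (X 2) X2_ne (isHomogeneous_X k 2) (S0 ∪ ⋃ i, ln (ev τ (p i)) (ev τ (p' i)))
    (S0 ∪ ⋃ i, ln (ev τ (q i)) 0) (∅ ∪ ⋃ i, ln (ev τ (p i)) (ev τ (p' i))) ?_ ?_ ?_
  · simp only [hp, hp'] at this t1
    beta_reduce
    omega
  · apply Set.union_subset_union_right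
    apply Set.iUnion_mono
    intro i
    exact ln_subset ⟨_, _, hqv i⟩ ⟨0, 0, by simp⟩
  · rintro v (hv | hv)
    · simpa using hS0 v hv
    · obtain ⟨i, a, b, rfl⟩ := Set.mem_iUnion.1 hv
      rw [hqv]
      simp
      ring
  · intro g hg v hv
    rw [Set.empty_union] at hv
    obtain ⟨i, hi⟩ := Set.mem_iUnion.1 hv
    refine div_line (X 2) g _ _ ⟨_, right_mem_ln _ _, ?_⟩
      (fun w hw => hg w (Or.inr (Set.mem_iUnion.2 ⟨i, hw⟩))) v hi
    simpa [ev] using t3 i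

/-- Parametrization of the quadric (or of its hyperplane section). -/
noncomputable def gq (μ : k) : Fin 5 → MvPolynomial (Fin 5) k :=
  ![X 1 * X 2, X 0 * X 3, C μ * X 4, X 0 * X 2, X 1 * X 3]

theorem ev_gq (μ : k) (τ : Fin 5 → k) :
    ev τ (gq μ) = ![τ 1 * τ 2, τ 0 * τ 3, μ * τ 4, τ 0 * τ 2, τ 1 * τ 3] := by
  funext c
  fin_cases c <;> simp [ev, gq]

theorem param (μ : k) (v : Fin 5 → k) (hQ : eval v (Q k) = 0) (hμ : ∃ w, v 2 = μ * w) :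
    ∃ τ, ev τ (gq μ) = v := by
  obtain ⟨w, hw⟩ := hμ
  rw [eval_Q, sub_eq_zero] at hQ
  by_cases h3 : v 3 = 0
  · have h01 : v 0 * v 1 = 0 := by rw [hQ, h3, zero_mul]
    rcases mul_eq_zero.1 h01 with h | h
    · refine ⟨![v 1, v 4, 0, 1, w], ?_⟩
      rw [ev_gq]; funext c; fin_cases c <;> simp [h, h3, hw]
    · refine ⟨![0, 1, v 0, v 4, w], ?_⟩
      rw [ev_gq]; funext c; fin_cases c <;> simp [h, h3, hw]
  · refine ⟨![1, v 0 / v 3, v 3, v 1, w], ?_⟩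
    rw [ev_gq]; funext c; fin_cases c <;> simp [hw]
    · field_simp
    · field_simp
      rw [hQ]

/-- The polar form of `Q`. -/
def Bf {A : Type} [CommRing A] (p p' : Fin 5 → A) : A :=
  p 0 * p' 1 + p 1 * p' 0 - p 3 * p' 4 - p 4 * p' 3

theorem eval_Q_comb (p p' : Fin 5 → k) (a b : k) : eval (a • p + b • p') (Q k)
    = a ^ 2 * eval p (Q k) + a * b * Bf p p' + b ^ 2 * eval p' (Q k) := by
  simp only [eval_Q, Bf, Pi.add_apply, Pi.smul_apply, smul_eq_mul]
  ring

theorem eval_Bf {T : Type} (τ : T → k) (p p' : Fin 5 → MvPolynomial T k) :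
    eval τ (Bf p p') = Bf (ev τ p) (ev τ p') := by
  simp [Bf, ev]

theorem ev_gq_Q (μ : k) (τ : Fin 5 → k) : eval (ev τ (gq μ)) (Q k) = 0 := by
  rw [eval_Q, ev_gq]
  simp; ring

theorem qstep [CharZero k] {ι : Type} [Fintype ι] (μ : k) (d : ℕ) (S0 : Set (Fin 5 → k))
    (hS0 : ∀ v ∈ S0, eval v (Q k) = 0) (r B : ℕ)
    (τ0 : ι × Fin 2 → Fin 5 → k)
    (h1 : kap d (⋃ i, ln (ev (τ0 (i, 0)) (gq μ)) (ev (τ0 (i, 1)) (gq μ))) ≤ r)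
    (hB0 : ∀ i, Bf (ev (τ0 (i, 0)) (gq μ)) (ev (τ0 (i, 1)) (gq μ)) ≠ 0)
    (h2 : kap (d + 2) (S0 ∪ Set.range (fun τ => ev τ (gq μ))) ≤ B)
    (h3 : kap (d + 2) S0 ≤ B + 2 * Fintype.card ι) :
    ∃ τ : ι × Fin 2 → Fin 5 → k,
      kap (d + 2) (S0 ∪ ⋃ i, ln (ev (τ (i, 0)) (gq μ)) (ev (τ (i, 1)) (gq μ))) + D k d
        ≤ B + r := by
  obtain ⟨x, hx, hx'⟩ := points (ι := ι × Fin 2) (d + 2) S0 _ B h2 ⟨_, ⟨0, rfl⟩⟩ (by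
    simpa [mul_comm] using h3)
  choose σ hσ using hx
  let q : ι × Fin 2 → Fin 5 → MvPolynomial ((ι × Fin 2) × Fin 5) k :=
    fun i c => rename (fun t => (i, t)) (gq μ c)
  have hq : ∀ τ i, ev τ (q i) = ev (fun t => τ (i, t)) (gq μ) := fun τ i => ev_rename _ _ _
  have g1 := gen_lines d ∅ (fun i : ι => q (i, 0)) (fun i => q (i, 1))
    (fun x => τ0 x.1 x.2) r (by
      simp only [hq, Set.empty_union]; exact h1)
  have g2 := gen_lines (d + 2) S0 q (fun _ _ => 0) (fun x => σ x.1 x.2) B (by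
    refine (kap_anti ?_).trans hx'
    apply Set.union_subset_union_right
    rintro _ ⟨i, rfl⟩
    refine Set.mem_iUnion.2 ⟨i, ?_⟩
    rw [← hσ i, hq]
    exact left_mem_ln _ _)
  have g3 : Gen (fun τ => ∀ i, eval τ (Bf (q (i, 0)) (q (i, 1))) ≠ 0) := by
    apply Gen.all
    intro i
    refine gen_ne _ (fun x => τ0 x.1 x.2) ?_
    rw [eval_Bf, hq, hq]
    exact hB0 i
  obtain ⟨τ, ⟨t1, t2⟩, t3⟩ := ((g1.and g2).and g3).exists
  refine ⟨fun i t => τ (i, t), ?_⟩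
  simp only [ev_zero] at t2
  have := residual d 2 (Q k) Q_ne Q_hom (S0 ∪ ⋃ i, ln (ev τ (q (i, 0))) (ev τ (q (i, 1))))
    (S0 ∪ ⋃ i, ln (ev τ (q i)) 0) (∅ ∪ ⋃ i, ln (ev τ (q (i, 0))) (ev τ (q (i, 1)))) ?_ ?_ ?_
  · simp only [hq] at this t1 t2
    beta_reduce
    omega
  · apply Set.union_subset_union_right
    apply Set.iUnion_subset
    rintro ⟨i, j⟩ v hv
    refine Set.mem_iUnion.2 ⟨i, ln_subset ?_ ⟨0, 0, by simp⟩ hv⟩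
    fin_cases j
    · exact left_mem_ln _ _
    · exact right_mem_ln _ _
  · rintro v (hv | hv)
    · exact hS0 v hv
    · obtain ⟨i, a, b, rfl⟩ := Set.mem_iUnion.1 hv
      rw [eval_Q_comb, hq, ev_gq_Q]
      simp [Bf]
      right; simp [Q]
  · intro g hg v hv
    rw [Set.empty_union] at hv
    obtain ⟨i, hi⟩ := Set.mem_iUnion.1 hv
    refine div_line (Q k) g _ _ ⟨_, ⟨1, 1, rfl⟩, ?_⟩
      (fun w hw => hg w (Or.inr (Set.mem_iUnion.2 ⟨i, hw⟩))) v hi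
    have := t3 i
    rw [eval_Bf] at this
    rw [eval_Q_comb, hq, hq, ev_gq_Q, ev_gq_Q]
    rw [hq, hq] at this
    simpa using this

/-- Two distinct intersection points of a general line with the quadric. -/
theorem chord [IsAlgClosed k] [CharZero k] (p p' : Fin 5 → k) (h : eval p' (Q k) ≠ 0)
    (hd : Bf p p' ^ 2 - 4 * eval p (Q k) * eval p' (Q k) ≠ 0) :
    ∃ q q' : Fin 5 → k, q ∈ ln p p' ∧ q' ∈ ln p p' ∧ ln p p' ⊆ ln q q' ∧
      eval q (Q k) = 0 ∧ eval q' (Q k) = 0 ∧ Bf q q' ≠ 0 := by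
  obtain ⟨s, hs⟩ := IsAlgClosed.exists_eq_mul_self
    (Bf p p' ^ 2 - 4 * eval p (Q k) * eval p' (Q k))
  have hs0 : s ≠ 0 := by rintro rfl; simp at hs; exact hd hs
  have h2 : (2 : k) ≠ 0 := two_ne_zero
  set c := eval p' (Q k) with hc
  set b := Bf p p' with hb
  set a := eval p (Q k) with ha
  let r1 := (-b + s) / (2 * c)
  let r2 := (-b - s) / (2 * c)
  have hr : r1 - r2 = s / c := by simp only [r1, r2]; field_simp; ring
  have hr0 : r1 - r2 ≠ 0 := by rw [hr]; exact div_ne_zero hs0 h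
  have q1 : a + r1 * b + r1 ^ 2 * c = 0 := by
    simp only [r1]; field_simp; linear_combination -hs
  have q2 : a + r2 * b + r2 ^ 2 * c = 0 := by
    simp only [r2]; field_simp; linear_combination -hs
  refine ⟨p + r1 • p', p + r2 • p', ⟨1, r1, by simp⟩, ⟨1, r2, by simp⟩, ?_, ?_, ?_, ?_⟩
  · have e' : p' = (1 / (r1 - r2)) • (p + r1 • p') + (- (1 / (r1 - r2))) • (p + r2 • p') := by
      funext i
      simp only [Pi.add_apply, Pi.smul_apply, smul_eq_mul]
      field_simp
      ring
    have e : p = (- r2 / (r1 - r2)) • (p + r1 • p') + (r1 / (r1 - r2)) • (p + r2 • p') := by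
      funext i
      simp only [Pi.add_apply, Pi.smul_apply, smul_eq_mul]
      field_simp
      ring
    exact ln_subset ⟨_, _, e⟩ ⟨_, _, e'⟩
  · have := eval_Q_comb p p' 1 r1
    rw [one_smul] at this
    rw [this, ← ha, ← hb, ← hc]
    linear_combination q1
  · have := eval_Q_comb p p' 1 r2
    rw [one_smul] at this
    rw [this, ← ha, ← hb, ← hc]
    linear_combination q2
  · have e : Bf (p + r1 • p') (p + r2 • p') = 2 * a + (r1 + r2) * b + 2 * r1 * r2 * c := by
      simp only [ha, hb, hc, eval_Q, Bf, Pi.add_apply, Pi.smul_apply, smul_eq_mul]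
      ring
    have e2 : Bf (p + r1 • p') (p + r2 • p') = - (s * s) / c := by
      rw [e]
      simp only [r1, r2]
      rw [← hs]
      field_simp
      linear_combination hs
    rw [e2]
    exact div_ne_zero (neg_ne_zero.2 (mul_ne_zero hs0 hs0)) h

theorem normalize [IsAlgClosed k] [CharZero k] {ι : Type} [Fintype ι] (μ : k) (d r : ℕ)
    (p p' : ι → Fin 5 → k) (hp : ∀ i, ∃ w, p i 2 = μ * w) (hp' : ∀ i, ∃ w, p' i 2 = μ * w)
    (h : kap d (⋃ i, ln (p i) (p' i)) ≤ r) :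
    ∃ τ0 : ι × Fin 2 → Fin 5 → k,
      kap d (⋃ i, ln (ev (τ0 (i, 0)) (gq μ)) (ev (τ0 (i, 1)) (gq μ))) ≤ r ∧
      ∀ i, Bf (ev (τ0 (i, 0)) (gq μ)) (ev (τ0 (i, 1)) (gq μ)) ≠ 0 := by
  choose w hw using hp
  choose w' hw' using hp'
  let P : Fin 2 → ι → Fin 5 → MvPolynomial (ι × Fin 2 × Fin 5) k :=
    fun j i c => if c = 2 then C μ * X (i, j, c) else X (i, j, c)
  have hP : ∀ j i τ, ev τ (P j i)
      = fun c => if c = 2 then μ * τ (i, j, c) else τ (i, j, c) := by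
    intro j i τ
    funext c
    by_cases hc : c = 2 <;> simp [ev, P, hc]
  have g1 := gen_lines d ∅ (P 0) (P 1) (fun x => if x.2.2 = 2 then
      (if x.2.1 = 0 then w x.1 else w' x.1) else (if x.2.1 = 0 then p x.1 x.2.2 else p' x.1 x.2.2))
      r (by
    rw [Set.empty_union]
    refine le_trans (le_of_eq ?_) h
    congr 2
    funext i
    rw [hP, hP]
    congr 1
    · funext c
      by_cases hc : c = 2
      · subst hc; simp [hw]
      · simp [hc]
    · funext c
      by_cases hc : c = 2
      · subst hc; simp [hw']
      · simp [hc])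
  have hQe : ∀ (τ : ι × Fin 2 × Fin 5 → k) j i, eval τ (aeval (P j i) (Q k))
      = eval (ev τ (P j i)) (Q k) := fun τ j i => eval_aeval _ _ _
  have g2 : Gen (fun τ => ∀ i, eval τ (aeval (P 1 i) (Q k) * (Bf (P 0 i) (P 1 i) ^ 2
      - 4 * aeval (P 0 i) (Q k) * aeval (P 1 i) (Q k))) ≠ 0) := by
    apply Gen.all
    intro i
    refine gen_ne _ (fun x => if x.2.1 = 0 then ![1, 0, 0, 0, 0] x.2.2
      else ![1, 1, 0, 0, 0] x.2.2) ?_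
    simp only [map_mul, map_sub, map_pow, hQe, eval_Bf]
    simp [hP, eval_Q, Bf]
  obtain ⟨τ, t1, t2⟩ := (g1.and g2).exists
  have hch : ∀ i, ∃ q q' : Fin 5 → k, q ∈ ln (ev τ (P 0 i)) (ev τ (P 1 i)) ∧
      q' ∈ ln (ev τ (P 0 i)) (ev τ (P 1 i)) ∧ ln (ev τ (P 0 i)) (ev τ (P 1 i)) ⊆ ln q q' ∧
      eval q (Q k) = 0 ∧ eval q' (Q k) = 0 ∧ Bf q q' ≠ 0 := by
    intro i
    have := t2 i
    simp only [map_mul, map_sub, map_pow, hQe, eval_Bf] at this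
    refine chord _ _ (left_ne_zero_of_mul this) ?_
    simpa using right_ne_zero_of_mul this
  choose q q' hq hq' hsub hQ hQ' hB using hch
  have hmem : ∀ i v, v ∈ ln (ev τ (P 0 i)) (ev τ (P 1 i)) → ∃ w, v 2 = μ * w := by
    rintro i _ ⟨a, b, rfl⟩
    refine ⟨a * τ (i, 0, 2) + b * τ (i, 1, 2), ?_⟩
    rw [hP, hP]
    simp
    ring
  choose a ha using fun i => param μ (q i) (hQ i) (hmem i _ (hq i))
  choose b hb using fun i => param μ (q' i) (hQ' i) (hmem i _ (hq' i))
  refine ⟨fun x => if x.2 = 0 then a x.1 else b x.1, ?_, ?_⟩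
  · simp only [Fin.isValue, one_ne_zero, if_true, if_false, ha, hb]
    refine (kap_anti ?_).trans t1
    rw [Set.empty_union]
    exact Set.iUnion_mono hsub
  · intro i
    simpa [ha, hb] using hB i

end steps
end PL

namespace PL

section lemA
variable {k : Type} [Field k]

theorem kap_union_sum {ι κ : Type} (d : ℕ) (p p' : ι → Fin 5 → k) (q q' : κ → Fin 5 → k) :
    kap d (⋃ i : ι ⊕ κ, ln (Sum.elim p q i) (Sum.elim p' q' i))
      ≤ kap d ((⋃ i, ln (q i) (q' i)) ∪ ⋃ i, ln (p i) (p' i)) := by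
  apply kap_anti
  rintro v (hv | hv)
  · obtain ⟨i, hi⟩ := Set.mem_iUnion.1 hv
    exact Set.mem_iUnion.2 ⟨Sum.inr i, hi⟩
  · obtain ⟨i, hi⟩ := Set.mem_iUnion.1 hv
    exact Set.mem_iUnion.2 ⟨Sum.inl i, hi⟩

/-- The first point of a general line in a ruling of the quadric. -/
noncomputable def PA (k : Type) [Field k] : Fin 5 → MvPolynomial (Fin 8) k :=
  ![X 1 * X 2, X 0 * X 3, X 4, X 0 * X 2, X 1 * X 3]

/-- The second point of a general line in a ruling of the quadric. -/
noncomputable def PA' (k : Type) [Field k] : Fin 5 → MvPolynomial (Fin 8) k :=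
  ![X 1 * X 5, X 0 * X 6, X 7, X 0 * X 5, X 1 * X 6]

theorem ev_PA (τ : Fin 8 → k) :
    ev τ (PA k) = ![τ 1 * τ 2, τ 0 * τ 3, τ 4, τ 0 * τ 2, τ 1 * τ 3] := by
  funext c
  fin_cases c <;> simp [ev, PA]

theorem ev_PA' (τ : Fin 8 → k) :
    ev τ (PA' k) = ![τ 1 * τ 5, τ 0 * τ 6, τ 7, τ 0 * τ 5, τ 1 * τ 6] := by
  funext c
  fin_cases c <;> simp [ev, PA']

theorem PA_Q (τ : Fin 8 → k) (v : Fin 5 → k) (hv : v ∈ ln (ev τ (PA k)) (ev τ (PA' k))) :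
    eval v (Q k) = 0 := by
  obtain ⟨a, b, rfl⟩ := hv
  rw [eval_Q, ev_PA, ev_PA']
  simp
  ring

/-- Number of lines on the quadric. -/
def NA : ℕ → ℕ
  | 0 => 0
  | d + 1 => NA d + ((d + 1) / 2 + 1)

theorem NA_even (e : ℕ) : NA (2 * e) = e ^ 2 + 2 * e := by
  induction e with
  | zero => simp [NA]
  | succ e ih =>
    have h : 2 * (e + 1) = (2 * e + 1) + 1 := by ring
    rw [h]
    simp only [NA]
    rw [ih]
    have h1 : (2 * e + 1) / 2 = e := by omega
    have h2 : (2 * e + 1 + 1) / 2 = e + 1 := by omega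
    rw [h1, h2]
    ring

theorem NA_le (d : ℕ) : 4 * NA d ≤ d ^ 2 + 4 * d := by
  obtain ⟨e, rfl | rfl⟩ := Nat.even_or_odd' d
  · rw [NA_even]
    nlinarith
  · simp only [NA]
    rw [NA_even]
    have h1 : (2 * e + 1) / 2 = e := by omega
    rw [h1]
    nlinarith

theorem NA_num (d : ℕ) : NA d + 2 + ((d + 1) / 2 + 1) * (d + 2) ≤ (d + 2) ^ 2 := by
  rcases d with _ | _ | d
  · simp [NA]
  · simp [NA]
  · have h1 := NA_le (d + 1 + 1)
    have : 2 * ((d + 1 + 1 + 1) / 2) ≤ d + 1 + 1 + 1 := Nat.mul_div_le _ _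
    nlinarith

theorem lemA [IsAlgClosed k] [CharZero k] (d : ℕ) : ∃ (ι : Type) (_ : Fintype ι)
    (τ : ι → Fin 8 → k), Fintype.card ι = NA d ∧
      kap d (⋃ i, ln (ev (τ i) (PA k)) (ev (τ i) (PA' k))) + NA d * (d + 1) ≤ D k d := by
  induction d with
  | zero =>
    refine ⟨Empty, inferInstance, fun i => i.elim, by simp [NA], ?_⟩
    simpa [NA] using kap_le_D _ _
  | succ d ih =>
    obtain ⟨ι, _, τ0, hc, h⟩ := ih
    obtain ⟨Θ, hΘ, hm⟩ := exists_theta (k := k) ((d + 1) / 2 + 1)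
    have hth := theta_lines Θ hΘ (d + 1) (by omega)
    have hnum := NA_num d
    set m := (d + 1) / 2 + 1 with hmdef
    have hQH : kap (d + 1) ((⋃ θ ∈ Θ, ln (th θ) (th' θ)) ∪
        Set.range (fun τ => ev τ (meet (PA k) (PA' k)))) + (d + 2) ^ 2 ≤ D k (d + 1) + 2 := by
      apply kap_QH
      intro v hQ h2
      right
      obtain ⟨τ, hτ⟩ := param 0 v hQ ⟨0, by simpa using h2⟩
      refine ⟨![τ 0, τ 1, τ 2, τ 3, 0, 0, 0, 1], ?_⟩
      rw [← hτ, ev_gq]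
      have : ∀ σ : Fin 8 → k, ev σ (meet (PA k) (PA' k))
          = fun c => ev σ (PA' k) 2 * ev σ (PA k) c - ev σ (PA k) 2 * ev σ (PA' k) c := by
        intro σ; funext c; simp [ev, meet]
      simp only [this, ev_PA, ev_PA']
      funext c
      fin_cases c <;> simp
    obtain ⟨r, hr⟩ := Nat.exists_eq_add_of_le (show NA d * (d + 1) ≤ D k d by omega)
    obtain ⟨B, hB⟩ := Nat.exists_eq_add_of_le (show NA d + m * (d + 2) ≤ D k (d + 1) by omega)
    rw [hm] at hth
    obtain ⟨τ, hτ⟩ := hstep (PA k) (PA' k) (by simp [PA']) d (⋃ θ ∈ Θ, ln (th θ) (th' θ)) (by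
      intro v hv
      obtain ⟨θ, hv⟩ := Set.mem_iUnion.1 hv
      obtain ⟨_, hv⟩ := Set.mem_iUnion.1 hv
      exact theta_ln_H hv) r B τ0 (by omega) (by omega) (by
        rw [hc]
        have : m * (d + 1 + 1) = m * (d + 2) := by ring
        omega)
    refine ⟨ι ⊕ Θ, inferInstance, Sum.elim τ (fun θ => ![1, θ, 1, 0, 0, 0, 1, 0]), ?_, ?_⟩
    · simp [hc, hm, NA, ← hmdef]
    · have h1 : kap (d + 1) (⋃ i, ln (ev (Sum.elim τ (fun θ : Θ => ![1, (θ : k), 1, 0, 0, 0, 1, 0]) i) (PA k))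
          (ev (Sum.elim τ (fun θ : Θ => ![1, (θ : k), 1, 0, 0, 0, 1, 0]) i) (PA' k)))
          ≤ kap (d + 1) ((⋃ θ ∈ Θ, ln (th θ) (th' θ)) ∪ ⋃ i, ln (ev (τ i) (PA k)) (ev (τ i) (PA' k))) := by
        apply kap_anti
        rintro v (hv | hv)
        · obtain ⟨θ, hv⟩ := Set.mem_iUnion.1 hv
          obtain ⟨hθ, hv⟩ := Set.mem_iUnion.1 hv
          refine Set.mem_iUnion.2 ⟨Sum.inr ⟨θ, hθ⟩, ?_⟩
          rw [ev_PA, ev_PA']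
          simpa [th, th'] using hv
        · obtain ⟨i, hi⟩ := Set.mem_iUnion.1 hv
          exact Set.mem_iUnion.2 ⟨Sum.inl i, hi⟩
      simp only [NA, ← hmdef]
      nlinarith

end lemA
end PL

namespace PL

section lemB
variable {k : Type} [Field k]

/-- Number of lines in the hyperplane. -/
def NB : ℕ → ℕ
  | 0 => 1
  | e + 1 => NB e + (e + 3)

theorem NB_eq (e : ℕ) : 2 * NB e = e ^ 2 + 5 * e + 2 := by
  induction e with
  | zero => simp [NB]
  | succ e ih => simp only [NB]; nlinarith

theorem theta_sub {d : ℕ} {ι : Type} (Θ : Finset k) (p p' : ι → Fin 5 → k) :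
    kap d (⋃ i : ι ⊕ Θ, ln (Sum.elim p (fun θ : Θ => th (θ : k)) i)
        (Sum.elim p' (fun θ : Θ => th' (θ : k)) i))
      ≤ kap d ((⋃ θ ∈ Θ, ln (th θ) (th' θ)) ∪ ⋃ i, ln (p i) (p' i)) := by
  refine (kap_union_sum d p p' (fun θ : Θ => th (θ : k)) (fun θ : Θ => th' (θ : k))).trans
    (kap_anti ?_)
  apply Set.union_subset_union_left
  intro v hv
  obtain ⟨θ, hv⟩ := Set.mem_iUnion.1 hv
  obtain ⟨hθ, hv⟩ := Set.mem_iUnion.1 hv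
  exact Set.mem_iUnion.2 ⟨⟨θ, hθ⟩, hv⟩

theorem lemB [IsAlgClosed k] [CharZero k] (e : ℕ) : ∃ (ι : Type) (_ : Fintype ι)
    (p p' : ι → Fin 5 → k), Fintype.card ι = NB e ∧ (∀ i, p i 2 = 0) ∧ (∀ i, p' i 2 = 0) ∧
      kap (2 * e + 1) (⋃ i, ln (p i) (p' i)) + NB e * (2 * e + 2) ≤ D k (2 * e + 1) := by
  induction e with
  | zero =>
    have h := theta_lines ({1} : Finset k) (by simp) 1 (by simp)
    refine ⟨Unit, inferInstance, fun _ => th 1, fun _ => th' 1, by simp [NB], by simp [th],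
      by simp [th'], ?_⟩
    simpa [NB, Set.iUnion_const] using h
  | succ e ih =>
    obtain ⟨ι, _, p, p', hc, hp, hp', h⟩ := ih
    obtain ⟨Θ, hΘ, hm⟩ := exists_theta (k := k) (e + 3)
    have hth := theta_lines Θ hΘ (2 * e + 1 + 2) (by omega)
    have hNB := NB_eq e
    have hQH : kap (2 * e + 1 + 2) ((⋃ θ ∈ Θ, ln (th θ) (th' θ)) ∪
        Set.range (fun τ => ev τ (gq 0))) + (2 * e + 2 + 2) ^ 2 ≤ D k (2 * e + 1 + 2) + 2 := by
      apply kap_QH (2 * e + 2)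
      intro v hQ h2
      right
      exact param 0 v hQ ⟨0, by simpa using h2⟩
    obtain ⟨r, hr⟩ := Nat.exists_eq_add_of_le
      (show NB e * (2 * e + 2) ≤ D k (2 * e + 1) by omega)
    obtain ⟨B, hB⟩ := Nat.exists_eq_add_of_le
      (show 2 * NB e + (e + 3) * (2 * e + 4) ≤ D k (2 * e + 1 + 2) by nlinarith)
    rw [hm] at hth
    obtain ⟨τ0, hτ0, hτ0'⟩ := normalize 0 (2 * e + 1) r p p' (fun i => ⟨0, by simp [hp]⟩)
      (fun i => ⟨0, by simp [hp']⟩) (by omega)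
    obtain ⟨τ, hτ⟩ := qstep 0 (2 * e + 1) (⋃ θ ∈ Θ, ln (th θ) (th' θ)) (by
      intro v hv
      obtain ⟨θ, hv⟩ := Set.mem_iUnion.1 hv
      obtain ⟨_, hv⟩ := Set.mem_iUnion.1 hv
      exact theta_ln_Q hv) r B τ0 hτ0 hτ0' (by nlinarith) (by rw [hc]; nlinarith)
    refine ⟨ι ⊕ Θ, inferInstance, Sum.elim (fun i => ev (τ (i, 0)) (gq 0)) (fun θ : Θ => th (θ : k)),
      Sum.elim (fun i => ev (τ (i, 1)) (gq 0)) (fun θ : Θ => th' (θ : k)), ?_, ?_, ?_, ?_⟩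
    · simp [hc, hm, NB]
    · rintro (i | i)
      · simp [ev_gq]
      · simp [th]
    · rintro (i | i)
      · simp [ev_gq]
      · simp [th']
    · have h1 := theta_sub (d := 2 * e + 1 + 2) Θ (fun i => ev (τ (i, 0)) (gq 0))
        (fun i => ev (τ (i, 1)) (gq 0))
      have e1 : 2 * (e + 1) + 1 = 2 * e + 1 + 2 := by ring
      rw [e1]
      have e2 : NB (e + 1) * (2 * (e + 1) + 2)
          = NB e * (2 * e + 2) + (2 * NB e + (e + 3) * (2 * e + 4)) := by
        simp only [NB]; ring
      rw [e2]
      omega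

/-- Number of lines in even degree. -/
def sg : ℕ → ℕ
  | 0 => 0
  | e + 1 => sg e + NA (2 * e + 2)

theorem sg_eq (e : ℕ) : 6 * sg e = e * (e + 1) * (2 * e + 7) := by
  induction e with
  | zero => simp [sg]
  | succ e ih =>
    have := NA_even (e + 1)
    simp only [sg]
    rw [show 2 * e + 2 = 2 * (e + 1) by ring, this]
    nlinarith

theorem D_even (e : ℕ) : D k (2 * e) = sg e * (2 * e + 1) := by
  have h1 := D_formula (k := k) (2 * e)
  have h2 := sg_eq e
  have : 24 * D k (2 * e) = 24 * (sg e * (2 * e + 1)) := by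
    have : 24 * (sg e * (2 * e + 1)) = 4 * (6 * sg e) * (2 * e + 1) := by ring
    rw [h1, this, h2]
    ring
  omega

theorem even_case [IsAlgClosed k] [CharZero k] (e : ℕ) : ∃ (ι : Type) (_ : Fintype ι)
    (p p' : ι → Fin 5 → k), Fintype.card ι = sg e ∧ kap (2 * e) (⋃ i, ln (p i) (p' i)) = 0 := by
  induction e with
  | zero =>
    refine ⟨Empty, inferInstance, fun i => i.elim, fun i => i.elim, by simp [sg], ?_⟩
    have := D_even (k := k) 0
    have h2 := kap_le_D (k := k) 0 (⋃ i : Empty, ln (i.elim) (i.elim))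
    simp only [sg, mul_zero, zero_mul] at this ⊢
    rw [this] at h2
    exact Nat.le_zero.1 h2
  | succ e ih =>
    obtain ⟨ι, _, p, p', hc, h⟩ := ih
    obtain ⟨κ, _, σ, hκ, hA⟩ := lemA (k := k) (2 * e + 2)
    have hD := D_even (k := k) e
    have hD' := D_even (k := k) (e + 1)
    simp only [sg] at hD'
    obtain ⟨τ0, hτ0, hτ0'⟩ := normalize 1 (2 * e) 0 p p' (fun i => ⟨_, (one_mul _).symm⟩)
      (fun i => ⟨_, (one_mul _).symm⟩) h.le
    rw [show 2 * (e + 1) = 2 * e + 2 by ring] at hD' ⊢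
    obtain ⟨τ, hτ⟩ := qstep 1 (2 * e) (⋃ i, ln (ev (σ i) (PA k)) (ev (σ i) (PA' k))) (by
      intro v hv
      obtain ⟨i, hv⟩ := Set.mem_iUnion.1 hv
      exact PA_Q _ _ hv) 0 (D k (2 * e)) τ0 hτ0 hτ0' (by
        apply kap_Q
        intro v hQ
        right
        exact param 1 v hQ ⟨_, (one_mul _).symm⟩) (by rw [hc]; nlinarith)
    refine ⟨ι ⊕ κ, inferInstance, Sum.elim (fun i => ev (τ (i, 0)) (gq 1)) (fun i => ev (σ i) (PA k)),
      Sum.elim (fun i => ev (τ (i, 1)) (gq 1)) (fun i => ev (σ i) (PA' k)), ?_, ?_⟩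
    · simp [hc, hκ, sg]
    · have h1 := kap_union_sum (2 * e + 2) (fun i => ev (τ (i, 0)) (gq 1))
        (fun i => ev (τ (i, 1)) (gq 1)) (fun i => ev (σ i) (PA k)) (fun i => ev (σ i) (PA' k))
      omega

theorem lines_sub [CharZero k] {ι : Type} [Fintype ι] (d : ℕ) (p p' : ι → Fin 5 → k) (N a : ℕ)
    (hc : Fintype.card ι = N) (ha : a ≤ N)
    (h : kap d (⋃ i, ln (p i) (p' i)) + N * (d + 1) ≤ D k d) :
    ∃ f : Fin a → ι, kap d (⋃ i, ln (p (f i)) (p' (f i))) + a * (d + 1) ≤ D k d := by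
  classical
  obtain ⟨s, hs⟩ := Finset.exists_subset_card_eq (s := (Finset.univ : Finset ι)) (n := a)
    (by rw [Finset.card_univ, hc]; exact ha)
  let e := s.equivFinOfCardEq hs.2
  refine ⟨fun i => e.symm i, ?_⟩
  have h1 := kap_lines sᶜ d (⋃ i, ln (p (e.symm i)) (p' (e.symm i))) p p'
  have h2 : kap d ((⋃ i, ln (p (e.symm i)) (p' (e.symm i))) ∪ ⋃ i ∈ sᶜ, ln (p i) (p' i))
      ≤ kap d (⋃ i, ln (p i) (p' i)) := by
    apply kap_anti
    intro v hv
    obtain ⟨i, hi⟩ := Set.mem_iUnion.1 hv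
    by_cases his : i ∈ s
    · left
      refine Set.mem_iUnion.2 ⟨e ⟨i, his⟩, ?_⟩
      simpa using hi
    · right
      exact Set.mem_iUnion₂.2 ⟨i, by simpa using his, hi⟩
  have h3 : sᶜ.card + a = N := by
    rw [Finset.card_compl, hs.2, hc]; omega
  have h4 : sᶜ.card * (d + 1) + a * (d + 1) = N * (d + 1) := by rw [← add_mul, h3]
  beta_reduce
  omega

theorem odd_case [IsAlgClosed k] [CharZero k] (e a : ℕ) (ha : a ≤ NB e) :
    ∃ (ι : Type) (_ : Fintype ι) (p p' : ι → Fin 5 → k), Fintype.card ι = sg e + a ∧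
      kap (2 * e + 1) (⋃ i, ln (p i) (p' i)) ≤ D k (2 * e + 1) - (sg e + a) * (2 * e + 2) := by
  obtain ⟨ι, _, p, p', hc, h⟩ := even_case (k := k) e
  obtain ⟨κ, _, q, q', hκ, hq, hq', hB⟩ := lemB (k := k) e
  obtain ⟨f, hf⟩ := lines_sub _ q q' _ a hκ ha hB
  have hD := D_even (k := k) e
  let P : Fin 5 → MvPolynomial (Fin 2 × Fin 5) k := fun c => X (0, c)
  let P' : Fin 5 → MvPolynomial (Fin 2 × Fin 5) k := fun c => X (1, c)
  have hS0 : ∀ v ∈ ⋃ i, ln (q (f i)) (q' (f i)), v 2 = 0 := by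
    intro v hv
    obtain ⟨i, x, y, rfl⟩ := Set.mem_iUnion.1 hv
    simp [hq, hq']
  have hH : kap (2 * e + 1) ((⋃ i, ln (q (f i)) (q' (f i))) ∪
      Set.range (fun τ => ev τ (meet P P'))) ≤ D k (2 * e) := by
    apply kap_H
    intro v hv
    right
    refine ⟨fun x => if x.1 = 0 then v x.2 else if x.2 = 2 then 1 else 0, ?_⟩
    funext c
    by_cases hc2 : c = 2
    · subst hc2; simp [ev, meet, P, P', hv]
    · simp [ev, meet, P, P', hv]
  obtain ⟨τ, hτ⟩ := hstep P P' (by simp [P']) (2 * e) (⋃ i, ln (q (f i)) (q' (f i))) hS0 0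
    (max (D k (2 * e + 1) - a * (2 * e + 2) - sg e) (D k (2 * e)))
    (fun i x => if x.1 = 0 then p i x.2 else p' i x.2) (by
      refine le_trans (le_of_eq ?_) h.le
      congr 2
      funext i
      congr 1 <;> funext c <;> simp [ev, P, P']) (hH.trans (le_max_right _ _)) (by
      rw [hc]
      have := le_max_left (D k (2 * e + 1) - a * (2 * e + 2) - sg e) (D k (2 * e))
      have e1 : a * (2 * e + 1 + 1) = a * (2 * e + 2) := by ring
      omega)
  refine ⟨ι ⊕ Fin a, inferInstance, Sum.elim (fun i => ev (τ i) P) (fun i => q (f i)),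
    Sum.elim (fun i => ev (τ i) P') (fun i => q' (f i)), by simp [hc], ?_⟩
  refine (kap_union_sum _ _ _ _ _).trans ?_
  have e2 : (sg e + a) * (2 * e + 2) = sg e * (2 * e + 1) + sg e + a * (2 * e + 2) := by ring
  rw [e2, ← hD]
  omega

theorem D_odd (e : ℕ) : D k (2 * e + 1) ≤ (sg e + NB e) * (2 * e + 2) := by
  have h1 := D_formula (k := k) (2 * e + 1)
  have h2 := sg_eq e
  have h3 := NB_eq e
  have : 24 * D k (2 * e + 1) ≤ 24 * ((sg e + NB e) * (2 * e + 2)) := by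
    rw [h1]
    have : 24 * ((sg e + NB e) * (2 * e + 2)) = 4 * (6 * sg e) * (2 * e + 2)
      + 12 * (2 * NB e) * (2 * e + 2) := by ring
    rw [this, h2, h3]
    have : 4 * (e * (e + 1) * (2 * e + 7)) * (2 * e + 2) + 12 * (e ^ 2 + 5 * e + 2) * (2 * e + 2)
      = (2 * e + 1) * (2 * e + 1 + 1) * (2 * e + 1 + 2) * (2 * e + 1 + 7) + (2 * e + 2) * (18 * e) := by ring
    rw [this]
    exact Nat.le_add_right _ _
  omega

end lemB
end PL

namespace PL

section final
variable {k : Type} [Field k]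

theorem good_of [CharZero k] {ι : Type} [Fintype ι] (d s0 s : ℕ) (p p' : ι → Fin 5 → k)
    (hc : Fintype.card ι = s0) (h : kap d (⋃ i, ln (p i) (p' i)) ≤ D k d - s0 * (d + 1))
    (hs : (s ≤ s0 ∧ s0 * (d + 1) ≤ D k d) ∨ (s0 ≤ s ∧ D k d ≤ s0 * (d + 1))) :
    ∃ q q' : Fin s → Fin 5 → k, kap d (⋃ i, ln (q i) (q' i)) ≤ D k d - s * (d + 1) := by
  rcases hs with ⟨h1, h2⟩ | ⟨h1, h2⟩
  · obtain ⟨f, hf⟩ := lines_sub d p p' s0 s hc h1 (by omega)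
    exact ⟨fun i => p (f i), fun i => p' (f i), by beta_reduce; omega⟩
  · obtain ⟨f⟩ : Nonempty (ι ↪ Fin s) :=
      Function.Embedding.nonempty_of_card_le (by simpa [hc] using h1)
    refine ⟨Function.extend f p 0, Function.extend f p' 0, ?_⟩
    have h3 : kap d (⋃ i, ln (Function.extend f p 0 i) (Function.extend f p' 0 i))
        ≤ kap d (⋃ i, ln (p i) (p' i)) := by
      apply kap_anti
      intro v hv
      obtain ⟨i, hi⟩ := Set.mem_iUnion.1 hv
      refine Set.mem_iUnion.2 ⟨f i, ?_⟩
      rw [f.injective.extend_apply, f.injective.extend_apply]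
      exact hi
    omega

theorem good [IsAlgClosed k] [CharZero k] (d s : ℕ) :
    ∃ q q' : Fin s → Fin 5 → k, kap d (⋃ i, ln (q i) (q' i)) ≤ D k d - s * (d + 1) := by
  obtain ⟨e, rfl | rfl⟩ := Nat.even_or_odd' d
  · obtain ⟨ι, _, p, p', hc, h⟩ := even_case (k := k) e
    have hD := D_even (k := k) e
    refine good_of _ _ s p p' hc (by rw [h]; exact Nat.zero_le _) ?_
    rcases le_total s (sg e) with h1 | h1
    · exact Or.inl ⟨h1, hD.ge⟩
    · exact Or.inr ⟨h1, hD.le⟩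
  · have hlow : sg e * (2 * e + 1 + 1) ≤ D k (2 * e + 1) := by
      have h1 := D_formula (k := k) (2 * e + 1)
      have h2 := sg_eq e
      have : 24 * (sg e * (2 * e + 1 + 1)) ≤ 24 * D k (2 * e + 1) := by
        rw [h1]
        have : 24 * (sg e * (2 * e + 1 + 1)) = 4 * (6 * sg e) * (2 * e + 2) := by ring
        rw [this, h2]
        have : (2 * e + 1) * (2 * e + 1 + 1) * (2 * e + 1 + 2) * (2 * e + 1 + 7)
          = 4 * (e * (e + 1) * (2 * e + 7)) * (2 * e + 2)
            + (12 * e ^ 2 + 42 * e + 24) * (2 * e + 2) := by ring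
        rw [this]
        exact Nat.le_add_right _ _
      omega
    have hup := D_odd (k := k) e
    rcases le_total s (sg e) with h1 | h1
    · obtain ⟨ι, _, p, p', hc, h⟩ := odd_case (k := k) e 0 (Nat.zero_le _)
      exact good_of _ _ s p p' hc h (Or.inl ⟨h1, hlow⟩)
    · rcases le_total s (sg e + NB e) with h2 | h2
      · obtain ⟨a, rfl⟩ := Nat.exists_eq_add_of_le h1
        obtain ⟨ι, _, p, p', hc, h⟩ := odd_case (k := k) e a (by omega)
        refine good_of _ _ _ p p' hc h ?_
        rcases le_total ((sg e + a) * (2 * e + 1 + 1)) (D k (2 * e + 1)) with h3 | h3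
        · exact Or.inl ⟨le_rfl, h3⟩
        · exact Or.inr ⟨le_rfl, h3⟩
      · obtain ⟨ι, _, p, p', hc, h⟩ := odd_case (k := k) e (NB e) le_rfl
        exact good_of _ _ _ p p' hc h (Or.inr ⟨h2, hup⟩)

theorem gen_disj {T : Type} (i j : Fin 2 → Fin 5 → T)
    (hij : Function.Injective (fun x : (Fin 2 ⊕ Fin 2) × Fin 5 => Sum.elim i j x.1 x.2)) :
    Gen (fun τ : T → k => ∀ v : Fin 4 → k, (∀ c : Fin 5, v 0 * τ (i 0 c) + v 1 * τ (i 1 c)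
      + v 2 * τ (j 0 c) + v 3 * τ (j 1 c) = 0) → v = 0) := by
  classical
  let pt : (Fin 2 ⊕ Fin 2) × Fin 5 → k := fun x =>
    match x.1 with
    | Sum.inl a => if x.2 = ![0, 1] a then 1 else 0
    | Sum.inr a => if x.2 = ![2, 3] a then 1 else 0
  let φ : Fin 5 → (Fin 4 → k) →ₗ[k] MvPolynomial T k := fun c =>
    (LinearMap.proj 0).smulRight (X (i 0 c)) + (LinearMap.proj 1).smulRight (X (i 1 c))
    + (LinearMap.proj 2).smulRight (X (j 0 c)) + (LinearMap.proj 3).smulRight (X (j 1 c))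
  have hφ : ∀ (τ : T → k) c v, eval τ (φ c v) = v 0 * τ (i 0 c) + v 1 * τ (i 1 c)
      + v 2 * τ (j 0 c) + v 3 * τ (j 1 c) := by
    intro τ c v
    simp [φ, smul_eval]
  let τ0 : T → k := Function.extend (fun x : (Fin 2 ⊕ Fin 2) × Fin 5 => Sum.elim i j x.1 x.2) pt 0
  have hi : ∀ a c, τ0 (i a c) = pt (Sum.inl a, c) := fun a c => hij.extend_apply pt 0 (Sum.inl a, c)
  have hj : ∀ a c, τ0 (j a c) = pt (Sum.inr a, c) := fun a c => hij.extend_apply pt 0 (Sum.inr a, c)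
  refine (gen_inj φ τ0 ?_).mono ?_
  · intro v hv
    simp only [hφ, hi, hj] at hv
    funext c
    have h0 := hv 0
    have h1 := hv 1
    have h2 := hv 2
    have h3 := hv 3
    simp [pt] at h0 h1 h2 h3
    fin_cases c <;> simp [h0, h1, h2, h3]
  · intro τ h v hv
    exact h v (fun c => by rw [hφ]; exact hv c)

/-- The plane. -/
def Pl0 (k : Type) [Field k] : Submodule k (Fin 5 → k) :=
  LinearMap.ker (LinearMap.pi ![LinearMap.proj 3, LinearMap.proj 4] : (Fin 5 → k) →ₗ[k] (Fin 2 → k))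

theorem mem_Pl0 (v : Fin 5 → k) : v ∈ Pl0 k ↔ v 3 = 0 ∧ v 4 = 0 := by
  simp [Pl0, LinearMap.mem_ker, funext_iff, Fin.forall_fin_two]

theorem finrank_Pl0 : Module.finrank k (Pl0 k) = 3 := by
  have h := LinearMap.finrank_range_add_finrank_ker
    (LinearMap.pi ![LinearMap.proj 3, LinearMap.proj 4] : (Fin 5 → k) →ₗ[k] (Fin 2 → k))
  rw [LinearMap.range_eq_top.2] at h
  · simp at h
    rw [Pl0]
    omega
  · intro w
    refine ⟨![0, 0, 0, w 0, w 1], ?_⟩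
    funext c
    fin_cases c <;> simp

theorem eps_iff [CharZero k] (f : MvPolynomial (Fin 5) k) :
    eps f = 0 ↔ ∀ v ∈ Pl0 k, eval v f = 0 := by
  have key : ∀ τ : Fin 3 → k, eval τ (eps f) = eval ![τ 0, τ 1, τ 2, 0, 0] f := by
    intro τ
    rw [eps, eval_aeval]
    congr 2
    funext c
    fin_cases c <;> simp [ev]
  constructor
  · intro h v hv
    rw [mem_Pl0] at hv
    have := key ![v 0, v 1, v 2]
    rw [h, map_zero] at this
    rw [this]
    congr 2
    funext c
    fin_cases c <;> simp [hv]
  · intro h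
    apply MvPolynomial.funext
    intro τ
    rw [key, map_zero]
    apply h
    rw [mem_Pl0]
    simp

theorem mem_span_ln (p p' v : Fin 5 → k) :
    v ∈ Submodule.span k (Set.range ![p, p']) ↔ v ∈ ln p p' := by
  rw [Matrix.range_cons_cons_empty, Submodule.mem_span_pair]
  constructor
  · rintro ⟨a, b, h⟩; exact ⟨a, b, h.symm⟩
  · rintro ⟨a, b, h⟩; exact ⟨a, b, h.symm⟩

theorem hdim_eq [CharZero k] {s : ℕ} (d : ℕ) (p p' : Fin s → Fin 5 → k) :
    hdim k 5 (vanIdeal k 5 ↑(Pl0 k) ⊓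
      ⨅ i, vanIdeal k 5 ↑(Submodule.span k (Set.range ![p i, p' i]))) d
      = kap d (⋃ i, ln (p i) (p' i)) := by
  rw [hdim, kap]
  refine congrArg (fun U : Submodule k (MvPolynomial (Fin 5) k) => Module.finrank k U) ?_
  ext f
  have hv : ∀ V : Set (Fin 5 → k), f ∈ vanIdeal k 5 V ↔ ∀ v ∈ V, eval v f = 0 :=
    fun V => Iff.rfl
  rw [mem_Kr, mem_W, Submodule.mem_inf, Submodule.restrictScalars_mem, Submodule.mem_inf,
    Submodule.mem_iInf, mem_homogeneousSubmodule, hv, eps_iff]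
  simp only [hv, SetLike.mem_coe, mem_span_ln, Set.mem_iUnion]
  constructor
  · rintro ⟨⟨h1, h2⟩, h3⟩
    exact ⟨⟨h3, h1⟩, fun v ⟨i, hi⟩ => h2 i v hi⟩
  · rintro ⟨⟨h3, h1⟩, h2⟩
    exact ⟨⟨h1, fun i v hi => h2 v ⟨i, hi⟩⟩, h3⟩

theorem main [IsAlgClosed k] [CharZero k] (d s : ℕ) :
    ∃ (Pl : Submodule k (Fin 5 → k)) (L : Fin s → Submodule k (Fin 5 → k)),
      Module.finrank k Pl = 3 ∧
      (∀ i, Module.finrank k (L i) = 2) ∧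
      (∀ i j, i ≠ j → L i ⊓ L j = ⊥) ∧
      (∀ i, L i ⊓ Pl = ⊥) ∧
      (hdim k 5 (vanIdeal k 5 ↑Pl ⊓ ⨅ i, vanIdeal k 5 ↑(L i)) d : ℤ)
        = max (((d+4).choose 4 : ℤ) - ((d+2).choose 2 : ℤ) - s * (d+1)) 0 := by
  classical
  obtain ⟨q, q', hq⟩ := good (k := k) d s
  let P : Fin 2 → Fin s → Fin 5 → MvPolynomial (Fin s × Fin 2 × Fin 5) k :=
    fun a i c => X (i, a, c)
  have hP : ∀ a i τ, ev τ (P a i) = fun c => τ (i, a, c) := by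
    intro a i τ; funext c; simp [ev, P]
  have g1 := gen_lines d ∅ (P 0) (P 1)
    (fun x => if x.2.1 = 0 then q x.1 x.2.2 else q' x.1 x.2.2) (D k d - s * (d + 1)) (by
      simpa [hP] using hq)
  have g2 : Gen (fun τ : Fin s × Fin 2 × Fin 5 → k => ∀ i,
      eval τ (X (i, 0, 3) * X (i, 1, 4) - X (i, 0, 4) * X (i, 1, 3) : MvPolynomial _ k) ≠ 0) := by
    apply Gen.all
    intro i
    refine gen_ne _ (fun x => if x.2.1 = 0 ∧ x.2.2 = 3 ∨ x.2.1 = 1 ∧ x.2.2 = 4 then 1 else 0) ?_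
    simp
  have g3 : Gen (fun τ : Fin s × Fin 2 × Fin 5 → k => ∀ x : {x : Fin s × Fin s // x.1 ≠ x.2},
      ∀ v : Fin 4 → k, (∀ c : Fin 5, v 0 * τ (x.1.1, 0, c) + v 1 * τ (x.1.1, 1, c)
      + v 2 * τ (x.1.2, 0, c) + v 3 * τ (x.1.2, 1, c) = 0) → v = 0) := by
    apply Gen.all
    rintro ⟨⟨i, j⟩, hij⟩
    refine gen_disj (fun a c => (i, a, c)) (fun a c => (j, a, c)) ?_
    rintro ⟨a | a, c⟩ ⟨b | b, c'⟩ h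
    · simp at h; simp [h]
    · simp at h; exact absurd h.1 hij
    · simp at h; exact absurd h.1.symm hij
    · simp at h; simp [h]
  obtain ⟨τ, ⟨t1, t2⟩, t3⟩ := ((g1.and g2).and g3).exists
  simp only [hP, Set.empty_union] at t1
  simp only [map_sub, map_mul, eval_X] at t2
  let p : Fin s → Fin 5 → k := fun i c => τ (i, 0, c)
  let p' : Fin s → Fin 5 → k := fun i c => τ (i, 1, c)
  have hind : ∀ (i : Fin s) (a b : k), (a • p i + b • p' i) 3 = 0 → (a • p i + b • p' i) 4 = 0 →
      a = 0 ∧ b = 0 := by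
    intro i a b h3 h4
    simp only [p, p', Pi.add_apply, Pi.smul_apply, smul_eq_mul] at h3 h4
    have hdet := t2 i
    constructor
    · refine (mul_eq_zero.1 (?_ : a * _ = 0)).resolve_right hdet
      linear_combination τ (i, 1, 4) * h3 - τ (i, 1, 3) * h4
    · refine (mul_eq_zero.1 (?_ : b * _ = 0)).resolve_right hdet
      linear_combination τ (i, 0, 3) * h4 - τ (i, 0, 4) * h3
  refine ⟨Pl0 k, fun i => Submodule.span k (Set.range ![p i, p' i]), finrank_Pl0, ?_, ?_, ?_, ?_⟩
  · intro i
    have hl : LinearIndependent k ![p i, p' i] := by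
      rw [LinearIndependent.pair_iff]
      intro a b hab
      exact hind i a b (by rw [hab]; rfl) (by rw [hab]; rfl)
    simpa using finrank_span_eq_card hl
  · intro i j hij
    rw [Submodule.eq_bot_iff]
    rintro v ⟨h1, h2⟩
    obtain ⟨a, b, rfl⟩ := (mem_span_ln _ _ _).1 h1
    obtain ⟨a', b', h⟩ := (mem_span_ln _ _ _).1 h2
    have := t3 ⟨(i, j), hij⟩ ![a, b, -a', -b'] (by
      intro c
      have := congrFun h c
      simp only [p, p', Pi.add_apply, Pi.smul_apply, smul_eq_mul] at this
      simp
      linear_combination this)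
    have ha := congrFun this 0
    have hb := congrFun this 1
    simp at ha hb
    simp [ha, hb]
  · intro i
    rw [Submodule.eq_bot_iff]
    rintro v ⟨h1, h2⟩
    obtain ⟨a, b, rfl⟩ := (mem_span_ln _ _ _).1 h1
    have h2' := (mem_Pl0 _).1 h2
    obtain ⟨rfl, rfl⟩ := hind i a b h2'.1 h2'.2
    simp
  · rw [hdim_eq]
    have hlow := kap_lines (Finset.univ : Finset (Fin s)) d ∅ p p'
    rw [kap_empty] at hlow
    simp only [Finset.mem_univ, Set.iUnion_true, Set.empty_union, Finset.card_univ,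
      Fintype.card_fin] at hlow
    have hD := D_add (k := k) d
    have t1' : kap d (⋃ i, ln (p i) (p' i)) ≤ D k d - s * (d + 1) := t1
    have e1 : (s : ℤ) * (d + 1) = ((s * (d + 1) : ℕ) : ℤ) := by push_cast; ring
    rw [e1]
    omega

end final
end PL

/-- A generic union of one plane and `s` generic lines in `ℙ^4` has
bipolynomial Hilbert function. -/
theorem stmt1 (k : Type) [Field k] [IsAlgClosed k] [CharZero k]
    (d s : ℕ) (hd : 1 ≤ d) :
    ∃ (Pl : Submodule k (Fin 5 → k)) (L : Fin s → Submodule k (Fin 5 → k)),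
      Module.finrank k Pl = 3 ∧
      (∀ i, Module.finrank k (L i) = 2) ∧
      (∀ i j, i ≠ j → L i ⊓ L j = ⊥) ∧
      (∀ i, L i ⊓ Pl = ⊥) ∧
      (hdim k 5 (vanIdeal k 5 ↑Pl ⊓ ⨅ i, vanIdeal k 5 ↑(L i)) d : ℤ)
        = max (((d+4).choose 4 : ℤ) - ((d+2).choose 2 : ℤ) - s * (d+1)) 0 := by
  exact PL.main d s
end

section
/- Let k be an algebraically closed field of characteristic zero, let d ≥ 1 and s ≥ 0 be integers. Then there exist a plane Π (a 3-dimensional linear subspace of k^4) and s pairwise disjoint lines L_1,…,L_s (2-dimensional linear subspaces of k^4) in P^3, none contained in Π, such that the ideal I_X = I(Π) ∩ I(L_1) ∩ ⋯ ∩ I(L_s) in k[x_0,…,x_3] satisfies dim (I_X)_d = max{ 0, C(d+2,3) − s·d }; equivalently HF(X,d) = C(d+3,3) − max{0, C(d+2,3) − s·d} = min{ C(d+3,3), C(d+2,2) + s·d }, so X has bipolynomial Hilbert function. -/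
open MvPolynomial

/-! ### Polynomial functions of one parameter -/

section HH

variable {k : Type} [Field k]

def PF (f : k → k) : Prop := ∃ p : Polynomial k, ∀ t, f t = p.eval t

lemma PF.const (a : k) : PF (fun _ : k => a) := ⟨Polynomial.C a, by simp⟩

lemma PF.id : PF (fun t : k => t) := ⟨Polynomial.X, by simp⟩

lemma PF.add {f g : k → k} (hf : PF f) (hg : PF g) : PF (fun t => f t + g t) := by
  obtain ⟨p, hp⟩ := hf
  obtain ⟨q, hq⟩ := hg
  exact ⟨p + q, by simp [hp, hq]⟩

lemma PF.sub {f g : k → k} (hf : PF f) (hg : PF g) : PF (fun t => f t - g t) := by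
  obtain ⟨p, hp⟩ := hf
  obtain ⟨q, hq⟩ := hg
  exact ⟨p - q, by simp [hp, hq]⟩

lemma PF.mul {f g : k → k} (hf : PF f) (hg : PF g) : PF (fun t => f t * g t) := by
  obtain ⟨p, hp⟩ := hf
  obtain ⟨q, hq⟩ := hg
  exact ⟨p * q, by simp [hp, hq]⟩

lemma PF.sum {ι : Type*} (s : Finset ι) {f : ι → k → k} (hf : ∀ i, PF (f i)) :
    PF (fun t => ∑ i ∈ s, f i t) := by
  choose p hp using hf
  exact ⟨∑ i ∈ s, p i, by simp [hp, Polynomial.eval_finsetSum]⟩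

lemma PF.prod {ι : Type*} (s : Finset ι) {f : ι → k → k} (hf : ∀ i, PF (f i)) :
    PF (fun t => ∏ i ∈ s, f i t) := by
  choose p hp using hf
  exact ⟨∏ i ∈ s, p i, by simp [hp, Polynomial.eval_prod]⟩

lemma PF.det {n : Type*} [Fintype n] [DecidableEq n] {M : k → Matrix n n k}
    (h : ∀ i j, PF (fun t => M t i j)) : PF (fun t => (M t).det) := by
  simp only [Matrix.det_apply']
  exact PF.sum _ fun σ => (PF.const _).mul (PF.prod _ fun i => h _ _)

lemma PF.eval {v : k → Fin 3 → k} (h : ∀ i, PF (fun t => v t i)) (F : MvPolynomial (Fin 3) k) :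
    PF (fun t => MvPolynomial.eval (v t) F) := by
  induction F using MvPolynomial.induction_on with
  | C a => simpa using PF.const a
  | add p q hp hq => simpa using hp.add hq
  | mul_X p i hp => simpa using hp.mul (h i)

/-! ### Polynomial systems of linear equations -/

def PS {E : Type*} [AddCommGroup E] [Module k E] (A : k → E → Prop) : Prop :=
  ∃ S : Set (k → Module.Dual k E), (∀ L ∈ S, ∀ e, PF (fun t => L t e)) ∧
    ∀ t e, A t e ↔ ∀ L ∈ S, L t e = 0

section PS
variable {E : Type*} [AddCommGroup E] [Module k E]

lemma PS.and {A B : k → E → Prop} (hA : PS A) (hB : PS B) : PS (fun t e => A t e ∧ B t e) := by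
  obtain ⟨S, hS, hS'⟩ := hA
  obtain ⟨T, hT, hT'⟩ := hB
  refine ⟨S ∪ T, ?_, ?_⟩
  · rintro L (hL | hL)
    exacts [hS L hL, hT L hL]
  · intro t e
    simp only [hS', hT', Set.mem_union]
    constructor
    · rintro ⟨h1, h2⟩ L (hL | hL)
      exacts [h1 L hL, h2 L hL]
    · intro h
      exact ⟨fun L hL => h L (Or.inl hL), fun L hL => h L (Or.inr hL)⟩

lemma PS.all {J : Sort*} {A : J → k → E → Prop} (hA : ∀ j, PS (A j)) :
    PS (fun t e => ∀ j, A j t e) := by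
  choose S hS hS' using hA
  refine ⟨⋃ j, S j, ?_, ?_⟩
  · intro L hL
    obtain ⟨j, hj⟩ := Set.mem_iUnion.1 hL
    exact hS j L hj
  · intro t e
    simp only [hS', Set.mem_iUnion]
    constructor
    · rintro h L ⟨j, hj⟩
      exact h j L hj
    · intro h j L hL
      exact h L ⟨j, hL⟩

lemma PS.base {f : k → E → k} (hl : ∀ t, IsLinearMap k (f t)) (hp : ∀ e, PF (fun t => f t e)) :
    PS (fun t e => f t e = 0) := by
  refine ⟨{fun t => (hl t).mk'}, ?_, ?_⟩
  · rintro L rfl e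
    exact hp e
  · intro t e
    simp

lemma PS.opn [Module.Finite k E] {A : k → E → Prop} (hA : PS A) {t0 : k}
    (h : ∀ e, A t0 e → e = 0) :
    ∃ p : Polynomial k, p.eval t0 ≠ 0 ∧ ∀ t, p.eval t ≠ 0 → ∀ e, A t e → e = 0 := by
  obtain ⟨S, hS, hS'⟩ := hA
  obtain ⟨f, hf, hspan, -⟩ := Submodule.exists_fun_fin_finrank_span_eq k
    ((fun L : k → Module.Dual k E => L t0) '' S)
  choose L hLS hL using hf
  -- the map given by the chosen functionals at parameter `t`
  let Φ : k → (E →ₗ[k] (_ → k)) := fun t => LinearMap.pi (fun i => L i t)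
  have hker : LinearMap.ker (Φ t0) = ⊥ := by
    rw [LinearMap.ker_eq_bot']
    intro e he
    apply h
    rw [hS']
    intro M hM
    have hmem : M t0 ∈ Submodule.span k (Set.range f) := by
      rw [hspan]
      exact Submodule.subset_span ⟨M, hM, rfl⟩
    have hle : Submodule.span k (Set.range f) ≤
        LinearMap.ker (LinearMap.applyₗ e : Module.Dual k E →ₗ[k] k) := by
      rw [Submodule.span_le]
      rintro _ ⟨i, rfl⟩
      have := congrFun he i
      simp only [Φ, LinearMap.pi_apply, Pi.zero_apply] at this
      have h2 : f i = L i t0 := (hL i).symm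
      simp [h2, this]
    simpa using hle hmem
  obtain ⟨B, hB⟩ := (Φ t0).exists_leftInverse_of_injective hker
  let b := Module.finBasis k E
  have hPF : PF (fun t => (LinearMap.toMatrix b b (B ∘ₗ Φ t)).det) := by
    apply PF.det
    intro i j
    have : ∀ t, LinearMap.toMatrix b b (B ∘ₗ Φ t) i j
        = ∑ l, L l t (b j) * b.repr (B (Pi.single l 1)) i := by
      intro t
      rw [LinearMap.toMatrix_apply, LinearMap.comp_apply]
      conv_lhs => rw [← Finset.univ_sum_single (Φ t (b j))]
      have h3 : ∀ l, (Pi.single l (Φ t (b j) l) : _ → k) = (L l t (b j)) • Pi.single l (1 : k) := by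
        intro l
        rw [← Pi.single_smul]
        simp [Φ]
      simp only [h3, map_sum, map_smul, Finsupp.coe_finsetSum, Finset.sum_apply,
        Finsupp.smul_apply, smul_eq_mul]
    simp only [this]
    exact PF.sum _ fun l => (hS _ (hLS l) _).mul (PF.const _)
  obtain ⟨p, hp⟩ := hPF
  beta_reduce at hp
  refine ⟨p, ?_, ?_⟩
  · rw [← hp, hB, LinearMap.toMatrix_id]
    simp
  · intro t ht e he
    rw [← hp] at ht
    have hz : Φ t e = 0 := by
      ext i
      exact (hS' t e).1 he _ (hLS i)
    by_contra hne
    apply ht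
    rw [LinearMap.det_toMatrix]
    by_contra hdet
    have hu : IsUnit (LinearMap.det (B ∘ₗ Φ t)) := isUnit_iff_ne_zero.2 hdet
    have hinj : Function.Injective (B ∘ₗ Φ t) :=
      (LinearEquiv.ofIsUnitDet (f := B ∘ₗ Φ t) (v := b) (v' := b)
      (by rw [LinearMap.det_toMatrix]; exact hu)).injective
    exact hne (hinj (by simp [hz]))
end PS

/-! ### Affine forms, the quadric `z = x y`, lines joining two points of it -/

/-- polynomials of total degree at most `d` in the affine coordinates `(z, x, y)` -/
noncomputable def VV (k : Type) [Field k] (d : ℕ) : Submodule k (MvPolynomial (Fin 3) k) :=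
  MvPolynomial.restrictTotalDegree (Fin 3) k d

instance (d : ℕ) : Module.Finite k (VV k d) :=
  inferInstanceAs (Module.Finite k (MvPolynomial.restrictTotalDegree (Fin 3) k d))

lemma mem_VV {d : ℕ} {F : MvPolynomial (Fin 3) k} : F ∈ VV k d ↔ F.totalDegree ≤ d :=
  MvPolynomial.mem_restrictTotalDegree _ _ _

/-- the point of the quadric with coordinates `x, y` -/
def pq (x y : k) : Fin 3 → k := ![x * y, x, y]

/-- the line joining the points `(c 0, c 1)` and `(c 2, c 3)` of the quadric -/
def ln (c : Fin 4 → k) (t : k) : Fin 3 → k :=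
  ![c 0 * c 1 + t * (c 2 * c 3 - c 0 * c 1), c 0 + t * (c 2 - c 0), c 1 + t * (c 3 - c 1)]

lemma ln_zero (c : Fin 4 → k) : ln c 0 = pq (c 0) (c 1) := by
  ext i; fin_cases i <;> simp [ln, pq]

lemma ln_one (c : Fin 4 → k) : ln c 1 = pq (c 2) (c 3) := by
  ext i; fin_cases i <;> simp [ln, pq]

lemma ln_vert (a b b' t : k) : ln ![a, b, a, b'] t = pq a (b + t * (b' - b)) := by
  ext i; fin_cases i <;> simp [ln, pq]; ring

/-- the equation of the quadric -/
noncomputable def WW (k : Type) [Field k] : MvPolynomial (Fin 3) k :=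
  MvPolynomial.X 0 - MvPolynomial.X 1 * MvPolynomial.X 2

lemma eval_WW_pq (x y : k) : MvPolynomial.eval (pq x y) (WW k) = 0 := by
  simp [WW, pq]

lemma eval_WW_ln (c : Fin 4 → k) (t : k) :
    MvPolynomial.eval (ln c t) (WW k) = t * (1 - t) * ((c 2 - c 0) * (c 3 - c 1)) := by
  simp [WW, ln]; ring

lemma natDegree_aeval_le (v : Fin 3 → Polynomial k) (hv : ∀ i, (v i).natDegree ≤ 1)
    (F : MvPolynomial (Fin 3) k) : (MvPolynomial.aeval v F).natDegree ≤ F.totalDegree := by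
  rw [MvPolynomial.aeval_def, MvPolynomial.eval₂_eq']
  apply Polynomial.natDegree_sum_le_of_forall_le
  intro m hm
  refine (Polynomial.natDegree_C_mul_le _ _).trans ?_
  refine (Polynomial.natDegree_prod_le _ _).trans ?_
  have h1 : ∀ i ∈ Finset.univ, (v i ^ m i).natDegree ≤ m i := by
    intro i _
    refine Polynomial.natDegree_pow_le.trans ?_
    have := hv i
    nlinarith
  refine (Finset.sum_le_sum h1).trans ?_
  refine le_trans (le_of_eq ?_) (MvPolynomial.le_totalDegree hm)
  rw [Finsupp.sum_fintype _ _ (fun _ => rfl)]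

lemma eval_aeval_poly (v : Fin 3 → Polynomial k) (F : MvPolynomial (Fin 3) k) (t : k) :
    (MvPolynomial.aeval v F).eval t = MvPolynomial.eval (fun i => (v i).eval t) F := by
  induction F using MvPolynomial.induction_on with
  | C a => simp
  | add p q hp hq => simp [hp, hq]
  | mul_X p i hp => simp [hp]

lemma zero_curve {d : ℕ} {F : MvPolynomial (Fin 3) k} (hF : F ∈ VV k d)
    (v : Fin 3 → Polynomial k) (hv : ∀ i, (v i).natDegree ≤ 1) (T : Finset k) (hT : d < T.card)
    (h : ∀ t ∈ T, MvPolynomial.eval (fun i => (v i).eval t) F = 0) (t : k) :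
    MvPolynomial.eval (fun i => (v i).eval t) F = 0 := by
  have h0 : MvPolynomial.aeval v F = 0 := by
    apply Polynomial.eq_zero_of_natDegree_lt_card_of_eval_eq_zero' _ T
    · intro x hx
      rw [eval_aeval_poly]
      exact h x hx
    · exact ((natDegree_aeval_le v hv F).trans (mem_VV.1 hF)).trans_lt hT
  rw [← eval_aeval_poly, h0, Polynomial.eval_zero]

variable [CharZero k]

lemma zero_curveN {d : ℕ} {F : MvPolynomial (Fin 3) k} (hF : F ∈ VV k d)
    (v : Fin 3 → Polynomial k) (hv : ∀ i, (v i).natDegree ≤ 1) (T : Finset ℕ) (hT : d < T.card)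
    (h : ∀ t ∈ T, MvPolynomial.eval (fun i => (v i).eval (t : k)) F = 0) (t : k) :
    MvPolynomial.eval (fun i => (v i).eval t) F = 0 := by
  classical
  refine zero_curve hF v hv (T.map Nat.castEmbedding) (by simpa using hT) ?_ t
  intro x hx
  obtain ⟨n, hn, rfl⟩ := Finset.mem_map.1 hx
  exact h n hn

lemma zero_x {d : ℕ} {F : MvPolynomial (Fin 3) k} (hF : F ∈ VV k d) (y : k) (T : Finset ℕ)
    (hT : d < T.card) (h : ∀ n ∈ T, MvPolynomial.eval (pq (n : k) y) F = 0) (x : k) :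
    MvPolynomial.eval (pq x y) F = 0 := by
  have key : ∀ t : k, (fun i => ((![Polynomial.X * Polynomial.C y, Polynomial.X, Polynomial.C y] :
      Fin 3 → Polynomial k) i).eval t) = pq t y := by
    intro t; ext i; fin_cases i <;> simp [pq] <;> ring
  have := zero_curveN hF ![Polynomial.X * Polynomial.C y, Polynomial.X, Polynomial.C y] ?_ T hT ?_ x
  · rwa [key] at this
  · intro i
    fin_cases i
    · exact (Polynomial.natDegree_mul_C_le _ _).trans (by simp)
    · simp
    · simp
  · intro n hn
    rw [key]; exact h n hn

lemma zero_y {d : ℕ} {F : MvPolynomial (Fin 3) k} (hF : F ∈ VV k d) (x : k) (T : Finset ℕ)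
    (hT : d < T.card) (h : ∀ n ∈ T, MvPolynomial.eval (pq x (n : k)) F = 0) (y : k) :
    MvPolynomial.eval (pq x y) F = 0 := by
  have key : ∀ t : k, (fun i => ((![Polynomial.C x * Polynomial.X, Polynomial.C x, Polynomial.X] :
      Fin 3 → Polynomial k) i).eval t) = pq x t := by
    intro t; ext i; fin_cases i <;> simp [pq]
  have := zero_curveN hF ![Polynomial.C x * Polynomial.X, Polynomial.C x, Polynomial.X] ?_ T hT ?_ y
  · rwa [key] at this
  · intro i
    fin_cases i
    · exact (Polynomial.natDegree_C_mul_le _ _).trans (by simp)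
    · simp
    · simp
  · intro n hn
    rw [key]; exact h n hn

lemma zero_ln {d : ℕ} {F : MvPolynomial (Fin 3) k} (hF : F ∈ VV k d) (c : Fin 4 → k) (T : Finset ℕ)
    (hT : d < T.card) (h : ∀ n ∈ T, MvPolynomial.eval (ln c (n : k)) F = 0) (t : k) :
    MvPolynomial.eval (ln c t) F = 0 := by
  have key : ∀ t : k, (fun i => ((![Polynomial.C (c 0 * c 1) + Polynomial.X * Polynomial.C (c 2 * c 3 - c 0 * c 1),
      Polynomial.C (c 0) + Polynomial.X * Polynomial.C (c 2 - c 0),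
      Polynomial.C (c 1) + Polynomial.X * Polynomial.C (c 3 - c 1)] :
      Fin 3 → Polynomial k) i).eval t) = ln c t := by
    intro t; ext i; fin_cases i <;> simp [ln]
  have hdeg : ∀ a b : k, (Polynomial.C a + Polynomial.X * Polynomial.C b).natDegree ≤ 1 := by
    intro a b
    refine (Polynomial.natDegree_add_le _ _).trans ?_
    rw [Polynomial.natDegree_C]
    refine max_le (by simp) ((Polynomial.natDegree_mul_C_le _ _).trans (by simp))
  have := zero_curveN hF ![Polynomial.C (c 0 * c 1) + Polynomial.X * Polynomial.C (c 2 * c 3 - c 0 * c 1),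
      Polynomial.C (c 0) + Polynomial.X * Polynomial.C (c 2 - c 0),
      Polynomial.C (c 1) + Polynomial.X * Polynomial.C (c 3 - c 1)] ?_ T hT ?_ t
  · rwa [key] at this
  · intro i
    fin_cases i
    · exact hdeg _ _
    · exact hdeg _ _
    · exact hdeg _ _
  · intro n hn
    rw [key]; exact h n hn

/-- cancelling a factor `t (1 - t)` along a line -/
lemma zero_ln' {d : ℕ} {F : MvPolynomial (Fin 3) k} (hF : F ∈ VV k d) (c : Fin 4 → k)
    (h : ∀ t, t * (1 - t) * MvPolynomial.eval (ln c t) F = 0) (t : k) :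
    MvPolynomial.eval (ln c t) F = 0 := by
  refine zero_ln hF c (Finset.Ico 2 (d + 3)) (by simp) ?_ t
  intro n hn
  rw [Finset.mem_Ico] at hn
  have h1 := h n
  rcases mul_eq_zero.1 h1 with h2 | h2
  · exfalso
    rcases mul_eq_zero.1 h2 with h3 | h3
    · have : n = 0 := by exact_mod_cast h3
      omega
    · have : (n : k) = 1 := by linear_combination -h3
      have : n = 1 := by exact_mod_cast this
      omega
  · exact h2

lemma div_ln {d : ℕ} {G : MvPolynomial (Fin 3) k} (hG : G ∈ VV k d) (c : Fin 4 → k)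
    (h0 : c 2 ≠ c 0) (h1 : c 3 ≠ c 1)
    (h : ∀ t, MvPolynomial.eval (ln c t) (WW k * G) = 0) (t : k) :
    MvPolynomial.eval (ln c t) G = 0 := by
  refine zero_ln' hG c (fun t => ?_) t
  have := h t
  rw [map_mul, eval_WW_ln] at this
  have h2 : (c 2 - c 0) * (c 3 - c 1) ≠ 0 := mul_ne_zero (sub_ne_zero.2 h0) (sub_ne_zero.2 h1)
  have h3 : ((c 2 - c 0) * (c 3 - c 1)) * (t * (1 - t) * MvPolynomial.eval (ln c t) G) = 0 := by
    linear_combination this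
  exact (mul_eq_zero.1 h3).resolve_left h2

/-- divisibility by the equation of the quadric -/
lemma dvd_of_vanish {n : ℕ} {F : MvPolynomial (Fin 3) k} (hF : F ∈ VV k (n + 2))
    (h : ∀ x y, MvPolynomial.eval (pq x y) F = 0) : ∃ G ∈ VV k n, F = WW k * G := by
  have hroot : Polynomial.IsRoot (MvPolynomial.finSuccEquiv k 2 F)
      (MvPolynomial.X 0 * MvPolynomial.X 1) := by
    rw [Polynomial.IsRoot.def]
    apply MvPolynomial.funext
    intro v
    rw [map_zero, ← h (v 0) (v 1)]
    have : pq (v 0) (v 1) = Fin.cons (v 0 * v 1) v := by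
      ext i; fin_cases i <;> simp [pq] <;> rfl
    rw [this, MvPolynomial.eval_eq_eval_mv_eval', Polynomial.eval_map]
    have h2 : v 0 * v 1 = MvPolynomial.eval v (MvPolynomial.X 0 * MvPolynomial.X 1) := by simp
    rw [h2, Polynomial.eval₂_at_apply]
  obtain ⟨g, hg⟩ := Polynomial.dvd_iff_isRoot.2 hroot
  set G := (MvPolynomial.finSuccEquiv k 2).symm g with hGdef
  have hFG : F = WW k * G := by
    apply (MvPolynomial.finSuccEquiv k 2).injective
    rw [map_mul (MvPolynomial.finSuccEquiv k 2) (WW k) G, hGdef, AlgEquiv.apply_symm_apply, hg]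
    congr 1
    symm
    simp only [WW, map_sub, map_mul]
    have h1 : (1 : Fin 3) = Fin.succ 0 := rfl
    have h2 : (2 : Fin 3) = Fin.succ 1 := rfl
    rw [h1, h2, MvPolynomial.finSuccEquiv_X_zero, MvPolynomial.finSuccEquiv_X_succ,
      MvPolynomial.finSuccEquiv_X_succ]
  refine ⟨G, ?_, hFG⟩
  rw [mem_VV]
  rcases eq_or_ne G 0 with hG0 | hG0
  · simp [hG0]
  have hW0 : WW k ≠ 0 := by
    intro h0
    have h1 : MvPolynomial.eval ![1, 0, 0] (WW k) = 1 := by simp [WW]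
    rw [h0] at h1
    simp at h1
  have hdeg := MvPolynomial.totalDegree_mul_of_isDomain hW0 hG0
  rw [← hFG] at hdeg
  have hW2 : 2 ≤ (WW k).totalDegree := by
    have hm : (Finsupp.single 1 1 + Finsupp.single 2 1 : Fin 3 →₀ ℕ) ∈ (WW k).support := by
      rw [MvPolynomial.mem_support_iff]
      have e1 : (MvPolynomial.X 1 * MvPolynomial.X 2 : MvPolynomial (Fin 3) k) =
          MvPolynomial.monomial (Finsupp.single 1 1 + Finsupp.single 2 1) 1 := by
        simp [MvPolynomial.X, MvPolynomial.monomial_mul]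
      have e2 : (Finsupp.single 0 1 : Fin 3 →₀ ℕ) ≠ Finsupp.single 1 1 + Finsupp.single 2 1 := by
        intro h
        have := DFunLike.congr_fun h 0
        simp at this
      rw [WW, e1, MvPolynomial.coeff_sub, MvPolynomial.coeff_X, MvPolynomial.coeff_monomial,
        if_neg e2, if_pos rfl]
      simp
    refine le_trans (le_of_eq ?_) (MvPolynomial.le_totalDegree hm)
    rw [Finsupp.sum_fintype _ _ (fun _ => rfl)]
    simp [Fin.sum_univ_three]
  have := mem_VV.1 hF
  omega

/-- a complement of the forms vanishing on the quadric -/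
lemma exists_compl (d : ℕ) : ∃ C : Submodule k (MvPolynomial (Fin 3) k), C ≤ VV k d ∧
    (∀ F ∈ C, (∀ x y, MvPolynomial.eval (pq x y) F = 0) → F = 0) ∧
    ∀ F ∈ VV k d, ∃ F' ∈ C, ∃ Z ∈ VV k d, (∀ x y, MvPolynomial.eval (pq x y) Z = 0) ∧
      F = F' + Z := by
  let Z : Submodule k (MvPolynomial (Fin 3) k) :=
    { carrier := {F | F ∈ VV k d ∧ ∀ x y, MvPolynomial.eval (pq x y) F = 0}
      add_mem' := fun ha hb => ⟨add_mem ha.1 hb.1, fun x y => by simp [ha.2 x y, hb.2 x y]⟩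
      zero_mem' := ⟨zero_mem _, by simp⟩
      smul_mem' := fun c F hF => ⟨Submodule.smul_mem _ _ hF.1, fun x y => by
        simp [MvPolynomial.smul_eval, hF.2 x y]⟩ }
  obtain ⟨C, hC⟩ := exists_isCompl Z
  refine ⟨C ⊓ VV k d, inf_le_right, ?_, ?_⟩
  · intro F hF h0
    have : F ∈ Z ⊓ C := ⟨⟨hF.2, h0⟩, hF.1⟩
    rw [hC.inf_eq_bot] at this
    simpa using this
  · intro F hF
    have : F ∈ Z ⊔ C := by rw [hC.sup_eq_top]; trivial
    obtain ⟨z, hz, c, hc, rfl⟩ := Submodule.mem_sup.1 this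
    refine ⟨c, ⟨hc, ?_⟩, z, hz.1, hz.2, add_comm _ _⟩
    have := sub_mem hF hz.1
    simpa using this

/-! ### Open conditions on configurations of lines -/

/-- configurations `c` such that a property holds generically along lines of configurations -/
def Opn {ι : Type} (P : (ι → Fin 4 → k) → Prop) : Prop :=
  ∀ c0 c1 : ι → Fin 4 → k, P c0 → ∃ p : Polynomial k, p ≠ 0 ∧
    ∀ t, p.eval t ≠ 0 → P (fun i j => c0 i j + t * (c1 i j - c0 i j))

lemma Opn.and {ι : Type} {P Q : (ι → Fin 4 → k) → Prop} (hP : Opn P) (hQ : Opn Q) :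
    Opn (fun c => P c ∧ Q c) := by
  rintro c0 c1 ⟨h1, h2⟩
  obtain ⟨p, hp, hp'⟩ := hP c0 c1 h1
  obtain ⟨q, hq, hq'⟩ := hQ c0 c1 h2
  refine ⟨p * q, mul_ne_zero hp hq, fun t ht => ?_⟩
  rw [Polynomial.eval_mul] at ht
  exact ⟨hp' t (left_ne_zero_of_mul ht), hq' t (right_ne_zero_of_mul ht)⟩

lemma Opn.all {ι J : Type} [Finite J] {P : J → (ι → Fin 4 → k) → Prop} (hP : ∀ j, Opn (P j)) :
    Opn (fun c => ∀ j, P j c) := by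
  intro c0 c1 h
  cases nonempty_fintype J
  choose p hp hp' using fun j => hP j c0 c1 (h j)
  refine ⟨∏ j, p j, Finset.prod_ne_zero_iff.2 fun j _ => hp j, fun t ht j => ?_⟩
  rw [Polynomial.eval_prod, Finset.prod_ne_zero_iff] at ht
  exact hp' j t (ht j (Finset.mem_univ _))

lemma exists_eval_ne {p : Polynomial k} (hp : p ≠ 0) : ∃ t, p.eval t ≠ 0 := by
  by_contra h
  push Not at h
  exact hp (Polynomial.funext fun t => by rw [h t, Polynomial.eval_zero])

lemma Opn.inter {ι : Type} {P Q : (ι → Fin 4 → k) → Prop} (hP : Opn P) (hQ : Opn Q)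
    {c0 c1 : ι → Fin 4 → k} (h0 : P c0) (h1 : Q c1) : ∃ c, P c ∧ Q c := by
  obtain ⟨p, hp, hp'⟩ := hP c0 c1 h0
  obtain ⟨q, hq, hq'⟩ := hQ c1 c0 h1
  have hq2 : q.comp (1 - Polynomial.X) ≠ 0 := by
    intro h
    apply hq
    have := congrArg (fun r => r.comp (1 - Polynomial.X)) h
    simpa [Polynomial.comp_assoc] using this
  obtain ⟨t, ht⟩ := exists_eval_ne (mul_ne_zero hp hq2)
  rw [Polynomial.eval_mul] at ht
  refine ⟨_, hp' t (left_ne_zero_of_mul ht), ?_⟩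
  have h3 := right_ne_zero_of_mul ht
  rw [Polynomial.eval_comp] at h3
  have h4 := hq' _ h3
  convert h4 using 3
  simp
  ring

lemma Opn.of_ps {ι : Type} {E : Type} [AddCommGroup E] [Module k E] [Module.Finite k E]
    {A : (ι → Fin 4 → k) → E → Prop}
    (hA : ∀ c : k → ι → Fin 4 → k, (∀ i j, PF (fun t => c t i j)) → PS (fun t => A (c t))) :
    Opn (fun c => ∀ e, A c e → e = 0) := by
  intro c0 c1 h
  have hc : ∀ i j, PF (fun t => c0 i j + t * (c1 i j - c0 i j)) := fun i j =>
    (PF.const _).add (PF.id.mul (PF.const _))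
  obtain ⟨p, hp, hp'⟩ := (hA (fun t i j => c0 i j + t * (c1 i j - c0 i j)) hc).opn (t0 := 0)
    (by simpa using h)
  refine ⟨p, ?_, hp'⟩
  rintro rfl
  simp at hp

lemma Opn.of_pf {ι : Type} {f : (ι → Fin 4 → k) → k}
    (hf : ∀ c : k → ι → Fin 4 → k, (∀ i j, PF (fun t => c t i j)) → PF (fun t => f (c t))) :
    Opn (fun c => f c ≠ 0) := by
  intro c0 c1 h
  have hc : ∀ i j, PF (fun t => c0 i j + t * (c1 i j - c0 i j)) := fun i j =>
    (PF.const _).add (PF.id.mul (PF.const _))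
  obtain ⟨p, hp⟩ := hf (fun t i j => c0 i j + t * (c1 i j - c0 i j)) hc
  refine ⟨p, ?_, ?_⟩
  · rintro rfl
    have := hp 0
    simp at this
    exact h this
  · intro t ht
    rw [← hp] at ht
    exact ht

lemma PF.pq {x y : k → k} (hx : PF x) (hy : PF y) (i : Fin 3) : PF (fun t => pq (x t) (y t) i) := by
  fin_cases i
  · simpa [_root_.pq] using hx.mul hy
  · simpa [_root_.pq] using hx
  · simpa [_root_.pq] using hy

lemma PF.ln {c : k → Fin 4 → k} (hc : ∀ j, PF (fun t => c t j)) (τ : k) (i : Fin 3) :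
    PF (fun t => ln (c t) τ i) := by
  fin_cases i
  · simpa [_root_.ln] using ((hc 0).mul (hc 1)).add
      ((PF.const τ).mul (((hc 2).mul (hc 3)).sub ((hc 0).mul (hc 1))))
  · simpa [_root_.ln] using (hc 0).add ((PF.const τ).mul ((hc 2).sub (hc 0)))
  · simpa [_root_.ln] using (hc 1).add ((PF.const τ).mul ((hc 3).sub (hc 1)))

lemma PS.ev {E : Type} [AddCommGroup E] [Module k E] (φ : E →ₗ[k] MvPolynomial (Fin 3) k)
    {v : k → Fin 3 → k} (hv : ∀ i, PF (fun t => v t i)) :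
    PS (fun t e => MvPolynomial.eval (v t) (φ e) = 0) := by
  apply PS.base
  · intro t
    constructor <;> intros <;> simp [MvPolynomial.smul_eval]
  · intro e
    exact PF.eval hv _

lemma PS.ev2 {E : Type} [AddCommGroup E] [Module k E] (φ ψ : E →ₗ[k] MvPolynomial (Fin 3) k)
    {a b : k → k} (ha : PF a) (hb : PF b)
    {v : k → Fin 3 → k} (hv : ∀ i, PF (fun t => v t i)) :
    PS (fun t e => a t * MvPolynomial.eval (v t) (φ e) + b t * MvPolynomial.eval (v t) (ψ e) = 0) := by
  apply PS.base
  · intro t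
    constructor
    · intros; simp; ring
    · intros; simp [MvPolynomial.smul_eval]; ring
  · intro e
    exact (ha.mul (PF.eval hv _)).add (hb.mul (PF.eval hv _))

/-! ### Configurations of lines -/

/-- vanishing on the lines of a configuration -/
def VL {ι : Type} (c : ι → Fin 4 → k) (F : MvPolynomial (Fin 3) k) : Prop :=
  ∀ i τ, MvPolynomial.eval (ln (c i) τ) F = 0

/-- vanishing at the intersection of the lines with the quadric -/
def VP {ι : Type} (c : ι → Fin 4 → k) (F : MvPolynomial (Fin 3) k) : Prop :=
  ∀ i, MvPolynomial.eval (pq (c i 0) (c i 1)) F = 0 ∧ MvPolynomial.eval (pq (c i 2) (c i 3)) F = 0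

lemma VL.vp {ι : Type} {c : ι → Fin 4 → k} {F : MvPolynomial (Fin 3) k} (h : VL c F) : VP c F :=
  fun i => ⟨by rw [← ln_zero]; exact h i 0, by rw [← ln_one]; exact h i 1⟩

def Good {ι : Type} (d : ℕ) (c : ι → Fin 4 → k) : Prop :=
  ∀ F ∈ VV k d, VL c F → F = 0

def Gen {ι : Type} (c : ι → Fin 4 → k) : Prop := ∀ i, c i 2 ≠ c i 0 ∧ c i 3 ≠ c i 1

lemma PS.vl {ι : Type} {E : Type} [AddCommGroup E] [Module k E]
    (φ : E →ₗ[k] MvPolynomial (Fin 3) k)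
    {c : k → ι → Fin 4 → k} (hc : ∀ i j, PF (fun t => c t i j)) : PS (fun t e => VL (c t) (φ e)) :=
  PS.all fun i => PS.all fun τ => PS.ev φ (PF.ln (hc i) τ)

lemma PS.vp {ι : Type} {E : Type} [AddCommGroup E] [Module k E]
    (φ : E →ₗ[k] MvPolynomial (Fin 3) k)
    {c : k → ι → Fin 4 → k} (hc : ∀ i j, PF (fun t => c t i j)) : PS (fun t e => VP (c t) (φ e)) :=
  PS.all fun i => (PS.ev φ (PF.pq (hc i 0) (hc i 1))).and (PS.ev φ (PF.pq (hc i 2) (hc i 3)))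

/-- a constant (parameter independent) evaluation condition -/
lemma PS.evc {E : Type} [AddCommGroup E] [Module k E] (φ : E →ₗ[k] MvPolynomial (Fin 3) k)
    (v : Fin 3 → k) : PS (fun (_ : k) e => MvPolynomial.eval v (φ e) = 0) :=
  PS.ev φ fun i => PF.const (v i)

lemma Opn.good (ι : Type) (d : ℕ) : Opn (fun c : ι → Fin 4 → k => Good d c) := by
  have := Opn.of_ps (ι := ι) (E := VV k d) (A := fun c e => VL c (e : MvPolynomial (Fin 3) k))
    (fun c hc => PS.vl (VV k d).subtype hc)
  convert this using 2 with c
  simp [Good]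

lemma Opn.gen (ι : Type) [Finite ι] : Opn (fun c : ι → Fin 4 → k => Gen c) := by
  have : ∀ i : ι, Opn (fun c : ι → Fin 4 → k => c i 2 - c i 0 ≠ 0 ∧ c i 3 - c i 1 ≠ 0) := fun i =>
    (Opn.of_pf fun c hc => (hc i 2).sub (hc i 0)).and (Opn.of_pf fun c hc => (hc i 3).sub (hc i 1))
  simpa [sub_ne_zero, Gen] using Opn.all this

lemma choice {ι : Type} [Finite ι] {n : ℕ} {P : (ι → Fin 4 → k) → Prop} (hP : Opn P)
    {c0 c1 : ι → Fin 4 → k} (h0 : P c0) (h1 : Good n c1) : ∃ c, Good n c ∧ Gen c ∧ P c := by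
  obtain ⟨c2, h2, h3⟩ := (Opn.good ι n).inter (Opn.gen ι) (c1 := fun _ => ![0, 0, 1, 1]) h1
    (by intro i; simp)
  obtain ⟨c, h4, h5⟩ := ((Opn.good ι n).and (Opn.gen ι)).inter hP ⟨h2, h3⟩ h0
  exact ⟨c, h4.1, h4.2, h5⟩

/-- pairing the points of a finite set into a configuration -/
lemma pairing {ι β : Type} (e : ι × Fin 2 ≃ β) (g : β → k × k) : ∃ c0 : ι → Fin 4 → k,
    ∀ F, VP c0 F → ∀ b, MvPolynomial.eval (pq (g b).1 (g b).2) F = 0 := by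
  refine ⟨fun i => ![(g (e (i, 0))).1, (g (e (i, 0))).2, (g (e (i, 1))).1, (g (e (i, 1))).2], ?_⟩
  intro F hF b
  obtain ⟨⟨i, ε⟩, rfl⟩ := e.surjective b
  have := hF i
  fin_cases ε
  · exact this.1
  · exact this.2

/-! ### First inductive step -/

lemma step0 (r : ℕ) {ι : Type} [Fintype ι] (hcard : 2 * Fintype.card ι = (r + 1) * (3 * r + 4))
    (c1 : ι → Fin 4 → k) (h1 : Good (3 * r + 1) c1) :
    ∃ c : ι ⊕ Fin (2 * r + 3) → Fin 4 → k, Good (3 * r + 3) c := by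
  obtain ⟨C, hC, hC0, hCZ⟩ := exists_compl (k := k) (3 * r + 3)
  haveI : Module.Finite k C := Submodule.finiteDimensional_of_le hC
  have e : ι × Fin 2 ≃ Fin (r + 1) × Fin (3 * r + 4) :=
    Fintype.equivOfCardEq (by simp; linarith)
  obtain ⟨c0, hc0⟩ := pairing e (fun b => (((b.1 : ℕ) : k), ((b.2 : ℕ) : k)))
  have hO : Opn (fun c : ι → Fin 4 → k => ∀ F : C,
      ((∀ j ∈ Finset.Ico (r + 1) (3 * r + 4), ∀ y, MvPolynomial.eval (pq (j : k) y) F.1 = 0) ∧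
        VP c F.1) → F = 0) :=
    Opn.of_ps fun c hc => (PS.all fun j => PS.all fun _ => PS.all fun y => PS.evc C.subtype _).and
      (PS.vp C.subtype hc)
  obtain ⟨c, hg, hgen, hP⟩ := choice hO (c0 := c0) (by
    rintro ⟨F, hF⟩ ⟨hM, hV⟩
    have hV := hc0 F hV
    have hFd := hC hF
    have a1 : ∀ m < 3 * r + 4, ∀ x, MvPolynomial.eval (pq x (m : k)) F = 0 := by
      intro m hm
      refine zero_x hFd _ (Finset.range (3 * r + 4)) (by simp) ?_
      intro n hn
      rw [Finset.mem_range] at hn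
      by_cases h : n < r + 1
      · exact hV (⟨n, h⟩, ⟨m, hm⟩)
      · exact hM n (by simp; omega) _
    have : F = 0 := by
      apply hC0 F hF
      intro x
      refine zero_y hFd _ (Finset.range (3 * r + 4)) (by simp) ?_
      intro n hn
      exact a1 n (by simpa using hn) x
    simpa using this) h1
  refine ⟨Sum.elim c (fun j => ![((r + 1 + j : ℕ) : k), 0, ((r + 1 + j : ℕ) : k), 1]), ?_⟩
  intro F hF hv
  obtain ⟨F', hF', Z, hZ, hZ0, rfl⟩ := hCZ F hF
  have hvc : VL c (F' + Z) := fun i τ => hv (Sum.inl i) τ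
  have hF'0 : F' = 0 := by
    have := hP ⟨F', hF'⟩ ⟨?_, ?_⟩
    · simpa using this
    · intro j hj y
      rw [Finset.mem_Ico] at hj
      have := hv (Sum.inr ⟨j - (r + 1), by omega⟩) y
      simp only [Sum.elim_inr, ln_vert] at this
      rw [show r + 1 + (j - (r + 1)) = j by omega, map_add, hZ0] at this
      simpa using this
    · intro i
      have := hvc.vp i
      rw [map_add, map_add, hZ0, hZ0] at this
      simpa using this
  subst hF'0
  obtain ⟨G, hG, rfl⟩ := dvd_of_vanish (n := 3 * r + 1) hZ hZ0
  have : G = 0 := by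
    apply hg G hG
    intro i τ
    refine div_ln hG (c i) (hgen i).1 (hgen i).2 (fun t => ?_) τ
    simpa using hvc i t
  simp [this]

/-! ### Second inductive step -/

lemma special (r : ℕ) {ι : Type} [Fintype ι] (hcard : 2 * Fintype.card ι = (r + 1) * (3 * r + 2)) :
    ∃ c0 : ι → Fin 4 → k, ∀ F, VP c0 F → ∀ a < r + 1, ∀ m < 3 * r + 3, m ≠ a →
      MvPolynomial.eval (pq (a : k) (m : k)) F = 0 := by
  have e : ι × Fin 2 ≃ Fin (r + 1) × Fin (3 * r + 2) :=
    Fintype.equivOfCardEq (by simp; linarith)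
  obtain ⟨c0, hc0⟩ := pairing e (fun b => (((b.1 : ℕ) : k),
    (((Fin.succAbove (⟨b.1, by omega⟩ : Fin (3 * r + 3)) b.2 : Fin (3 * r + 3)) : ℕ) : k)))
  refine ⟨c0, fun F hF a ha m hm hma => ?_⟩
  have hne : (⟨m, hm⟩ : Fin (3 * r + 3)) ≠ ⟨a, by omega⟩ := by simpa using hma
  obtain ⟨m', hm'⟩ := Fin.exists_succAbove_eq hne
  have := hc0 F hF (⟨a, ha⟩, m')
  simp only [hm'] at this
  exact this

lemma sarg (r : ℕ) {G : MvPolynomial (Fin 3) k} (hG : G ∈ VV k (3 * r + 2))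
    (hM : ∀ j ∈ Finset.Ico (3 * r + 5) (5 * r + 7), ∀ y, MvPolynomial.eval (pq (j : k) y) G = 0)
    (hgrid : ∀ a < r + 1, ∀ m < 3 * r + 3, m ≠ a → MvPolynomial.eval (pq (a : k) (m : k)) G = 0)
    (hN : ∀ i < r + 1, MvPolynomial.eval (pq ((3 * r + 4 : ℕ) : k) (i : k)) G = 0) (x y : k) :
    MvPolynomial.eval (pq x y) G = 0 := by
  have a1 : ∀ i < r + 1, ∀ x, MvPolynomial.eval (pq x (i : k)) G = 0 := by
    intro i hi
    refine zero_x hG _ ((Finset.range (r + 1)).erase i ∪ Finset.Ico (3 * r + 4) (5 * r + 7)) ?_ ?_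
    · rw [Finset.card_union_of_disjoint, Finset.card_erase_of_mem (by simpa using hi)]
      · simp; omega
      · rw [Finset.disjoint_left]
        intro a ha hb
        simp at ha hb
        omega
    · intro n hn
      simp only [Finset.mem_union, Finset.mem_erase, Finset.mem_range, Finset.mem_Ico] at hn
      rcases hn with hn | hn
      · exact hgrid n hn.2 i (by omega) (Ne.symm hn.1)
      · rcases eq_or_ne n (3 * r + 4) with rfl | h
        · exact hN i hi
        · exact hM n (by simp; omega) _
  have a2 : ∀ a < r + 1, ∀ y, MvPolynomial.eval (pq (a : k) y) G = 0 := by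
    intro a ha
    refine zero_y hG _ (Finset.range (3 * r + 3)) (by simp) ?_
    intro m hm
    rw [Finset.mem_range] at hm
    rcases eq_or_ne m a with rfl | h
    · exact a1 m ha _
    · exact hgrid a ha m hm h
  refine zero_x hG _ (Finset.range (r + 1) ∪ Finset.Ico (3 * r + 5) (5 * r + 7)) ?_ ?_ x
  · rw [Finset.card_union_of_disjoint]
    · simp; omega
    · rw [Finset.disjoint_left]
      intro a ha hb
      simp at ha hb
      omega
  · intro n hn
    simp only [Finset.mem_union, Finset.mem_range] at hn
    rcases hn with hn | hn
    · exact a2 n hn y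
    · exact hM n hn y

lemma step2 (r : ℕ) {ι : Type} [Fintype ι] (hcard : 2 * Fintype.card ι = (r + 1) * (3 * r + 2))
    (c1 : ι → Fin 4 → k) (h1 : Good (3 * r) c1) :
    ∃ c : ι ⊕ Fin (2 * r + 2) → Fin 4 → k, ∀ F ∈ VV k (3 * r + 2), VL c F →
      (∀ i < r + 1, MvPolynomial.eval (pq ((3 * r + 4 : ℕ) : k) (i : k)) F = 0) → F = 0 := by
  obtain ⟨C, hC, hC0, hCZ⟩ := exists_compl (k := k) (3 * r + 2)
  haveI : Module.Finite k C := Submodule.finiteDimensional_of_le hC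
  obtain ⟨c0, hc0⟩ := special (k := k) r hcard
  have hO : Opn (fun c : ι → Fin 4 → k => ∀ F : C,
      ((∀ j ∈ Finset.Ico (3 * r + 5) (5 * r + 7), ∀ y, MvPolynomial.eval (pq (j : k) y) F.1 = 0) ∧
        (∀ i < r + 1, MvPolynomial.eval (pq ((3 * r + 4 : ℕ) : k) (i : k)) F.1 = 0) ∧
        VP c F.1) → F = 0) :=
    Opn.of_ps fun c hc => (PS.all fun j => PS.all fun _ => PS.all fun y => PS.evc C.subtype _).and
      ((PS.all fun j => PS.all fun _ => PS.evc C.subtype _).and (PS.vp C.subtype hc))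
  obtain ⟨c, hg, hgen, hP⟩ := choice hO (c0 := c0) (by
    rintro ⟨F, hF⟩ ⟨hM, hN, hV⟩
    have : F = 0 := hC0 F hF (sarg r (hC hF) hM (hc0 F hV) hN)
    simpa using this) h1
  refine ⟨Sum.elim c (fun j => ![((3 * r + 5 + j : ℕ) : k), 0, ((3 * r + 5 + j : ℕ) : k), 1]), ?_⟩
  intro F hF hv hN
  obtain ⟨F', hF', Z, hZ, hZ0, rfl⟩ := hCZ F hF
  have hvc : VL c (F' + Z) := fun i τ => hv (Sum.inl i) τ
  have hF'0 : F' = 0 := by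
    have := hP ⟨F', hF'⟩ ⟨?_, ?_, ?_⟩
    · simpa using this
    · intro j hj y
      rw [Finset.mem_Ico] at hj
      have := hv (Sum.inr ⟨j - (3 * r + 5), by omega⟩) y
      simp only [Sum.elim_inr, ln_vert] at this
      rw [show 3 * r + 5 + (j - (3 * r + 5)) = j by omega, map_add, hZ0] at this
      simpa using this
    · intro i hi
      have := hN i hi
      rw [map_add, hZ0] at this
      simpa using this
    · intro i
      have := hvc.vp i
      rw [map_add, map_add, hZ0, hZ0] at this
      simpa using this
  subst hF'0
  obtain ⟨G, hG, rfl⟩ := dvd_of_vanish (n := 3 * r) hZ hZ0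
  have : G = 0 := by
    apply hg G hG
    intro i τ
    refine div_ln hG (c i) (hgen i).1 (hgen i).2 (fun t => ?_) τ
    simpa using hvc i t
  simp [this]

/-! ### Third inductive step -/

lemma h1arg (r : ℕ) {G F : MvPolynomial (Fin 3) k} (hG : G ∈ VV k (3 * r + 2))
    (hF : F ∈ VV k (3 * r + 4))
    (hM : ∀ i < r + 1, ∀ ε < 2, ∀ y,
      MvPolynomial.eval (pq ((3 * r + 5 + 2 * i + ε : ℕ) : k) y) G = 0)
    (hgG : ∀ a < r + 1, ∀ m < 3 * r + 3, m ≠ a → MvPolynomial.eval (pq (a : k) (m : k)) G = 0)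
    (hgF : ∀ a < r + 1, ∀ m < 3 * r + 3, m ≠ a → MvPolynomial.eval (pq (a : k) (m : k)) F = 0)
    (hM' : ∀ j ∈ Finset.Ico (r + 1) (3 * r + 4), ∀ y, MvPolynomial.eval (pq (j : k) y) F = 0)
    (hE : ∀ i < r + 1, ∀ ε < 2,
      MvPolynomial.eval (pq ((3 * r + 5 + 2 * i + ε : ℕ) : k) (i : k)) F = 0 ∧
      MvPolynomial.eval (pq ((3 * r + 5 + 2 * i + ε : ℕ) : k) ((3 * r + 3 + ε : ℕ) : k)) F = 0)
    (hN : ∀ τ : k, τ * (1 - τ) *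
      MvPolynomial.eval (pq ((3 * r + 4 : ℕ) : k) (((r + 1 : ℕ) : k) + τ)) G +
      MvPolynomial.eval (pq ((3 * r + 4 : ℕ) : k) (((r + 1 : ℕ) : k) + τ)) F = 0) :
    (∀ x y, MvPolynomial.eval (pq x y) G = 0) ∧ ∀ x y, MvPolynomial.eval (pq x y) F = 0 := by
  have a1 : ∀ i < r + 1, ∀ x, MvPolynomial.eval (pq x (i : k)) F = 0 := by
    intro i hi
    refine zero_x hF _ ((Finset.range (3 * r + 4)).erase i ∪
      Finset.Ico (3 * r + 5 + 2 * i) (3 * r + 5 + 2 * i + 2)) ?_ ?_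
    · rw [Finset.card_union_of_disjoint, Finset.card_erase_of_mem (by simp; omega)]
      · simp
      · rw [Finset.disjoint_left]
        intro a ha hb
        simp at ha hb
        omega
    · intro n hn
      simp only [Finset.mem_union, Finset.mem_erase, Finset.mem_range, Finset.mem_Ico] at hn
      rcases hn with hn | hn
      · by_cases h : n < r + 1
        · exact hgF n h i (by omega) (Ne.symm hn.1)
        · exact hM' n (by simp; omega) _
      · have := (hE i hi (n - (3 * r + 5 + 2 * i)) (by omega)).1
        rwa [show 3 * r + 5 + 2 * i + (n - (3 * r + 5 + 2 * i)) = n by omega] at this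
  have hG0 : ∀ x y, MvPolynomial.eval (pq x y) G = 0 := by
    apply sarg r hG _ hgG
    · intro i hi
      have h1 := hN ((i : k) - ((r + 1 : ℕ) : k))
      rw [show ((r + 1 : ℕ) : k) + ((i : k) - ((r + 1 : ℕ) : k)) = i by ring, a1 i hi, add_zero] at h1
      refine (mul_eq_zero.1 h1).resolve_left (mul_ne_zero ?_ ?_)
      · rw [sub_ne_zero]
        intro h
        have : i = r + 1 := by exact_mod_cast h
        omega
      · intro h
        have h3 : ((r + 2 : ℕ) : k) = (i : k) := by
          push_cast at h ⊢
          linear_combination h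
        have : r + 2 = i := by exact_mod_cast h3
        omega
    · intro j hj y
      rw [Finset.mem_Ico] at hj
      have := hM ((j - (3 * r + 5)) / 2) (by omega) ((j - (3 * r + 5)) % 2) (by omega) y
      rwa [show 3 * r + 5 + 2 * ((j - (3 * r + 5)) / 2) + (j - (3 * r + 5)) % 2 = j by omega] at this
  refine ⟨hG0, ?_⟩
  have a2 : ∀ y, MvPolynomial.eval (pq ((3 * r + 4 : ℕ) : k) y) F = 0 := by
    intro y
    have h1 := hN (y - ((r + 1 : ℕ) : k))
    rw [hG0, mul_zero, zero_add] at h1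
    rwa [show ((r + 1 : ℕ) : k) + (y - ((r + 1 : ℕ) : k)) = y by ring] at h1
  have a3 : ∀ ε < 2, ∀ x, MvPolynomial.eval (pq x ((3 * r + 3 + ε : ℕ) : k)) F = 0 := by
    intro ε hε
    refine zero_x hF _ (Finset.Ico (r + 1) (3 * r + 5) ∪
      (Finset.range (r + 1)).image (fun i => 3 * r + 5 + 2 * i + ε)) ?_ ?_
    · rw [Finset.card_union_of_disjoint, Finset.card_image_of_injective]
      · simp; omega
      · intro a b hab
        simp at hab
        omega
      · rw [Finset.disjoint_left]
        intro a ha hb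
        simp at ha hb
        omega
    · intro n hn
      simp only [Finset.mem_union, Finset.mem_image, Finset.mem_range, Finset.mem_Ico] at hn
      rcases hn with hn | ⟨i, hi, rfl⟩
      · rcases eq_or_ne n (3 * r + 4) with rfl | h
        · exact a2 _
        · exact hM' n (by simp; omega) _
      · exact (hE i hi ε hε).2
  have a4 : ∀ a < r + 1, ∀ y, MvPolynomial.eval (pq (a : k) y) F = 0 := by
    intro a ha
    refine zero_y hF _ (Finset.range (3 * r + 5)) (by simp) ?_
    intro m hm
    rw [Finset.mem_range] at hm
    by_cases h : m < 3 * r + 3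
    · rcases eq_or_ne m a with rfl | h'
      · exact a1 m ha _
      · exact hgF a ha m h h'
    · have := a3 (m - (3 * r + 3)) (by omega) a
      rwa [show 3 * r + 3 + (m - (3 * r + 3)) = m by omega] at this
  intro x y
  refine zero_x hF _ (Finset.range (3 * r + 5)) (by simp) ?_ x
  intro n hn
  rw [Finset.mem_range] at hn
  by_cases h : n < r + 1
  · exact a4 n h y
  · rcases eq_or_ne n (3 * r + 4) with rfl | h
    · exact a2 y
    · exact hM' n (by simp; omega) y

/-- the transversal lines used in the third step -/
def trl (r i ε : ℕ) (ν : k) : Fin 4 → k :=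
  ![((3 * r + 5 + 2 * i + ε : ℕ) : k), (i : k), ((3 * r + 5 + 2 * i + ε : ℕ) : k) + ν,
    ((3 * r + 3 + ε : ℕ) : k)]

/-- the last line used in the third step -/
def lastl (r : ℕ) (ν : k) : Fin 4 → k :=
  ![((3 * r + 4 : ℕ) : k), ((r + 1 : ℕ) : k), ((3 * r + 4 : ℕ) : k) + ν ^ 2, ((r + 1 : ℕ) : k) + 1]

lemma PF.trl (r i ε : ℕ) (j : Fin 4) : PF (fun ν : k => trl r i ε ν j) := by
  fin_cases j
  · simpa [_root_.trl] using PF.const _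
  · simpa [_root_.trl] using PF.const _
  · simpa [_root_.trl] using (PF.const _).add PF.id
  · simpa [_root_.trl] using PF.const _

lemma PF.lastl (r : ℕ) (j : Fin 4) : PF (fun ν : k => lastl r ν j) := by
  fin_cases j
  · simpa [_root_.lastl] using PF.const _
  · simpa [_root_.lastl] using PF.const _
  · simpa [_root_.lastl, sq] using (PF.const _).add (PF.id.mul PF.id)
  · simpa [_root_.lastl] using PF.const _

lemma step1_aux (r : ℕ) {ι : Type} [Fintype ι]
    (hcard : 2 * Fintype.card ι = (r + 1) * (3 * r + 2))
    (c1 : ι → Fin 4 → k) (h1 : Good (3 * r) c1)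
    (C : Submodule k (MvPolynomial (Fin 3) k)) (hC : C ≤ VV k (3 * r + 4))
    (hC0 : ∀ F ∈ C, (∀ x y, MvPolynomial.eval (pq x y) F = 0) → F = 0) :
    ∃ (c : ι → Fin 4 → k) (ν : k), ν ≠ 0 ∧ ∀ G ∈ VV k (3 * r + 2), ∀ F ∈ C,
      (∀ j ∈ Finset.Ico (r + 1) (3 * r + 4), ∀ y, MvPolynomial.eval (pq (j : k) y) F = 0) →
      VP c F →
      (∀ i < r + 1, ∀ ε < 2, MvPolynomial.eval (ln (trl r i ε ν) 0) F = 0 ∧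
        MvPolynomial.eval (ln (trl r i ε ν) 1) F = 0) →
      (∀ i τ, τ * (1 - τ) * ((c i 2 - c i 0) * (c i 3 - c i 1)) *
        MvPolynomial.eval (ln (c i) τ) G + ν ^ 2 * MvPolynomial.eval (ln (c i) τ) F = 0) →
      (∀ i < r + 1, ∀ ε < 2, ∀ τ, τ * (1 - τ) * (((3 * r + 3 + ε : ℕ) : k) - i) *
        MvPolynomial.eval (ln (trl r i ε ν) τ) G + ν * MvPolynomial.eval (ln (trl r i ε ν) τ) F = 0) →
      (∀ τ, τ * (1 - τ) * MvPolynomial.eval (ln (lastl r ν) τ) G +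
        1 * MvPolynomial.eval (ln (lastl r ν) τ) F = 0) →
      G = 0 ∧ F = 0 := by
  obtain ⟨D, hD, hD0, hDZ⟩ := exists_compl (k := k) (3 * r + 2)
  haveI : Module.Finite k C := Submodule.finiteDimensional_of_le hC
  haveI : Module.Finite k D := Submodule.finiteDimensional_of_le hD
  obtain ⟨c0, hc0⟩ := special (k := k) r hcard
  let φ : (D × C) →ₗ[k] MvPolynomial (Fin 3) k := D.subtype ∘ₗ LinearMap.fst k D C
  let ψ : (D × C) →ₗ[k] MvPolynomial (Fin 3) k := C.subtype ∘ₗ LinearMap.snd k D C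
  have hO : Opn (fun c : ι → Fin 4 → k => ∀ e : D × C,
      ((∀ i < r + 1, ∀ ε < 2, ∀ y,
        MvPolynomial.eval (pq ((3 * r + 5 + 2 * i + ε : ℕ) : k) y) (φ e) = 0) ∧
      VP c (φ e) ∧ VP c (ψ e) ∧
      (∀ j ∈ Finset.Ico (r + 1) (3 * r + 4), ∀ y, MvPolynomial.eval (pq (j : k) y) (ψ e) = 0) ∧
      (∀ i < r + 1, ∀ ε < 2,
        MvPolynomial.eval (pq ((3 * r + 5 + 2 * i + ε : ℕ) : k) (i : k)) (ψ e) = 0 ∧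
        MvPolynomial.eval (pq ((3 * r + 5 + 2 * i + ε : ℕ) : k) ((3 * r + 3 + ε : ℕ) : k)) (ψ e) = 0) ∧
      (∀ τ : k, τ * (1 - τ) *
        MvPolynomial.eval (pq ((3 * r + 4 : ℕ) : k) (((r + 1 : ℕ) : k) + τ)) (φ e) +
        1 * MvPolynomial.eval (pq ((3 * r + 4 : ℕ) : k) (((r + 1 : ℕ) : k) + τ)) (ψ e) = 0))
        → e = 0) := by
    apply Opn.of_ps
    intro c hc
    refine PS.and ?_ (PS.and (PS.vp φ hc) (PS.and (PS.vp ψ hc) (PS.and ?_ (PS.and ?_ ?_))))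
    · exact PS.all fun i => PS.all fun _ => PS.all fun ε => PS.all fun _ => PS.all fun y =>
        PS.evc φ _
    · exact PS.all fun i => PS.all fun _ => PS.all fun y => PS.evc ψ _
    · exact PS.all fun i => PS.all fun _ => PS.all fun ε => PS.all fun _ =>
        (PS.evc ψ _).and (PS.evc ψ _)
    · exact PS.all fun τ => PS.ev2 φ ψ (PF.const _) (PF.const _) (fun i => PF.const _)
  obtain ⟨c, hg, hgen, hP⟩ := choice hO (c0 := c0) (by
    rintro ⟨⟨G, hG⟩, ⟨F, hF⟩⟩ ⟨q1, q2, q3, q4, q5, q6⟩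
    simp only [φ, ψ, LinearMap.comp_apply, LinearMap.fst_apply, LinearMap.snd_apply,
      Submodule.subtype_apply, one_mul] at q1 q2 q3 q4 q5 q6
    have := h1arg r (hD hG) (hC hF) q1 (hc0 G q2) (hc0 F q3) q4 q5 q6
    have e1 := hD0 G hG this.1
    have e2 := hC0 F hF this.2
    subst e1 e2
    rfl) h1
  refine ⟨c, ?_⟩
  let φ' : (VV k (3 * r + 2) × C) →ₗ[k] MvPolynomial (Fin 3) k :=
    (VV k (3 * r + 2)).subtype ∘ₗ LinearMap.fst k _ C
  let ψ' : (VV k (3 * r + 2) × C) →ₗ[k] MvPolynomial (Fin 3) k :=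
    C.subtype ∘ₗ LinearMap.snd k _ C
  have hPS : PS (fun (ν : k) (e : VV k (3 * r + 2) × C) =>
      (∀ j ∈ Finset.Ico (r + 1) (3 * r + 4), ∀ y, MvPolynomial.eval (pq (j : k) y) (ψ' e) = 0) ∧
      VP c (ψ' e) ∧
      (∀ i < r + 1, ∀ ε < 2, MvPolynomial.eval (ln (trl r i ε ν) 0) (ψ' e) = 0 ∧
        MvPolynomial.eval (ln (trl r i ε ν) 1) (ψ' e) = 0) ∧
      (∀ i τ, τ * (1 - τ) * ((c i 2 - c i 0) * (c i 3 - c i 1)) *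
        MvPolynomial.eval (ln (c i) τ) (φ' e) + ν ^ 2 * MvPolynomial.eval (ln (c i) τ) (ψ' e) = 0) ∧
      (∀ i < r + 1, ∀ ε < 2, ∀ τ, τ * (1 - τ) * (((3 * r + 3 + ε : ℕ) : k) - i) *
        MvPolynomial.eval (ln (trl r i ε ν) τ) (φ' e) +
          ν * MvPolynomial.eval (ln (trl r i ε ν) τ) (ψ' e) = 0) ∧
      (∀ τ, τ * (1 - τ) * MvPolynomial.eval (ln (lastl r ν) τ) (φ' e) +
        1 * MvPolynomial.eval (ln (lastl r ν) τ) (ψ' e) = 0)) := by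
    refine PS.and ?_ (PS.and ?_ (PS.and ?_ (PS.and ?_ (PS.and ?_ ?_))))
    · exact PS.all fun i => PS.all fun _ => PS.all fun y => PS.evc ψ' _
    · exact PS.all fun i => (PS.evc ψ' _).and (PS.evc ψ' _)
    · exact PS.all fun i => PS.all fun _ => PS.all fun ε => PS.all fun _ =>
        (PS.ev ψ' (PF.ln (PF.trl r i ε) _)).and (PS.ev ψ' (PF.ln (PF.trl r i ε) _))
    · exact PS.all fun i => PS.all fun τ => PS.ev2 φ' ψ' (PF.const _)
        (by simpa [sq] using PF.id.mul PF.id) (fun i => PF.const _)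
    · exact PS.all fun i => PS.all fun _ => PS.all fun ε => PS.all fun _ => PS.all fun τ =>
        PS.ev2 φ' ψ' (PF.const _) PF.id (PF.ln (PF.trl r i ε) _)
    · exact PS.all fun τ => PS.ev2 φ' ψ' (PF.const _) (PF.const _) (PF.ln (PF.lastl r) _)
  obtain ⟨p, hp0, hp⟩ := hPS.opn (t0 := 0) (by
    rintro ⟨⟨G, hG⟩, ⟨F, hF⟩⟩ ⟨q1, q2, q3, q4, q5, q6⟩
    simp only [φ', ψ', LinearMap.comp_apply, LinearMap.fst_apply, LinearMap.snd_apply,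
      Submodule.subtype_apply, one_mul] at q1 q2 q3 q4 q5 q6
    have hGc : VL c G := by
      intro i τ
      refine zero_ln' hG (c i) (fun t => ?_) τ
      have := q4 i t
      have h2 : (c i 2 - c i 0) * (c i 3 - c i 1) ≠ 0 :=
        mul_ne_zero (sub_ne_zero.2 (hgen i).1) (sub_ne_zero.2 (hgen i).2)
      have h3 : ((c i 2 - c i 0) * (c i 3 - c i 1)) *
          (t * (1 - t) * MvPolynomial.eval (ln (c i) t) G) = 0 := by
        linear_combination this
      exact (mul_eq_zero.1 h3).resolve_left h2
    have hnz : ∀ i < r + 1, ∀ ε < 2, (((3 * r + 3 + ε : ℕ) : k) - i) ≠ 0 := by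
      intro i hi ε hε h
      rw [sub_eq_zero] at h
      have : 3 * r + 3 + ε = i := by exact_mod_cast h
      omega
    have htr : ∀ i ε : ℕ, ∀ τ : k, ln (trl r i ε 0) τ = pq ((3 * r + 5 + 2 * i + ε : ℕ) : k)
        (i + τ * (((3 * r + 3 + ε : ℕ) : k) - i)) := by
      intro i ε τ
      rw [trl, add_zero, ln_vert]
    have hGM : ∀ i < r + 1, ∀ ε < 2, ∀ y,
        MvPolynomial.eval (pq ((3 * r + 5 + 2 * i + ε : ℕ) : k) y) G = 0 := by
      intro i hi ε hε y
      have h3 := zero_ln' hG (trl r i ε 0) (fun t => by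
        have := q5 i hi ε hε t
        have h3 : (((3 * r + 3 + ε : ℕ) : k) - i) *
            (t * (1 - t) * MvPolynomial.eval (ln (trl r i ε 0) t) G) = 0 := by
          linear_combination this
        exact (mul_eq_zero.1 h3).resolve_left (hnz i hi ε hε))
        ((y - i) / (((3 * r + 3 + ε : ℕ) : k) - i))
      rw [htr, div_mul_cancel₀ _ (hnz i hi ε hε)] at h3
      simpa using h3
    obtain ⟨G', hG', Z, hZ, hZ0, rfl⟩ := hDZ G hG
    have key := hP (⟨G', hG'⟩, ⟨F, hF⟩) (by
      simp only [φ, ψ, LinearMap.comp_apply, LinearMap.fst_apply, LinearMap.snd_apply,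
        Submodule.subtype_apply, one_mul]
      refine ⟨?_, ?_, q2, q1, ?_, ?_⟩
      · intro i hi ε hε y
        simpa [hZ0] using hGM i hi ε hε y
      · intro i
        simpa [hZ0] using hGc.vp i
      · intro i hi ε hε
        have := q3 i hi ε hε
        rw [htr, htr] at this
        simpa using this
      · intro τ
        have := q6 τ
        rw [lastl] at this
        simp only [ne_eq, OfNat.ofNat_ne_zero, not_false_eq_true, zero_pow, add_zero, ln_vert,
          add_sub_cancel_left, mul_one, map_add, hZ0] at this
        simpa using this)
    have e1 : G' = 0 := by simpa using congrArg (fun e => (e.1 : MvPolynomial (Fin 3) k)) key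
    have e2 : F = 0 := by simpa using congrArg (fun e => (e.2 : MvPolynomial (Fin 3) k)) key
    subst e1 e2
    obtain ⟨H, hH, rfl⟩ := dvd_of_vanish (n := 3 * r) hZ hZ0
    have : H = 0 := by
      apply hg H hH
      intro i τ
      refine div_ln hH (c i) (hgen i).1 (hgen i).2 (fun t => ?_) τ
      simpa using hGc i t
    subst this
    simp)
  have hp' : p * Polynomial.X ≠ 0 := mul_ne_zero (by rintro rfl; simp at hp0) Polynomial.X_ne_zero
  obtain ⟨ν, hν⟩ := exists_eval_ne hp'
  rw [Polynomial.eval_mul, Polynomial.eval_X] at hν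
  refine ⟨ν, right_ne_zero_of_mul hν, ?_⟩
  intro G hG F hF q1 q2 q3 q4 q5 q6
  have key := hp ν (left_ne_zero_of_mul hν) (⟨G, hG⟩, ⟨F, hF⟩) ⟨q1, q2, q3, q4, q5, q6⟩
  exact ⟨by simpa using congrArg (fun e => (e.1 : MvPolynomial (Fin 3) k)) key,
    by simpa using congrArg (fun e => (e.2 : MvPolynomial (Fin 3) k)) key⟩

lemma step1 (r : ℕ) {ι : Type} [Fintype ι]
    (hcard : 2 * Fintype.card ι = (r + 1) * (3 * r + 2))
    (c1 : ι → Fin 4 → k) (h1 : Good (3 * r) c1) :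
    ∃ c : ι ⊕ ((Fin (r + 1) × Fin 2) ⊕ (Fin (2 * r + 3) ⊕ Unit)) → Fin 4 → k,
      Good (3 * r + 4) c := by
  obtain ⟨C, hC, hC0, hCZ⟩ := exists_compl (k := k) (3 * r + 4)
  obtain ⟨c, ν, hν, hmain⟩ := step1_aux r hcard c1 h1 C hC hC0
  refine ⟨Sum.elim c (Sum.elim (fun p => trl r p.1 p.2 ν) (Sum.elim
    (fun j => ![((r + 1 + j : ℕ) : k), 0, ((r + 1 + j : ℕ) : k), 1]) (fun _ => lastl r ν))), ?_⟩
  intro F hF hv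
  obtain ⟨F', hF', Z, hZ, hZ0, rfl⟩ := hCZ F hF
  obtain ⟨G, hG, rfl⟩ := dvd_of_vanish (n := 3 * r + 2) hZ hZ0
  have hvc : VL c (F' + WW k * G) := fun i τ => hv (Sum.inl i) τ
  have hvt : ∀ i < r + 1, ∀ ε < 2, ∀ τ,
      MvPolynomial.eval (ln (trl r i ε ν) τ) (F' + WW k * G) = 0 := fun i hi ε hε τ =>
    hv (Sum.inr (Sum.inl (⟨i, hi⟩, ⟨ε, hε⟩))) τ
  have hvl : ∀ τ, MvPolynomial.eval (ln (lastl r ν) τ) (F' + WW k * G) = 0 := fun τ =>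
    hv (Sum.inr (Sum.inr (Sum.inr ()))) τ
  have key := hmain G hG ((ν ^ 2)⁻¹ • F') (C.smul_mem _ hF') ?_ ?_ ?_ ?_ ?_ ?_
  · have h2 : F' = 0 := by
      have := key.2
      rcases smul_eq_zero.1 this with h | h
      · exfalso
        exact inv_ne_zero (pow_ne_zero 2 hν) h
      · exact h
    rw [key.1, h2]
    simp
  · intro j hj y
    rw [Finset.mem_Ico] at hj
    have := hv (Sum.inr (Sum.inr (Sum.inl ⟨j - (r + 1), by omega⟩))) y
    simp only [Sum.elim_inr, Sum.elim_inl, ln_vert] at this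
    rw [show r + 1 + (j - (r + 1)) = j by omega, map_add, hZ0] at this
    simp only [sub_zero, mul_one, zero_add, add_zero] at this
    rw [MvPolynomial.smul_eval, this, mul_zero]
  · intro i
    have := hvc.vp i
    rw [map_add, map_add, hZ0, hZ0, add_zero, add_zero] at this
    rw [MvPolynomial.smul_eval, MvPolynomial.smul_eval, this.1, this.2]
    simp
  · intro i hi ε hε
    have u1 := hvt i hi ε hε 0
    have u2 := hvt i hi ε hε 1
    rw [ln_zero, map_add, hZ0, add_zero] at u1
    rw [ln_one, map_add, hZ0, add_zero] at u2
    rw [ln_zero, ln_one, MvPolynomial.smul_eval, MvPolynomial.smul_eval, u1, u2]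
    simp
  · intro i τ
    have := hvc i τ
    rw [map_add, map_mul, eval_WW_ln] at this
    rw [MvPolynomial.smul_eval, mul_inv_cancel_left₀ (pow_ne_zero 2 hν)]
    linear_combination this
  · intro i hi ε hε τ
    have := hvt i hi ε hε τ
    rw [map_add, map_mul, eval_WW_ln] at this
    rw [MvPolynomial.smul_eval]
    simp only [trl, Matrix.cons_val, add_sub_cancel_left] at this ⊢
    field_simp
    linear_combination this
  · intro τ
    have := hvl τ
    rw [map_add, map_mul, eval_WW_ln] at this
    rw [MvPolynomial.smul_eval]
    simp only [lastl, Matrix.cons_val, add_sub_cancel_left] at this ⊢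
    field_simp
    linear_combination this

/-! ### Assembling the induction -/

lemma base0 : Good 0 (fun _ : Unit => (![0, 0, 0, 1] : Fin 4 → k)) := by
  intro F hF h
  have h1 : F.totalDegree = 0 := by have := mem_VV.1 hF; omega
  rw [MvPolynomial.totalDegree_eq_zero_iff_eq_C] at h1
  have h2 := h () 0
  rw [h1] at h2 ⊢
  simp only [MvPolynomial.eval_C] at h2
  rw [h2, map_zero]

lemma base1 : Good 1 (fun j : Fin 2 => (![((j : ℕ) : k), 0, ((j : ℕ) : k), 1] : Fin 4 → k)) := by
  intro F hF h
  have hq : ∀ x y, MvPolynomial.eval (pq x y) F = 0 := by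
    intro x y
    refine zero_x hF y (Finset.range 2) (by simp) ?_ x
    intro n hn
    have := h ⟨n, by simpa using hn⟩ y
    simpa [ln_vert] using this
  have hF2 : F ∈ VV k (0 + 2) := by
    rw [mem_VV] at hF ⊢
    omega
  obtain ⟨G, hG, hFG⟩ := dvd_of_vanish hF2 hq
  have h1 : G.totalDegree = 0 := by have := mem_VV.1 hG; omega
  rw [MvPolynomial.totalDegree_eq_zero_iff_eq_C] at h1
  have h2 := zero_ln hF ![0, 0, 1, 1] (Finset.range 2) (by simp) (by
    intro n hn
    have hn : n < 2 := by simpa using hn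
    interval_cases n
    · rw [Nat.cast_zero, ln_zero]; exact hq _ _
    · rw [Nat.cast_one, ln_one]; exact hq _ _) 2
  rw [hFG, map_mul, eval_WW_ln, h1, MvPolynomial.eval_C] at h2
  have h3 : MvPolynomial.coeff 0 G = 0 := by
    simp only [Matrix.cons_val] at h2
    linear_combination (-1 / 2 : k) * h2
  rw [hFG, h1, h3]
  simp

lemma hh_ind (r : ℕ) :
    (∃ (ι : Type) (_ : Fintype ι), 2 * Fintype.card ι = (r + 1) * (3 * r + 2) ∧
      ∃ c : ι → Fin 4 → k, Good (3 * r) c) ∧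
    (∃ (ι : Type) (_ : Fintype ι), 2 * Fintype.card ι = (r + 1) * (3 * r + 4) ∧
      ∃ c : ι → Fin 4 → k, Good (3 * r + 1) c) := by
  induction r with
  | zero =>
    exact ⟨⟨Unit, inferInstance, by simp, _, base0⟩, ⟨Fin 2, inferInstance, by simp, _, base1⟩⟩
  | succ r ih =>
    obtain ⟨⟨ι, _, h0, c0, hc0⟩, ⟨ι', _, h1, c1, hc1⟩⟩ := ih
    refine ⟨?_, ?_⟩
    · obtain ⟨c, hc⟩ := step0 r h1 c1 hc1
      refine ⟨_, inferInstance, ?_, c, hc⟩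
      simp only [Fintype.card_sum, Fintype.card_fin]
      nlinarith
    · obtain ⟨c, hc⟩ := step1 r h0 c0 hc0
      refine ⟨_, inferInstance, ?_, c, hc⟩
      simp only [Fintype.card_sum, Fintype.card_prod, Fintype.card_fin, Fintype.card_unit]
      nlinarith

lemma six_choose (n : ℕ) : 6 * (n + 3).choose 3 = (n + 3) * (n + 2) * (n + 1) := by
  have h1 := Nat.add_one_mul_choose_eq (n + 2) 2
  have h2 := Nat.add_one_mul_choose_eq (n + 1) 1
  rw [Nat.choose_one_right] at h2
  simp only [Nat.add_assoc, Nat.reduceAdd] at h1 h2 ⊢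
  nlinarith

/-- a maximal configuration of lines and collinear points in degree `e` -/
lemma hh_all (e : ℕ) : ∃ (ι : Type) (_ : Fintype ι) (m : ℕ) (c : ι → Fin 4 → k) (cl : Fin 4 → k)
    (P : Fin m → k), m ≤ e ∧ Fintype.card ι * (e + 1) + m = (e + 3).choose 3 ∧
    ∀ F ∈ VV k e, VL c F → (∀ j, MvPolynomial.eval (ln cl (P j)) F = 0) → F = 0 := by
  have he := six_choose e
  obtain ⟨r, rfl | rfl | rfl⟩ : ∃ r, e = 3 * r ∨ e = 3 * r + 1 ∨ e = 3 * r + 2 :=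
    ⟨e / 3, by omega⟩
  · obtain ⟨ι, _, h, c, hc⟩ := (hh_ind (k := k) r).1
    refine ⟨ι, inferInstance, 0, c, 0, fun _ => 0, by simp, ?_, fun F hF hv _ => hc F hF hv⟩
    have : 6 * (Fintype.card ι * (3 * r + 1) + 0) = 3 * (2 * Fintype.card ι) * (3 * r + 1) := by ring
    rw [h] at this
    nlinarith
  · obtain ⟨ι, _, h, c, hc⟩ := (hh_ind (k := k) r).2
    refine ⟨ι, inferInstance, 0, c, 0, fun _ => 0, by simp, ?_, fun F hF hv _ => hc F hF hv⟩
    have : 6 * (Fintype.card ι * (3 * r + 1 + 1) + 0) = 3 * (2 * Fintype.card ι) * (3 * r + 2) := by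
      ring
    rw [h] at this
    nlinarith
  · obtain ⟨ι, _, h, c1, hc1⟩ := (hh_ind (k := k) r).1
    obtain ⟨c, hc⟩ := step2 r h c1 hc1
    refine ⟨_, inferInstance, r + 1, c, ![((3 * r + 4 : ℕ) : k), 0, ((3 * r + 4 : ℕ) : k), 1],
      fun j => ((j : ℕ) : k), by omega, ?_, ?_⟩
    · simp only [Fintype.card_sum, Fintype.card_fin]
      have : 6 * ((Fintype.card ι + (2 * r + 2)) * (3 * r + 2 + 1) + (r + 1)) =
        3 * (2 * Fintype.card ι + 4 * r + 4) * (3 * r + 3) + 6 * (r + 1) := by ring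
      rw [h] at this
      nlinarith
    · intro F hF hv hP
      apply hc F hF hv
      intro i hi
      have := hP ⟨i, hi⟩
      simpa [ln_vert] using this

/-- `s` lines and the right number of points -/
lemma hh_main (e s : ℕ) : ∃ (J : Type) (_ : Fintype J) (c : Fin s → Fin 4 → k) (P : J → Fin 3 → k),
    Fintype.card J = (e + 3).choose 3 - s * (e + 1) ∧
    ∀ F ∈ VV k e, VL c F → (∀ j, MvPolynomial.eval (P j) F = 0) → F = 0 := by
  obtain ⟨ι, _, m, c, cl, P, hm, hcard, h⟩ := hh_all (k := k) e
  rcases le_or_gt s (Fintype.card ι) with hs | hs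
  · have f : ι ≃ Fin s ⊕ Fin (Fintype.card ι - s) := Fintype.equivOfCardEq (by simp; omega)
    refine ⟨(Fin (Fintype.card ι - s) × Fin (e + 1)) ⊕ Fin m, inferInstance,
      fun i => c (f.symm (Sum.inl i)),
      Sum.elim (fun p => ln (c (f.symm (Sum.inr p.1))) ((p.2 : ℕ) : k)) (fun j => ln cl (P j)), ?_, ?_⟩
    · simp only [Fintype.card_sum, Fintype.card_prod, Fintype.card_fin]
      obtain ⟨u, hu⟩ := Nat.exists_eq_add_of_le hs
      rw [← hcard, hu, add_tsub_cancel_left, add_mul]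
      omega
    · intro F hF hv hP
      apply h F hF
      · intro i τ
        obtain ⟨a, rfl⟩ := f.symm.surjective i
        rcases a with a | a
        · exact hv a τ
        · refine zero_ln hF _ (Finset.range (e + 1)) (by simp) ?_ τ
          intro n hn
          exact hP (Sum.inl (a, ⟨n, by simpa using hn⟩))
      · intro j
        exact hP (Sum.inr j)
  · have f : ι ⊕ Fin (s - Fintype.card ι) ≃ Fin s := Fintype.equivOfCardEq (by simp; omega)
    refine ⟨Empty, inferInstance, fun i => Sum.elim c (fun _ => cl) (f.symm i), fun j => j.elim, ?_, ?_⟩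
    · obtain ⟨u, hu⟩ := Nat.exists_eq_add_of_le hs
      rw [← hcard, hu]
      simp only [Fintype.card_empty]
      symm
      rw [Nat.sub_eq_zero_iff_le]
      nlinarith
    · intro F hF hv _
      apply h F hF
      · intro i τ
        have := hv (f (Sum.inl i)) τ
        simpa using this
      · intro j
        have := hv (f (Sum.inr ⟨0, by omega⟩)) (P j)
        simpa using this

/-- homogeneous coordinates of the two points spanning the lines `c` and `c'` -/
def quad (c c' : Fin 4 → k) : Matrix (Fin 4) (Fin 4) k :=
  ![Fin.cons 1 (ln c 0), Fin.cons 1 (ln c 1), Fin.cons 1 (ln c' 0), Fin.cons 1 (ln c' 1)]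

lemma hh_gen (e s : ℕ) : ∃ (J : Type) (_ : Fintype J) (c : Fin s → Fin 4 → k) (P : J → Fin 3 → k),
    Fintype.card J = (e + 3).choose 3 - s * (e + 1) ∧
    (∀ F ∈ VV k e, VL c F → (∀ j, MvPolynomial.eval (P j) F = 0) → F = 0) ∧
    (∀ i, c i 3 ≠ c i 1) ∧ ∀ i j, i ≠ j → (quad (c i) (c j)).det ≠ 0 := by
  obtain ⟨J, _, c0, P, hJ, h0⟩ := hh_main (k := k) e s
  have hO1 : Opn (fun c : Fin s → Fin 4 → k => ∀ F : VV k e,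
      (VL c F.1 ∧ ∀ j, MvPolynomial.eval (P j) F.1 = 0) → F = 0) :=
    Opn.of_ps fun c hc => (PS.vl (VV k e).subtype hc).and (PS.all fun j => PS.evc (VV k e).subtype _)
  have hcons : ∀ (v : k → Fin 3 → k), (∀ i, PF fun t => v t i) →
      ∀ i : Fin 4, PF (fun t => (Fin.cons 1 (v t) : Fin 4 → k) i) := by
    intro v hv i
    refine Fin.cases ?_ (fun i => ?_) i
    · simpa using PF.const 1
    · simpa using hv i
  have hO2 : Opn (fun c : Fin s → Fin 4 → k => (∀ i, c i 3 - c i 1 ≠ 0) ∧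
      ∀ i j, i ≠ j → (quad (c i) (c j)).det ≠ 0) := by
    refine (Opn.all fun i => Opn.of_pf fun c hc => (hc i 3).sub (hc i 1)).and ?_
    refine Opn.all fun i => Opn.all fun j => ?_
    by_cases hij : i = j
    · intro _ _ _
      exact ⟨1, one_ne_zero, fun _ _ h => absurd hij h⟩
    · have : Opn (fun c : Fin s → Fin 4 → k => (quad (c i) (c j)).det ≠ 0) := by
        refine Opn.of_pf fun c hc => PF.det fun a b => ?_
        fin_cases a
        · exact hcons _ (PF.ln (hc i) 0) b
        · exact hcons _ (PF.ln (hc i) 1) b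
        · exact hcons _ (PF.ln (hc j) 0) b
        · exact hcons _ (PF.ln (hc j) 1) b
      simpa [hij] using this
  obtain ⟨c, h1, h2, h3⟩ := hO1.inter hO2 (c0 := c0)
    (c1 := fun i => ![((i : ℕ) : k), 0, ((i : ℕ) : k), 1])
    (by
      rintro ⟨F, hF⟩ ⟨hv, hP⟩
      simpa using h0 F hF hv hP)
    (by
      refine ⟨by simp, ?_⟩
      intro i j hij
      have hne : ((i : ℕ) : k) - ((j : ℕ) : k) ≠ 0 := by
        rw [sub_ne_zero]
        intro h
        exact hij (Fin.ext (by exact_mod_cast h))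
      have : (quad (![((i : ℕ) : k), 0, ((i : ℕ) : k), 1]) (![((j : ℕ) : k), 0, ((j : ℕ) : k), 1])).det
          = -(((i : ℕ) : k) - ((j : ℕ) : k)) ^ 2 ∨
          (quad (![((i : ℕ) : k), 0, ((i : ℕ) : k), 1]) (![((j : ℕ) : k), 0, ((j : ℕ) : k), 1])).det
          = (((i : ℕ) : k) - ((j : ℕ) : k)) ^ 2 := by
        left
        have hq : quad (![((i : ℕ) : k), 0, ((i : ℕ) : k), 1]) (![((j : ℕ) : k), 0, ((j : ℕ) : k), 1])
            = !![1, 0, ((i : ℕ) : k), 0; 1, ((i : ℕ) : k), ((i : ℕ) : k), 1;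
              1, 0, ((j : ℕ) : k), 0; 1, ((j : ℕ) : k), ((j : ℕ) : k), 1] := by
          ext a b
          fin_cases a <;> fin_cases b <;> simp [quad, ln, Fin.cons]
        rw [hq]
        simp [Matrix.det_succ_row_zero, Fin.sum_univ_succ, Fin.succAbove]
        ring
      rcases this with this | this
      · rw [this]; exact neg_ne_zero.2 (pow_ne_zero 2 hne)
      · rw [this]; exact pow_ne_zero 2 hne)
  refine ⟨J, inferInstance, c, P, hJ, ?_, fun i => sub_ne_zero.1 (h2 i), h3⟩
  intro F hF hv hP
  simpa using h1 ⟨F, hF⟩ ⟨hv, hP⟩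

/-! ### Homogeneous forms and the final statement -/

lemma finrank_hom (e : ℕ) :
    Module.finrank k (MvPolynomial.homogeneousSubmodule (Fin 4) k e) = (e + 3).choose 3 := by
  have h : MvPolynomial.homogeneousSubmodule (Fin 4) k e =
      MvPolynomial.restrictSupport k {d | d.degree = e} :=
    MvPolynomial.homogeneousSubmodule_eq_finsupp_supported _ _ _
  rw [h, Module.finrank_eq_nat_card_basis (MvPolynomial.basisRestrictSupport k _)]
  have h2 : ({d | d.degree = e} : Set (Fin 4 →₀ ℕ)) =
      ((Finset.univ : Finset (Fin 4)).finsuppAntidiag e : Set (Fin 4 →₀ ℕ)) := by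
    ext d
    simp [Finsupp.degree_eq_sum]
  rw [h2, Nat.card_coe_set_eq, Set.ncard_coe_finset, Finset.card_finsuppAntidiag_nat_eq_choose]
  simp only [Finset.card_univ, Fintype.card_fin]
  rw [show 4 + e - 1 = e + 3 by omega, Nat.choose_symm_add]

lemma eval_smul_hom {e : ℕ} {F : MvPolynomial (Fin 4) k} (hF : F.IsHomogeneous e) (a : k)
    (v : Fin 4 → k) : MvPolynomial.eval (a • v) F = a ^ e * MvPolynomial.eval v F := by
  rw [MvPolynomial.eval_eq', MvPolynomial.eval_eq', Finset.mul_sum]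
  refine Finset.sum_congr rfl fun m hm => ?_
  have h1 : m.degree = e := by
    rw [Finsupp.degree_eq_weight_one]
    exact hF (MvPolynomial.mem_support_iff.1 hm)
  rw [Finsupp.degree_eq_sum] at h1
  simp only [Pi.smul_apply, smul_eq_mul, mul_pow, Finset.prod_mul_distrib]
  rw [Finset.prod_pow_eq_pow_sum, h1]
  ring

/-- dehomogenization -/
lemma dehom {e : ℕ} {F : MvPolynomial (Fin 4) k} (hF : F.totalDegree ≤ e) :
    ∃ f ∈ VV k e, ∀ v : Fin 3 → k,
      MvPolynomial.eval v f = MvPolynomial.eval (Fin.cons 1 v : Fin 4 → k) F := by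
  let g : Fin 4 → MvPolynomial (Fin 3) k := Fin.cons 1 MvPolynomial.X
  have hg : ∀ i, (g i).totalDegree ≤ 1 := by
    intro i
    refine Fin.cases ?_ (fun i => ?_) i
    · simp [g]
    · simp [g]
  refine ⟨MvPolynomial.aeval g F, ?_, ?_⟩
  · rw [mem_VV, MvPolynomial.aeval_def, MvPolynomial.eval₂_eq']
    apply MvPolynomial.totalDegree_finsetSum_le
    intro m hm
    refine (MvPolynomial.totalDegree_mul _ _).trans ?_
    rw [MvPolynomial.algebraMap_eq, MvPolynomial.totalDegree_C, zero_add]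
    refine (MvPolynomial.totalDegree_finset_prod _ _).trans ?_
    have h1 : ∀ i ∈ Finset.univ, (g i ^ m i).totalDegree ≤ m i := by
      intro i _
      refine (MvPolynomial.totalDegree_pow _ _).trans ?_
      have := hg i
      nlinarith
    refine (Finset.sum_le_sum h1).trans ?_
    refine le_trans (le_trans (le_of_eq ?_) (MvPolynomial.le_totalDegree hm)) hF
    rw [Finsupp.sum_fintype _ _ (fun _ => rfl)]
  · intro v
    have : ∀ i, MvPolynomial.eval v (g i) = (Fin.cons 1 v : Fin 4 → k) i := by
      intro i
      refine Fin.cases ?_ (fun i => ?_) i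
      · simp [g]
      · simp [g]
    have key : ∀ H : MvPolynomial (Fin 4) k, MvPolynomial.eval v (MvPolynomial.aeval g H) =
        MvPolynomial.eval (Fin.cons 1 v : Fin 4 → k) H := by
      intro H
      induction H using MvPolynomial.induction_on with
      | C a => simp
      | add p q hp hq => simp only [map_add, hp, hq]
      | mul_X p i hp => simp only [map_mul, hp, MvPolynomial.aeval_X, this, MvPolynomial.eval_X]
    exact key F

lemma X_dvd_of_vanish {F : MvPolynomial (Fin 4) k}
    (h : ∀ v : Fin 3 → k, MvPolynomial.eval (Fin.cons 0 v : Fin 4 → k) F = 0) :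
    ∃ G, F = MvPolynomial.X 0 * G := by
  have h0 : (MvPolynomial.finSuccEquiv k 3 F).coeff 0 = 0 := by
    apply MvPolynomial.funext
    intro v
    rw [map_zero, ← h v, MvPolynomial.eval_eq_eval_mv_eval', ← Polynomial.coeff_zero_eq_eval_zero,
      Polynomial.coeff_map]
  obtain ⟨g, hg⟩ := Polynomial.X_dvd_iff.2 h0
  refine ⟨(MvPolynomial.finSuccEquiv k 3).symm g, ?_⟩
  apply (MvPolynomial.finSuccEquiv k 3).injective
  rw [hg, map_mul (MvPolynomial.finSuccEquiv k 3) (MvPolynomial.X 0) _,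
    AlgEquiv.apply_symm_apply, MvPolynomial.finSuccEquiv_X_zero]

/-- the plane at infinity -/
def Pinf (k : Type) [Field k] : Submodule k (Fin 4 → k) :=
  LinearMap.ker (LinearMap.proj 0 : (Fin 4 → k) →ₗ[k] k)

/-- the projective line attached to `c` -/
def LL (c : Fin 4 → k) : Submodule k (Fin 4 → k) :=
  Submodule.span k {(Fin.cons 1 (ln c 0) : Fin 4 → k), (Fin.cons 1 (ln c 1) : Fin 4 → k)}

lemma finrank_Pinf : Module.finrank k (Pinf k) = 3 := by
  have h := LinearMap.finrank_range_add_finrank_ker (LinearMap.proj 0 : (Fin 4 → k) →ₗ[k] k)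
  have h2 : LinearMap.range (LinearMap.proj 0 : (Fin 4 → k) →ₗ[k] k) = ⊤ :=
    LinearMap.range_eq_top.2 (LinearMap.proj_surjective 0)
  rw [h2] at h
  simp at h
  rw [Pinf]
  omega

lemma cons_ln_eq (c : Fin 4 → k) (t : k) : (Fin.cons 1 (ln c t) : Fin 4 → k) =
    (1 - t) • (Fin.cons 1 (ln c 0) : Fin 4 → k) + t • (Fin.cons 1 (ln c 1) : Fin 4 → k) := by
  ext i
  refine Fin.cases ?_ (fun i => ?_) i
  · simp
  · fin_cases i <;> simp [ln] <;> ring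

lemma cons_ln_mem (c : Fin 4 → k) (t : k) : (Fin.cons 1 (ln c t) : Fin 4 → k) ∈ LL c := by
  rw [cons_ln_eq]
  exact add_mem (Submodule.smul_mem _ _ (Submodule.subset_span (by simp)))
    (Submodule.smul_mem _ _ (Submodule.subset_span (by simp)))

lemma finrank_LL {c : Fin 4 → k} (h : c 3 ≠ c 1) : Module.finrank k (LL c) = 2 := by
  have hli : LinearIndependent k ![(Fin.cons 1 (ln c 0) : Fin 4 → k), Fin.cons 1 (ln c 1)] := by
    rw [LinearIndependent.pair_iff]
    intro a b hab
    have h0 : a + b = 0 := by simpa using congrFun hab 0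
    have h3 := congrFun hab (Fin.succ 2)
    simp [ln] at h3
    have h4 : b * (c 3 - c 1) = 0 := by linear_combination h3 - c 1 * h0
    have hb := (mul_eq_zero.1 h4).resolve_right (sub_ne_zero.2 h)
    subst hb
    simpa using h0
  have := finrank_span_eq_card hli
  rw [Fintype.card_fin] at this
  have hr : Set.range ![(Fin.cons 1 (ln c 0) : Fin 4 → k), Fin.cons 1 (ln c 1)] =
      {(Fin.cons 1 (ln c 0) : Fin 4 → k), (Fin.cons 1 (ln c 1) : Fin 4 → k)} := by
    ext x
    simp
    exact or_comm
  rw [hr] at this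
  exact this

lemma disj_LL {c c' : Fin 4 → k} (h : (quad c c').det ≠ 0) : LL c ⊓ LL c' = ⊥ := by
  rw [eq_bot_iff]
  rintro x ⟨h1, h2⟩
  obtain ⟨a, b, rfl⟩ := Submodule.mem_span_pair.1 h1
  obtain ⟨a', b', hab⟩ := Submodule.mem_span_pair.1 h2
  have hli := Matrix.linearIndependent_rows_of_det_ne_zero h
  rw [Fintype.linearIndependent_iff] at hli
  have := hli ![a, b, -a', -b'] (by
    simp only [Fin.sum_univ_four, Matrix.cons_val, quad, Matrix.row]
    have : a • (Fin.cons 1 (ln c 0) : Fin 4 → k) + b • (Fin.cons 1 (ln c 1) : Fin 4 → k) +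
        -a' • (Fin.cons 1 (ln c' 0) : Fin 4 → k) + -b' • (Fin.cons 1 (ln c' 1) : Fin 4 → k) = 0 := by
      rw [← hab]
      module
    exact this)
  have ha : a = 0 := by simpa using this 0
  have hb : b = 0 := by simpa using this 1
  simp [ha, hb]

lemma not_le_Pinf (c : Fin 4 → k) : ¬ LL c ≤ Pinf k := by
  intro h
  have := h (cons_ln_mem c 0)
  simp [Pinf] at this

lemma mem_van {N : ℕ} {V : Set (Fin N → k)} {F : MvPolynomial (Fin N) k} :
    F ∈ vanIdeal k N V ↔ ∀ v ∈ V, MvPolynomial.eval v F = 0 := Iff.rfl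

lemma hdim_eq {e s : ℕ} {J : Type} [Fintype J] (c : Fin s → Fin 4 → k) (P : J → Fin 3 → k)
    (hJ : Fintype.card J = (e + 3).choose 3 - s * (e + 1))
    (h : ∀ F ∈ VV k e, VL c F → (∀ j, MvPolynomial.eval (P j) F = 0) → F = 0) :
    hdim k 4 (vanIdeal k 4 ↑(Pinf k) ⊓ ⨅ i, vanIdeal k 4 ↑(LL (c i))) (e + 1) =
      (e + 3).choose 3 - s * (e + 1) := by
  rw [hdim]
  set A := Submodule.restrictScalars k (vanIdeal k 4 ↑(Pinf k) ⊓ ⨅ i, vanIdeal k 4 ↑(LL (c i)) :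
    Submodule (MvPolynomial (Fin 4) k) (MvPolynomial (Fin 4) k)) ⊓
      MvPolynomial.homogeneousSubmodule (Fin 4) k (e + 1) with hA
  have memA : ∀ F, F ∈ A ↔ ((∀ v : Fin 4 → k, v 0 = 0 → MvPolynomial.eval v F = 0) ∧
      ∀ i, ∀ v ∈ LL (c i), MvPolynomial.eval v F = 0) ∧ F.IsHomogeneous (e + 1) := by
    intro F
    rw [hA]
    simp only [Submodule.mem_inf, Submodule.restrictScalars_mem, Submodule.mem_iInf,
      MvPolynomial.mem_homogeneousSubmodule]
    rfl
  haveI hfin : ∀ n, Module.Finite k (MvPolynomial.homogeneousSubmodule (Fin 4) k n) := fun n =>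
    Module.Finite.iff_fg.2 (MvPolynomial.homogeneousSubmodule_fg _ _ n)
  haveI : Module.Finite k A := Submodule.finiteDimensional_of_le inf_le_right
  apply le_antisymm
  · -- upper bound
    let Φ : A →ₗ[k] (J → k) :=
      { toFun := fun F j => MvPolynomial.eval (Fin.cons 1 (P j) : Fin 4 → k) F.1
        map_add' := fun F G => by ext j; simp
        map_smul' := fun a F => by ext j; simp [MvPolynomial.smul_eval] }
    have hinj : Function.Injective Φ := by
      rw [injective_iff_map_eq_zero]
      rintro ⟨F, hF⟩ h0
      obtain ⟨⟨h1, h2⟩, h3⟩ := (memA F).1 hF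
      obtain ⟨G, hG⟩ := X_dvd_of_vanish (F := F) (fun v => h1 _ (by simp))
      have hGd : G.totalDegree ≤ e := by
        rcases eq_or_ne G 0 with hG0 | hG0
        · simp [hG0]
        have := MvPolynomial.totalDegree_mul_of_isDomain
          (MvPolynomial.X_ne_zero (R := k) (0 : Fin 4)) hG0
        rw [← hG, MvPolynomial.totalDegree_X] at this
        have := h3.totalDegree_le
        omega
      obtain ⟨f, hf, hfe⟩ := dehom hGd
      have hfF : ∀ v, MvPolynomial.eval v f = MvPolynomial.eval (Fin.cons 1 v : Fin 4 → k) F := by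
        intro v
        rw [hfe, hG]
        simp
      have hf0 : f = 0 := by
        apply h f hf
        · intro i τ
          rw [hfF]
          exact h2 i _ (cons_ln_mem _ _)
        · intro j
          rw [hfF]
          exact congrFun h0 j
      have : F = 0 := by
        apply MvPolynomial.funext
        intro v
        rw [map_zero]
        by_cases hv : v 0 = 0
        · exact h1 v hv
        · have : v = v 0 • (Fin.cons 1 (fun i => v (Fin.succ i) / v 0) : Fin 4 → k) := by
            ext i
            refine Fin.cases ?_ (fun i => ?_) i
            · simp
            · simp [mul_div_cancel₀ _ hv]
          rw [this, eval_smul_hom h3, ← hfF, hf0]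
          simp
      simpa using this
    have := LinearMap.finrank_le_finrank_of_injective hinj
    rw [Module.finrank_fintype_fun_eq_card, hJ] at this
    exact this
  · -- lower bound
    let Ψ : MvPolynomial.homogeneousSubmodule (Fin 4) k e →ₗ[k] (Fin s × Fin (e + 1) → k) :=
      { toFun := fun F p => MvPolynomial.eval
          (Fin.cons 1 (ln (c p.1) ((p.2 : ℕ) : k)) : Fin 4 → k) F.1
        map_add' := fun F G => by ext j; simp
        map_smul' := fun a F => by ext j; simp [MvPolynomial.smul_eval] }
    have hker : (e + 3).choose 3 - s * (e + 1) ≤ Module.finrank k (LinearMap.ker Ψ) := by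
      have h1 := LinearMap.finrank_range_add_finrank_ker Ψ
      have h2 := Submodule.finrank_le (LinearMap.range Ψ)
      rw [Module.finrank_fintype_fun_eq_card] at h2
      simp only [Fintype.card_prod, Fintype.card_fin] at h2
      rw [finrank_hom] at h1
      omega
    refine hker.trans ?_
    have hmem : ∀ F : LinearMap.ker Ψ, MvPolynomial.X 0 * F.1.1 ∈ A := by
      rintro ⟨⟨F, hF⟩, hF0⟩
      rw [MvPolynomial.mem_homogeneousSubmodule] at hF
      simp only
      have hF1 : ∀ i, ∀ n < e + 1,
          MvPolynomial.eval (Fin.cons 1 (ln (c i) (n : k)) : Fin 4 → k) F = 0 := by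
        intro i n hn
        exact congrFun (LinearMap.mem_ker.1 hF0) (i, ⟨n, hn⟩)
      obtain ⟨f, hf, hfe⟩ := dehom hF.totalDegree_le
      have hln : ∀ i t, MvPolynomial.eval (Fin.cons 1 (ln (c i) t) : Fin 4 → k) F = 0 := by
        intro i t
        rw [← hfe]
        refine zero_ln hf _ (Finset.range (e + 1)) (by simp) ?_ t
        intro n hn
        rw [hfe]
        exact hF1 i n (by simpa using hn)
      rw [memA]
      refine ⟨⟨?_, ?_⟩, ?_⟩
      · intro v hv
        simp [hv]
      · intro i v hv
        obtain ⟨a, b, rfl⟩ := Submodule.mem_span_pair.1 hv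
        by_cases hab : a + b = 0
        · simp [hab]
        · have : a • (Fin.cons 1 (ln (c i) 0) : Fin 4 → k) + b • (Fin.cons 1 (ln (c i) 1) : Fin 4 → k)
              = (a + b) • (Fin.cons 1 (ln (c i) (b / (a + b))) : Fin 4 → k) := by
            rw [cons_ln_eq (c i) (b / (a + b)), smul_add, smul_smul, smul_smul]
            congr 2
            · field_simp; ring
            · field_simp
          rw [this, map_mul, eval_smul_hom hF, hln]
          simp
      · rw [add_comm]
        exact (MvPolynomial.isHomogeneous_X _ _).mul hF
    let Θ : LinearMap.ker Ψ →ₗ[k] A :=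
      { toFun := fun F => ⟨MvPolynomial.X 0 * F.1.1, hmem F⟩
        map_add' := fun F G => by ext1; simp [mul_add]
        map_smul' := fun a F => by ext1; simp }
    apply LinearMap.finrank_le_finrank_of_injective (f := Θ)
    rw [injective_iff_map_eq_zero]
    intro F hF
    have h1 : MvPolynomial.X 0 * F.1.1 = 0 := congrArg Subtype.val hF
    have h2 := (mul_eq_zero.1 h1).resolve_left (MvPolynomial.X_ne_zero _)
    exact Subtype.ext (Subtype.ext h2)

end HH

/-- A generic union of one plane and `s` generic lines in `ℙ^3` has
bipolynomial Hilbert function. -/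
theorem stmt2 (k : Type) [Field k] [IsAlgClosed k] [CharZero k]
    (d s : ℕ) (hd : 1 ≤ d) :
    ∃ (Pl : Submodule k (Fin 4 → k)) (L : Fin s → Submodule k (Fin 4 → k)),
      Module.finrank k Pl = 3 ∧
      (∀ i, Module.finrank k (L i) = 2) ∧
      (∀ i j, i ≠ j → L i ⊓ L j = ⊥) ∧
      (∀ i, ¬ L i ≤ Pl) ∧
      (hdim k 4 (vanIdeal k 4 ↑Pl ⊓ ⨅ i, vanIdeal k 4 ↑(L i)) d : ℤ)
        = max 0 (((d+2).choose 3 : ℤ) - s * d) ∧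
      ((d+3).choose 3 : ℤ)
          - (hdim k 4 (vanIdeal k 4 ↑Pl ⊓ ⨅ i, vanIdeal k 4 ↑(L i)) d : ℤ)
        = min ((d+3).choose 3 : ℤ) (((d+2).choose 2 : ℤ) + s * d) := by
  obtain ⟨e, rfl⟩ : ∃ e, d = e + 1 := ⟨d - 1, by omega⟩
  obtain ⟨J, _, c, P, hJ, h, h3, hdet⟩ := hh_gen (k := k) e s
  have hd := hdim_eq c P hJ h
  refine ⟨Pinf k, fun i => LL (c i), finrank_Pinf, fun i => finrank_LL (h3 i),
    fun i j hij => disj_LL (hdet i j hij), fun i => not_le_Pinf _, ?_, ?_⟩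
  · rw [hd, show e + 1 + 2 = e + 3 by ring]
    have hc : (s : ℤ) * ((e + 1 : ℕ) : ℤ) = ((s * (e + 1) : ℕ) : ℤ) := by push_cast; ring
    rw [hc]
    omega
  · rw [hd, show e + 1 + 2 = e + 3 by ring]
    have hp : (e + 1 + 3).choose 3 = (e + 3).choose 2 + (e + 3).choose 3 :=
      Nat.choose_succ_succ (e + 3) 2
    rw [hp]
    have hc : (s : ℤ) * ((e + 1 : ℕ) : ℤ) = ((s * (e + 1) : ℕ) : ℤ) := by push_cast; ring
    rw [hc]
    omega
end
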